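/- Let f be a fake μ defined via the sequence (ε_j), and suppose there is an integer k ≥ 1 with ε_j = 0 for 1 ≤ j ≤ k−1 and ε_k = −1 (so f is of Möbius-type with initial index k). Then there exist constants c > 0 and C > 0 such that for all x ≥ 16: |Σ_{n≤x} f(n)| ≤ C x^{1/k} exp(−c (log x)^{3/5} (log log x)^{−1/5}). -/

import Mathlib

namespace MeanValue

open Finset

/-- The number of pairs `(x, y)` of tuples with `x i, y i ∈ A i` and
`∑ x i ^ j - ∑ y i ^ j = l j` for `1 ≤ j ≤ d`. -/
noncomputable def count {ι : Type*} [Fintype ι] [DecidableEq ι] (d : ℕ) (A : ι → Finset ℤ)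
    (l : Fin d → ℤ) : ℕ :=
  #{w ∈ Fintype.piFinset A ×ˢ Fintype.piFinset A |
    ∀ j : Fin d, ∑ i, w.1 i ^ (j + 1 : ℕ) - ∑ i, w.2 i ^ (j + 1 : ℕ) = l j}

/-- The point `(x, x², …, x^d)` of the moment curve modulo `M`. -/
def curve (d M : ℕ) (x : ℤ) : Fin d → ZMod M := fun j => ((x ^ (j + 1 : ℕ) : ℤ) : ZMod M)

section Fourier

lemma map_sum_char {κ G : Type*} [AddCommGroup G] (ψ : AddChar G ℂ) (s : Finset κ) (f : κ → G) :
    ψ (∑ i ∈ s, f i) = ∏ i ∈ s, ψ (f i) :=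
  map_prod ψ.toMonoidHom (fun i => Multiplicative.ofAdd (f i)) s

variable {ι : Type*} [Fintype ι] [DecidableEq ι]

lemma prod_normSq_eq (d M : ℕ) [NeZero M] (A : ι → Finset ℤ)
    (ψ : AddChar (Fin d → ZMod M) ℂ) :
    ((∏ i, ‖∑ x ∈ A i, ψ (curve d M x)‖ ^ 2 : ℝ) : ℂ) =
      ∑ w ∈ Fintype.piFinset A ×ˢ Fintype.piFinset A,
        ψ (fun j => ((∑ i, w.1 i ^ (j + 1 : ℕ) - ∑ i, w.2 i ^ (j + 1 : ℕ) : ℤ) : ZMod M)) := by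
  have h1 : ((∏ i, ‖∑ x ∈ A i, ψ (curve d M x)‖ ^ 2 : ℝ) : ℂ) =
      (∏ i, ∑ x ∈ A i, ψ (curve d M x)) * (∏ i, ∑ x ∈ A i, ψ (-curve d M x)) := by
    push_cast
    rw [← Finset.prod_mul_distrib]
    refine Finset.prod_congr rfl fun i _ => ?_
    rw [← Complex.mul_conj', map_sum]
    simp_rw [AddChar.map_neg_eq_conj]
  rw [h1, Finset.prod_univ_sum, Finset.prod_univ_sum, Finset.sum_mul_sum, Finset.sum_product]
  refine Finset.sum_congr rfl fun x _ => Finset.sum_congr rfl fun y _ => ?_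
  rw [← map_sum_char, ← map_sum_char, ← AddChar.map_add_eq_mul]
  congr 1
  ext j
  simp [curve, Finset.sum_apply, sub_eq_add_neg]

/-- For a large modulus the count is a mean value over characters. -/
lemma exists_modulus (d : ℕ) (A : ι → Finset ℤ) (l : Fin d → ℤ) :
    ∃ M₀ : ℕ, ∀ M : ℕ, M₀ < M → ∀ _ : NeZero M,
      ((M : ℂ) ^ d * count d A l =
      ∑ ψ : AddChar (Fin d → ZMod M) ℂ, ψ (fun j => ((-l j : ℤ) : ZMod M)) *
        ((∏ i, ‖∑ x ∈ A i, ψ (curve d M x)‖ ^ 2 : ℝ) : ℂ)) := by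
  classical
  set S := Fintype.piFinset A ×ˢ Fintype.piFinset A with hS
  let e : (ι → ℤ) × (ι → ℤ) → Fin d → ℤ := fun w j =>
    ∑ i, w.1 i ^ (j + 1 : ℕ) - ∑ i, w.2 i ^ (j + 1 : ℕ) - l j
  refine ⟨∑ w ∈ S, ∑ j, (e w j).natAbs, fun M hM _ => ?_⟩
  have hsmall : ∀ w ∈ S, ((fun j => ((e w j : ℤ) : ZMod M)) = (0 : Fin d → ZMod M)) ↔
      ∀ j : Fin d, ∑ i, w.1 i ^ (j + 1 : ℕ) - ∑ i, w.2 i ^ (j + 1 : ℕ) = l j := by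
    intro w hw
    constructor
    · intro h j
      have h1 : ((e w j : ℤ) : ZMod M) = 0 := congrFun h j
      rw [ZMod.intCast_zmod_eq_zero_iff_dvd] at h1
      have h2 : (e w j).natAbs < M := by
        refine lt_of_le_of_lt ?_ hM
        refine le_trans ?_ (Finset.single_le_sum
          (f := fun w => ∑ j, (e w j).natAbs) (fun _ _ => Nat.zero_le _) hw)
        exact Finset.single_le_sum (f := fun j => (e w j).natAbs)
          (fun _ _ => Nat.zero_le _) (Finset.mem_univ j)
      have h3 : e w j = 0 := Int.eq_zero_of_abs_lt_dvd h1 (by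
        rw [Int.abs_eq_natAbs]; exact_mod_cast h2)
      simp only [e] at h3
      linarith
    · intro h
      ext j
      simp only [e, h j, sub_self, Int.cast_zero, Pi.zero_apply]
  have h1 : ∀ ψ : AddChar (Fin d → ZMod M) ℂ, ψ (fun j => ((-l j : ℤ) : ZMod M)) *
        ((∏ i, ‖∑ x ∈ A i, ψ (curve d M x)‖ ^ 2 : ℝ) : ℂ) =
      ∑ w ∈ S, ψ (fun j => ((e w j : ℤ) : ZMod M)) := by
    intro ψ
    rw [prod_normSq_eq, Finset.mul_sum]
    refine Finset.sum_congr rfl fun w _ => ?_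
    rw [← AddChar.map_add_eq_mul]
    congr 1
    ext j
    simp only [Pi.add_apply, e]
    push_cast
    ring
  simp_rw [h1]
  rw [Finset.sum_comm]
  simp_rw [AddChar.sum_apply_eq_ite]
  rw [Finset.sum_ite, Finset.sum_const_zero, add_zero, Finset.sum_const, nsmul_eq_mul, count,
    mul_comm]
  congr 2
  · congr 1
    apply Finset.filter_congr
    intro w hw
    exact (hsmall w hw).symm
  · simp [ZMod.card]

lemma exists_modulus_zero (d : ℕ) (A : ι → Finset ℤ) :
    ∃ M₀ : ℕ, ∀ M : ℕ, M₀ < M → ∀ _ : NeZero M,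
      ((M : ℝ) ^ d * count d A 0 =
      ∑ ψ : AddChar (Fin d → ZMod M) ℂ, ∏ i, ‖∑ x ∈ A i, ψ (curve d M x)‖ ^ 2) := by
  obtain ⟨M₀, h⟩ := exists_modulus d A 0
  refine ⟨M₀, fun M hM _ => ?_⟩
  have h1 := h M hM inferInstance
  have h2 : (fun j : Fin d => ((-(0 : Fin d → ℤ) j : ℤ) : ZMod M)) = 0 := by ext; simp
  simp_rw [h2, AddChar.map_zero_eq_one, one_mul] at h1
  exact_mod_cast h1

lemma count_le_count_zero (d : ℕ) (A : ι → Finset ℤ) (l : Fin d → ℤ) :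
    count d A l ≤ count d A 0 := by
  obtain ⟨M₁, h1⟩ := exists_modulus d A l
  obtain ⟨M₂, h2⟩ := exists_modulus_zero d A
  set M := M₁ + M₂ + 1 with hM
  have : NeZero M := ⟨by omega⟩
  have e1 := h1 M (by omega) inferInstance
  have e2 := h2 M (by omega) inferInstance
  have hMpos : (0 : ℝ) < (M : ℝ) ^ d := by positivity
  have : (M : ℝ) ^ d * count d A l ≤ (M : ℝ) ^ d * count d A 0 := by
    rw [e2]
    calc (M : ℝ) ^ d * count d A l = ‖((M : ℂ) ^ d * count d A l)‖ := by simp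
      _ ≤ _ := by
        rw [e1]
        refine (norm_sum_le _ _).trans (Finset.sum_le_sum fun ψ _ => ?_)
        rw [norm_mul, AddChar.norm_apply, one_mul, Complex.norm_real, Real.norm_of_nonneg]
        positivity
  exact_mod_cast le_of_mul_le_mul_left this hMpos

end Fourier

section Affine

lemma sum_shift_pow_eq {ι : Type*} [Fintype ι] {d : ℕ} {x y : ι → ℤ} (b : ℤ)
    (h : ∀ j : Fin d, ∑ i, x i ^ (j + 1 : ℕ) = ∑ i, y i ^ (j + 1 : ℕ)) (j : Fin d) :
    ∑ i, (x i - b) ^ (j + 1 : ℕ) = ∑ i, (y i - b) ^ (j + 1 : ℕ) := by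
  have h' : ∀ k ≤ d, ∑ i, x i ^ k = ∑ i, y i ^ k := by
    intro k hk
    rcases k with _ | k
    · simp
    · exact h ⟨k, by omega⟩
  simp_rw [sub_eq_add_neg, add_pow]
  rw [Finset.sum_comm, Finset.sum_comm (s := univ)]
  refine Finset.sum_congr rfl fun k hk => ?_
  rw [← Finset.sum_mul, ← Finset.sum_mul, ← Finset.sum_mul, ← Finset.sum_mul]
  rw [h' k]
  have := j.2
  simp only [Finset.mem_range] at hk
  omega

lemma count_image_affine_le {ι : Type*} [Fintype ι] [DecidableEq ι] (d : ℕ) (A : ι → Finset ℤ)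
    (b : ι → ℤ) (b₀ q : ℤ) (hb : ∀ i, b i = b₀) (hq : q ≠ 0) :
    count d (fun i => (A i).image fun z => b i + q * z) 0 ≤ count d A 0 := by
  classical
  obtain rfl : b = fun _ => b₀ := funext hb
  unfold count
  let g : (ι → ℤ) → (ι → ℤ) := fun z i => b₀ + q * z i
  have hsub : ({w ∈ Fintype.piFinset (fun i => (A i).image fun z => b₀ + q * z) ×ˢ
      Fintype.piFinset (fun i => (A i).image fun z => b₀ + q * z) |
      ∀ j : Fin d, ∑ i, w.1 i ^ (j + 1 : ℕ) - ∑ i, w.2 i ^ (j + 1 : ℕ) = (0 : Fin d → ℤ) j} :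
        Finset ((ι → ℤ) × (ι → ℤ))) ⊆ Finset.image (fun w => (g w.1, g w.2))
      {w ∈ Fintype.piFinset A ×ˢ Fintype.piFinset A |
      ∀ j : Fin d, ∑ i, w.1 i ^ (j + 1 : ℕ) - ∑ i, w.2 i ^ (j + 1 : ℕ) = (0 : Fin d → ℤ) j} := ?_
  · exact (Finset.card_le_card hsub).trans Finset.card_image_le
  rintro ⟨x, y⟩ hw
  simp only [Finset.mem_filter, Finset.mem_product, Fintype.mem_piFinset, Finset.mem_image] at hw
  obtain ⟨⟨hx, hy⟩, hw⟩ := hw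
  choose x' hx' hxe using hx
  choose y' hy' hye using hy
  simp only [Finset.mem_image, Finset.mem_filter, Finset.mem_product, Fintype.mem_piFinset]
  refine ⟨(x', y'), ⟨⟨hx', hy'⟩, fun j => ?_⟩, ?_⟩
  · have h1 := sum_shift_pow_eq (d := d) (x := x) (y := y) b₀
      (fun j => by have := hw j; simp only [Pi.zero_apply] at this; linarith) j
    have e1 : ∀ i, x i - b₀ = q * x' i := fun i => by rw [← hxe i]; ring
    have e2 : ∀ i, y i - b₀ = q * y' i := fun i => by rw [← hye i]; ring
    simp_rw [e1, e2, mul_pow, ← Finset.mul_sum] at h1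
    have := mul_left_cancel₀ (pow_ne_zero _ hq) h1
    simp [this]
  · simp only [g, Prod.mk.injEq]
    exact ⟨funext fun i => hxe i, funext fun i => hye i⟩

end Affine

section Hensel

/-- Hensel-type uniqueness: tuples that are distinct and congruent modulo `p` and whose first `d`
power sums agree modulo `p ^ n` are congruent modulo `p ^ n`. -/
lemma dvd_sub_of_power_sums {p d : ℕ} [hp : Fact p.Prime] (hd : d < p) {u v : Fin d → ℤ}
    (huv : ∀ i, (p : ℤ) ∣ v i - u i)
    (hinj : Function.Injective fun i => (u i : ZMod p)) :
    ∀ n : ℕ, (∀ j : Fin d, (p : ℤ) ^ n ∣ ∑ i, v i ^ (j + 1 : ℕ) - ∑ i, u i ^ (j + 1 : ℕ)) →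
      ∀ i, (p : ℤ) ^ n ∣ v i - u i := by
  intro n
  induction n with
  | zero => intro _ i; simp
  | succ k ih =>
    intro h
    rcases Nat.eq_zero_or_pos k with rfl | hk
    · simpa using huv
    have hdiv := ih fun j => (pow_dvd_pow _ (Nat.le_succ k)).trans (h j)
    choose w hw using hdiv
    have hp0 : (p : ℤ) ^ k ≠ 0 := pow_ne_zero _ (by exact_mod_cast hp.out.ne_zero)
    have hexp : ∀ (j : Fin d) (i : Fin d), (p : ℤ) ^ (k + 1) ∣
        v i ^ (j + 1 : ℕ) - u i ^ (j + 1 : ℕ) - (j + 1) * u i ^ (j : ℕ) * ((p : ℤ) ^ k * w i) := by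
      intro j i
      have hv : v i = u i + p ^ k * w i := by linarith [hw i]
      obtain ⟨c, hc⟩ := Polynomial.binomExpansion (Polynomial.X ^ (j + 1 : ℕ) : Polynomial ℤ)
        (u i) ((p : ℤ) ^ k * w i)
      simp only [Polynomial.eval_pow, Polynomial.eval_X, Polynomial.derivative_X_pow,
        Polynomial.eval_mul, Polynomial.eval_C] at hc
      rw [hv, hc]
      refine Dvd.dvd.trans (b := ((p : ℤ) ^ k * w i) ^ 2)
        ((pow_dvd_pow (p : ℤ) (show k + 1 ≤ k * 2 by omega)).trans
          ⟨w i ^ 2, by rw [mul_pow, pow_mul]⟩) ⟨c, ?_⟩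
      push_cast
      ring
    have hsum : ∀ j : Fin d, (∑ i, (w i : ZMod p) * (u i : ZMod p) ^ (j : ℕ)) = 0 := by
      intro j
      have h1 : (p : ℤ) ^ (k + 1) ∣ ∑ i, (j + 1) * u i ^ (j : ℕ) * ((p : ℤ) ^ k * w i) := by
        have := Finset.dvd_sum (s := Finset.univ) fun i _ => hexp j i
        rw [Finset.sum_sub_distrib, Finset.sum_sub_distrib] at this
        exact (dvd_sub_right (h j)).1 this
      have h2 : ∑ i, ((j : ℤ) + 1) * u i ^ (j : ℕ) * ((p : ℤ) ^ k * w i) =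
          (p : ℤ) ^ k * (((j + 1 : ℕ) : ℤ) * ∑ i, w i * u i ^ (j : ℕ)) := by
        rw [Finset.mul_sum, Finset.mul_sum]
        refine Finset.sum_congr rfl fun i _ => ?_
        push_cast
        ring
      rw [h2, pow_succ] at h1
      have h3 := (mul_dvd_mul_iff_left hp0).1 h1
      have h4 : ((((j + 1 : ℕ) : ℤ) * ∑ i, w i * u i ^ (j : ℕ) : ℤ) : ZMod p) = 0 :=
        (ZMod.intCast_zmod_eq_zero_iff_dvd _ p).2 h3
      push_cast at h4
      rcases mul_eq_zero.1 h4 with h5 | h5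
      · exfalso
        have h6 : (((j + 1 : ℕ)) : ZMod p) = 0 := by exact_mod_cast h5
        rw [ZMod.natCast_eq_zero_iff] at h6
        have := Nat.le_of_dvd (by omega) h6
        have := j.2
        omega
      · exact h5
    have hw0 := Matrix.eq_zero_of_forall_pow_sum_mul_pow_eq_zero hinj hsum
    intro i
    have h7 : ((w i : ℤ) : ZMod p) = 0 := congrFun hw0 i
    obtain ⟨c, hc⟩ := (ZMod.intCast_zmod_eq_zero_iff_dvd _ p).1 h7
    rw [hw i, hc]
    exact ⟨c, by ring⟩

end Hensel

section System

/-- The number of solutions of a triangular system of congruences in tuples with prescribed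
distinct residues modulo `p`. -/
lemma card_system_le {p d m L : ℕ} [hp : Fact p.Prime] (hd : d < p) (hL : L ≤ m * d)
    (A : Fin d → Finset ℤ) (a : Fin d → ZMod p) (ha : Function.Injective a)
    (hA : ∀ i, ∀ x ∈ A i, (0 ≤ x ∧ x < (p : ℤ) ^ L) ∧ (x : ZMod p) = a i) (b : ℤ)
    (c : Fin d → ℤ) :
    #{u ∈ Fintype.piFinset A | ∀ j : Fin d,
      ((p : ℤ) ^ m) ^ (j + 1 : ℕ) ∣ ∑ i, (u i - b) ^ (j + 1 : ℕ) - c j} ≤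
      (p ^ m) ^ (d * (d - 1) / 2) := by
  classical
  set q : ℤ := (p : ℤ) ^ m with hq
  have hp0 : (0 : ℤ) < p := by exact_mod_cast hp.out.pos
  have hq0 : 0 < q := by positivity
  let f : (Fin d → ℤ) → Fin d → ℤ := fun u j =>
    ((∑ i, (u i - b) ^ (j + 1 : ℕ) - c j) / q ^ (j + 1 : ℕ)) % q ^ (d - 1 - j : ℕ)
  let T : Fin d → Finset ℤ := fun j => Finset.Ico 0 (q ^ (d - 1 - j : ℕ))
  have hcard : #(Fintype.piFinset T) = (p ^ m) ^ (d * (d - 1) / 2) := by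
    rw [Fintype.card_piFinset]
    have : ∀ j : Fin d, #(T j) = (p ^ m) ^ (d - 1 - j : ℕ) := by
      intro j
      simp only [T, Int.card_Ico, sub_zero, hq]
      exact_mod_cast Int.toNat_natCast ((p ^ m) ^ (d - 1 - j : ℕ))
    simp_rw [this]
    rw [Finset.prod_pow_eq_pow_sum, Fin.sum_univ_eq_sum_range (fun j => d - 1 - j),
      Finset.sum_range_reflect (fun j => j), Finset.sum_range_id]
  rw [← hcard]
  refine Finset.card_le_card_of_injOn f ?_ ?_
  · intro u _
    simp only [Finset.mem_coe, Fintype.mem_piFinset, T, Finset.mem_Ico, f]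
    intro j
    have : (0 : ℤ) < q ^ (d - 1 - j : ℕ) := by positivity
    exact ⟨Int.emod_nonneg _ this.ne', Int.emod_lt_of_pos _ this⟩
  · intro u hu v hv huv
    simp only [Finset.coe_filter, Set.mem_ofPred_eq, Fintype.mem_piFinset] at hu hv
    have hdiv : ∀ j : Fin d, (p : ℤ) ^ (m * d) ∣
        ∑ i, (v i - b) ^ (j + 1 : ℕ) - ∑ i, (u i - b) ^ (j + 1 : ℕ) := by
      intro j
      obtain ⟨x, hx⟩ := hu.2 j
      obtain ⟨y, hy⟩ := hv.2 j
      have h1 := congrFun huv j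
      have hqj : q ^ (j + 1 : ℕ) ≠ 0 := by positivity
      simp only [f] at h1
      rw [hx, hy, Int.mul_ediv_cancel_left _ hqj, Int.mul_ediv_cancel_left _ hqj] at h1
      obtain ⟨z, hz⟩ := (Int.ModEq.dvd h1 : q ^ (d - 1 - j : ℕ) ∣ y - x)
      refine ⟨z, ?_⟩
      have : ∑ i, (v i - b) ^ (j + 1 : ℕ) - ∑ i, (u i - b) ^ (j + 1 : ℕ) =
        q ^ (j + 1 : ℕ) * (y - x) := by linarith
      rw [this, hz, ← mul_assoc, ← pow_add, pow_mul, ← hq]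
      congr 2
      have := j.2
      omega
    have hres : ∀ i, (p : ℤ) ∣ (v i - b) - (u i - b) := by
      intro i
      have : v i - b - (u i - b) = v i - u i := by ring
      rw [this, ← ZMod.intCast_zmod_eq_zero_iff_dvd]
      push_cast
      rw [(hA i _ (hu.1 i)).2, (hA i _ (hv.1 i)).2, sub_self]
    have hinj : Function.Injective fun i => ((u i - b : ℤ) : ZMod p) := by
      intro i i' h
      apply ha
      simp only [Int.cast_sub] at h
      rw [← (hA i _ (hu.1 i)).2, ← (hA i' _ (hu.1 i')).2]
      exact sub_left_injective h
    have key := dvd_sub_of_power_sums hd hres hinj (m * d) hdiv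
    ext i
    have h1 := key i
    have h2 : (p : ℤ) ^ L ∣ v i - u i := by
      have : v i - b - (u i - b) = v i - u i := by ring
      rw [this] at h1
      exact (pow_dvd_pow _ hL).trans h1
    have h3 := (hA i _ (hu.1 i)).1
    have h4 := (hA i _ (hv.1 i)).1
    have := Int.eq_zero_of_abs_lt_dvd h2 (abs_lt.2 ⟨by linarith, by linarith⟩)
    linarith

lemma card_filter_sum_elim {s d : ℕ} (A : Fin d → Finset ℤ) (B : Finset ℤ) :
    count d (Sum.elim A fun _ : Fin s => B) 0 =
      ∑ w ∈ Fintype.piFinset A ×ˢ Fintype.piFinset A,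
        count d (fun _ : Fin s => B)
          (fun j => ∑ i, w.2 i ^ (j + 1 : ℕ) - ∑ i, w.1 i ^ (j + 1 : ℕ)) := by
  classical
  simp only [count]
  rw [← Finset.card_sigma]
  refine Finset.card_nbij'
    (fun w => ⟨(fun i => w.1 (Sum.inl i), fun i => w.2 (Sum.inl i)),
      (fun i => w.1 (Sum.inr i), fun i => w.2 (Sum.inr i))⟩)
    (fun w => (Sum.elim w.1.1 w.2.1, Sum.elim w.1.2 w.2.2)) ?_ ?_ ?_ ?_
  · rintro ⟨x, y⟩ h
    simp only [Finset.coe_filter, Finset.mem_product, Fintype.mem_piFinset, Set.mem_ofPred_eq,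
      Sum.forall, Sum.elim_inl, Sum.elim_inr, Fintype.sum_sum_type, Pi.zero_apply] at h
    simp only [Finset.coe_sigma, Set.mem_sigma_iff, Finset.mem_coe, Finset.mem_filter,
      Finset.mem_product, Fintype.mem_piFinset]
    refine ⟨⟨h.1.1.1, h.1.2.1⟩, ⟨h.1.1.2, h.1.2.2⟩, fun j => ?_⟩
    linarith [h.2 j]
  · rintro ⟨⟨x, y⟩, ⟨z, w⟩⟩ h
    simp only [Finset.coe_sigma, Set.mem_sigma_iff, Finset.mem_coe, Finset.mem_filter,
      Finset.mem_product, Fintype.mem_piFinset] at h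
    simp only [Finset.coe_filter, Finset.mem_product, Fintype.mem_piFinset, Set.mem_ofPred_eq,
      Sum.forall, Sum.elim_inl, Sum.elim_inr, Fintype.sum_sum_type, Pi.zero_apply]
    refine ⟨⟨⟨h.1.1, h.2.1.1⟩, ⟨h.1.2, h.2.1.2⟩⟩, fun j => ?_⟩
    linarith [h.2.2 j]
  · rintro ⟨x, y⟩ _
    simp only [Prod.mk.injEq]
    constructor <;> ext i <;> rcases i with i | i <;> rfl
  · rintro ⟨⟨x, y⟩, ⟨z, w⟩⟩ _
    rfl

lemma count_sum_elim_le {p s d m L : ℕ} [hp : Fact p.Prime] (hd : d < p) (hL : L ≤ m * d)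
    (A : Fin d → Finset ℤ) (a : Fin d → ZMod p) (ha : Function.Injective a)
    (hA : ∀ i, ∀ x ∈ A i, (0 ≤ x ∧ x < (p : ℤ) ^ L) ∧ (x : ZMod p) = a i) (b : ℤ)
    (B : Finset ℤ) (hB : ∀ x ∈ B, (p : ℤ) ^ m ∣ x - b) :
    count d (Sum.elim A fun _ : Fin s => B) 0 ≤
      (∏ i, #(A i)) * (p ^ m) ^ (d * (d - 1) / 2) * count d (fun _ : Fin s => B) 0 := by
  classical
  rw [card_filter_sum_elim]
  set W := Fintype.piFinset A ×ˢ Fintype.piFinset A with hW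
  let P : (Fin d → ℤ) × (Fin d → ℤ) → Prop := fun w => ∀ j : Fin d,
      ((p : ℤ) ^ m) ^ (j + 1 : ℕ) ∣ ∑ i, (w.1 i - b) ^ (j + 1 : ℕ) -
        ∑ i, (w.2 i - b) ^ (j + 1 : ℕ)
  have h0 : ∀ w ∈ W, ¬ P w → count d (fun _ : Fin s => B)
      (fun j => ∑ i, w.2 i ^ (j + 1 : ℕ) - ∑ i, w.1 i ^ (j + 1 : ℕ)) = 0 := by
    intro w _ hP
    by_contra hne
    apply hP
    obtain ⟨⟨z, y⟩, hzy⟩ := Finset.card_pos.1 (Nat.pos_of_ne_zero hne)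
    simp only [Finset.mem_filter, Finset.mem_product, Fintype.mem_piFinset] at hzy
    obtain ⟨⟨hz, hy⟩, he⟩ := hzy
    have hs := sum_shift_pow_eq (x := Sum.elim w.1 z) (y := Sum.elim w.2 y) (d := d) b (by
      intro j
      simp only [Fintype.sum_sum_type, Sum.elim_inl, Sum.elim_inr]
      linarith [he j])
    intro j
    have := hs j
    simp only [Fintype.sum_sum_type, Sum.elim_inl, Sum.elim_inr] at this
    have e : ∑ i, (w.1 i - b) ^ (j + 1 : ℕ) - ∑ i, (w.2 i - b) ^ (j + 1 : ℕ) =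
      ∑ i, (y i - b) ^ (j + 1 : ℕ) - ∑ i, (z i - b) ^ (j + 1 : ℕ) := by linarith
    rw [e]
    exact dvd_sub (Finset.dvd_sum fun i _ => pow_dvd_pow_of_dvd (hB _ (hy i)) _)
      (Finset.dvd_sum fun i _ => pow_dvd_pow_of_dvd (hB _ (hz i)) _)
  calc _ ≤ ∑ w ∈ W, if P w then count d (fun _ : Fin s => B) 0 else 0 := by
        refine Finset.sum_le_sum fun w hw => ?_
        split_ifs with h
        · exact count_le_count_zero _ _ _
        · exact (h0 w hw h).le
    _ = #{w ∈ W | P w} * count d (fun _ : Fin s => B) 0 := by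
        rw [← Finset.sum_filter, Finset.sum_const, smul_eq_mul]
    _ ≤ _ := by
        refine Nat.mul_le_mul_right _ ?_
        have hfib : #{w ∈ W | P w} = ∑ v ∈ Fintype.piFinset A,
            #{u ∈ Fintype.piFinset A | P (u, v)} := by
          simp only [hW, Finset.card_filter, Finset.sum_product_right]
        rw [hfib]
        refine (Finset.sum_le_card_nsmul _ _ _ fun v _ =>
          card_system_le hd hL A a ha hA b fun j => ∑ i, (v i - b) ^ (j + 1 : ℕ)).trans ?_
        rw [Fintype.card_piFinset, smul_eq_mul]

end System

section Pigeonhole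

lemma norm_sum_pow_le_of_pigeonhole {Z : Type*} [Fintype Z] [DecidableEq Z] (z : Z → ℂ) {d : ℕ}
    (hd : 1 ≤ d) (s : ℕ) :
    ‖∑ a, z a‖ ^ (2 * (s + d)) ≤
      (2 * d) ^ (2 * (s + d)) * ∑ a, ‖z a‖ ^ (2 * (s + d)) +
      (2 * Fintype.card Z) ^ (2 * d) * (‖∑ a, z a‖ ^ (2 * s) *
        ∑ f : Fin d ↪ Z, ∏ i, ‖z (f i)‖ ^ 2) := by
  classical
  set F := ‖∑ a, z a‖ with hF
  have hF0 : 0 ≤ F := norm_nonneg _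
  set p := Fintype.card Z with hp
  rcases Nat.eq_zero_or_pos p with hp0 | hp0
  · have : IsEmpty Z := Fintype.card_eq_zero_iff.1 hp0
    have : F = 0 := by rw [hF]; simp
    rw [this, zero_pow (by omega)]
    positivity
  have hpR : (0 : ℝ) < p := by exact_mod_cast hp0
  have hdR : (1 : ℝ) ≤ d := by exact_mod_cast hd
  set T : Finset Z := {a | F / (2 * p) ≤ ‖z a‖} with hT
  rcases le_or_gt d #T with h | h
  · have hcard : Fintype.card (Fin d) ≤ Fintype.card T := by simpa using h
    obtain ⟨g⟩ := Function.Embedding.nonempty_of_card_le hcard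
    let f : Fin d ↪ Z := g.trans (Function.Embedding.subtype _)
    have h1 : (F / (2 * p)) ^ (2 * d) ≤ ∏ i, ‖z (f i)‖ ^ 2 := by
      calc (F / (2 * p)) ^ (2 * d) = ∏ _i : Fin d, (F / (2 * p)) ^ 2 := by
            simp [pow_mul]
        _ ≤ _ := by
            refine Finset.prod_le_prod (fun _ _ => by positivity) fun i _ => ?_
            exact pow_le_pow_left₀ (by positivity) (Finset.mem_filter.1 (g i).2).2 2
    have h2 : ∏ i, ‖z (f i)‖ ^ 2 ≤ ∑ f : Fin d ↪ Z, ∏ i, ‖z (f i)‖ ^ 2 :=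
      Finset.single_le_sum (f := fun f : Fin d ↪ Z => ∏ i, ‖z (f i)‖ ^ 2)
        (fun _ _ => by positivity) (Finset.mem_univ f)
    have h3 : F ^ (2 * (s + d)) = (2 * p) ^ (2 * d) * (F ^ (2 * s) * (F / (2 * p)) ^ (2 * d)) := by
      rw [div_pow]
      field_simp
      ring
    have h4 : (0 : ℝ) ≤ (2 * d) ^ (2 * (s + d)) * ∑ a, ‖z a‖ ^ (2 * (s + d)) := by positivity
    have h5 : (2 * p : ℝ) ^ (2 * d) * (F ^ (2 * s) * (F / (2 * p)) ^ (2 * d)) ≤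
      (2 * p) ^ (2 * d) * (F ^ (2 * s) * ∑ f : Fin d ↪ Z, ∏ i, ‖z (f i)‖ ^ 2) := by
      have := h1.trans h2
      gcongr
    linarith
  · have h1 : F ≤ ∑ a ∈ T, ‖z a‖ + F / 2 := by
      have e : F ≤ ∑ a, ‖z a‖ := norm_sum_le _ _
      rw [← Finset.sum_add_sum_compl T] at e
      refine e.trans (add_le_add_right ?_ _)
      calc ∑ a ∈ Tᶜ, ‖z a‖ ≤ ∑ a ∈ Tᶜ, F / (2 * p) := by
            refine Finset.sum_le_sum fun a ha => ?_
            simp only [hT, Finset.mem_compl, Finset.mem_filter, Finset.mem_univ, true_and,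
              not_le] at ha
            exact ha.le
        _ ≤ p * (F / (2 * p)) := by
            rw [Finset.sum_const, nsmul_eq_mul]
            gcongr
            exact Finset.card_le_univ _
        _ = F / 2 := by field_simp
    have h2 : ∃ a, F ≤ 2 * d * ‖z a‖ := by
      by_contra hcon
      push Not at hcon
      have hFpos : 0 < F := by
        obtain ⟨a⟩ := Fintype.card_pos_iff.1 hp0
        have := hcon a
        have h0 : 0 ≤ 2 * d * ‖z a‖ := by positivity
        linarith
      have : ∑ a ∈ T, ‖z a‖ < F / 2 := by
        calc ∑ a ∈ T, ‖z a‖ ≤ ∑ a ∈ T, F / (2 * d) := by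
              refine Finset.sum_le_sum fun a _ => ?_
              rw [le_div_iff₀ (by positivity)]
              linarith [hcon a]
          _ = #T * (F / (2 * d)) := by rw [Finset.sum_const, nsmul_eq_mul]
          _ < d * (F / (2 * d)) := by
              have : (#T : ℝ) < d := by exact_mod_cast h
              gcongr
          _ = F / 2 := by field_simp
      linarith
    obtain ⟨a, ha⟩ := h2
    have h3 : F ^ (2 * (s + d)) ≤ (2 * d) ^ (2 * (s + d)) * ‖z a‖ ^ (2 * (s + d)) := by
      rw [← mul_pow]
      exact pow_le_pow_left₀ hF0 ha _
    have h4 : ‖z a‖ ^ (2 * (s + d)) ≤ ∑ a, ‖z a‖ ^ (2 * (s + d)) :=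
      Finset.single_le_sum (f := fun a => ‖z a‖ ^ (2 * (s + d)))
        (fun _ _ => by positivity) (Finset.mem_univ a)
    have h5 : (2 * d : ℝ) ^ (2 * (s + d)) * ‖z a‖ ^ (2 * (s + d)) ≤
      (2 * d) ^ (2 * (s + d)) * ∑ a, ‖z a‖ ^ (2 * (s + d)) := by gcongr
    have h6 : (0 : ℝ) ≤ (2 * p) ^ (2 * d) * (F ^ (2 * s) *
        ∑ f : Fin d ↪ Z, ∏ i, ‖z (f i)‖ ^ 2) := by positivity
    linarith

end Pigeonhole

/-- The integers of `[0, p ^ L)` congruent to `r` modulo `p ^ m`. -/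
noncomputable def piece (p L m : ℕ) (r : ZMod (p ^ m)) : Finset ℤ :=
  {x ∈ Finset.Ico (0 : ℤ) ((p : ℤ) ^ L) | (x : ZMod (p ^ m)) = r}

/-- Vinogradov's mean value over `[0, p ^ L)`, with `s` pairs of variables and degree `d`. -/
noncomputable def vino (d p s L : ℕ) : ℕ :=
  count d (fun _ : Fin s => Finset.Ico (0 : ℤ) ((p : ℤ) ^ L)) 0

lemma piece_eq_image {p L m : ℕ} [hp : Fact p.Prime] (hm : m ≤ L) (r : ZMod (p ^ m)) :
    piece p L m r =
      (Finset.Ico (0 : ℤ) ((p : ℤ) ^ (L - m))).image fun z => (r.val : ℤ) + (p : ℤ) ^ m * z := by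
  have hp0 : 0 < p := hp.out.pos
  have hq : (0 : ℤ) < (p : ℤ) ^ m := by positivity
  have : NeZero (p ^ m) := ⟨by positivity⟩
  have hr : (r.val : ℤ) < (p : ℤ) ^ m := by exact_mod_cast ZMod.val_lt r
  have hsplit : (p : ℤ) ^ L = (p : ℤ) ^ m * (p : ℤ) ^ (L - m) := by
    rw [← pow_add]; congr 1; omega
  ext x
  simp only [piece, Finset.mem_filter, Finset.mem_image, Finset.mem_Ico]
  constructor
  · rintro ⟨⟨h0, h1⟩, h2⟩
    have h3 : x % (p : ℤ) ^ m = r.val := by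
      rw [← h2, ZMod.val_intCast]
      push_cast
      rfl
    refine ⟨x / (p : ℤ) ^ m, ⟨Int.ediv_nonneg h0 hq.le, ?_⟩, ?_⟩
    · apply Int.ediv_lt_of_lt_mul hq
      rw [hsplit] at h1; linarith
    · rw [← h3]; exact Int.emod_add_mul_ediv x _
  · rintro ⟨z, ⟨h0, h1⟩, rfl⟩
    refine ⟨⟨by positivity, ?_⟩, ?_⟩
    · rw [hsplit]; nlinarith
    · have : ((p ^ m : ℕ) : ZMod (p ^ m)) = 0 := ZMod.natCast_self _
      push_cast at this ⊢
      rw [this]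
      simp

lemma card_piece {p L m : ℕ} [hp : Fact p.Prime] (hm : m ≤ L) (r : ZMod (p ^ m)) :
    #(piece p L m r) = p ^ (L - m) := by
  have hp0 : 0 < p := hp.out.pos
  rw [piece_eq_image hm, Finset.card_image_of_injective]
  · simp only [Int.card_Ico, sub_zero]
    exact_mod_cast Int.toNat_natCast (p ^ (L - m))
  · intro x y h
    have hq : (p : ℤ) ^ m ≠ 0 := by positivity
    simpa [hq] using h

lemma count_piece_le {p L m s d : ℕ} [hp : Fact p.Prime] (hm : m ≤ L) (r : ZMod (p ^ m)) :
    count d (fun _ : Fin s => piece p L m r) 0 ≤ vino d p s (L - m) := by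
  have hp0 : 0 < p := hp.out.pos
  rw [piece_eq_image hm]
  exact count_image_affine_le d (fun _ : Fin s => Finset.Ico (0 : ℤ) ((p : ℤ) ^ (L - m)))
    (fun _ => (r.val : ℤ)) r.val _ (fun _ => rfl) (by positivity)

lemma sum_piece {p : ℕ} (L m : ℕ) [Fintype (ZMod (p ^ m))] (g : ℤ → ℂ) :
    ∑ r, ∑ x ∈ piece p L m r, g x = ∑ x ∈ Finset.Ico (0 : ℤ) ((p : ℤ) ^ L), g x := by
  classical
  simp only [piece]
  exact Finset.sum_fiberwise _ _ _

lemma norm_sum_pow_le_card_pow {ι : Type*} [Fintype ι] (z : ι → ℂ) (n : ℕ) :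
    ‖∑ i, z i‖ ^ (n + 1) ≤ (Fintype.card ι : ℝ) ^ n * ∑ i, ‖z i‖ ^ (n + 1) := by
  calc ‖∑ i, z i‖ ^ (n + 1) ≤ (∑ i, ‖z i‖) ^ (n + 1) := by
        gcongr; exact norm_sum_le _ _
    _ ≤ _ := by
        rcases isEmpty_or_nonempty ι with _ | _
        · simp
        have h := pow_sum_div_card_le_sum_pow (s := univ) (fun i _ => norm_nonneg (z i)) n
        rwa [div_le_iff₀ (by simp [Fintype.card_pos]), mul_comm] at h

theorem vino_recursion {p d s L m : ℕ} [hp : Fact p.Prime] (hd1 : 1 ≤ d) (hd : d < p)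
    (hs : 1 ≤ s) (hL : 1 ≤ L) (hLm : L ≤ m * d) (hm : m ≤ L) :
    (vino d p (s + d) L : ℝ) ≤
      (2 * d) ^ (2 * (s + d)) * p * vino d p (s + d) (L - 1) +
      (2 * p) ^ (2 * d) * p ^ d * ((p : ℝ) ^ m) ^ (2 * s) * ((p : ℝ) ^ (L - 1)) ^ d *
        ((p : ℝ) ^ m) ^ (d * (d - 1) / 2) * vino d p s (L - m) := by
  classical
  have hp0 : 0 < p := hp.out.pos
  have : NeZero (p ^ m) := ⟨by positivity⟩
  have : NeZero (p ^ 1) := ⟨by positivity⟩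
  let I := Finset.Ico (0 : ℤ) ((p : ℤ) ^ L)
  let P₁ : ZMod (p ^ 1) → Finset ℤ := piece p L 1
  let P : ZMod (p ^ m) → Finset ℤ := piece p L m
  let mix : ZMod (p ^ m) → (Fin d ↪ ZMod (p ^ 1)) → Fin d ⊕ Fin s → Finset ℤ :=
    fun b f => Sum.elim (fun i => P₁ (f i)) fun _ => P b
  obtain ⟨M₁, h1⟩ := exists_modulus_zero d fun _ : Fin (s + d) => I
  choose M₂ h2 using fun a => exists_modulus_zero d fun _ : Fin (s + d) => P₁ a
  choose M₃ h3 using fun b f => exists_modulus_zero d (mix b f)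
  set M := M₁ + ∑ a, M₂ a + ∑ b, ∑ f, M₃ b f + 1 with hM
  have hM2 : ∀ a, M₂ a < M := fun a => by
    have := Finset.single_le_sum (fun a _ => Nat.zero_le (M₂ a)) (Finset.mem_univ a)
    omega
  have hM3 : ∀ b f, M₃ b f < M := fun b f => by
    have := Finset.single_le_sum (fun b _ => Nat.zero_le (∑ f, M₃ b f)) (Finset.mem_univ b)
    have := Finset.single_le_sum (fun f _ => Nat.zero_le (M₃ b f)) (Finset.mem_univ f)
    omega
  have : NeZero M := ⟨by omega⟩
  have e1 := h1 M (by omega) inferInstance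
  have e2 := fun a => h2 a M (hM2 a) inferInstance
  have e3 := fun b f => h3 b f M (hM3 b f) inferInstance
  simp only [Finset.prod_const, Finset.card_univ, Fintype.card_fin, mix, Fintype.prod_sum_type,
    Sum.elim_inl, Sum.elim_inr, ← pow_mul] at e1 e2 e3
  have hMpos : (0 : ℝ) < (M : ℝ) ^ d := by positivity
  have hcard1 : (Fintype.card (ZMod (p ^ 1)) : ℝ) = p := by simp [ZMod.card]
  have hcardm : (Fintype.card (ZMod (p ^ m)) : ℝ) = (p : ℝ) ^ m := by simp [ZMod.card]
  have key : ∀ ψ : AddChar (Fin d → ZMod M) ℂ,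
      ‖∑ x ∈ I, ψ (curve d M x)‖ ^ (2 * (s + d)) ≤
      (2 * d) ^ (2 * (s + d)) * ∑ a, ‖∑ x ∈ P₁ a, ψ (curve d M x)‖ ^ (2 * (s + d)) +
      (2 * p) ^ (2 * d) * (((p : ℝ) ^ m) ^ (2 * s - 1) *
        ∑ b, ∑ f : Fin d ↪ ZMod (p ^ 1), ((∏ i, ‖∑ x ∈ P₁ (f i), ψ (curve d M x)‖ ^ 2) *
          ‖∑ x ∈ P b, ψ (curve d M x)‖ ^ (2 * s))) := by
    intro ψ
    have k1 := norm_sum_pow_le_of_pigeonhole (fun a => ∑ x ∈ P₁ a, ψ (curve d M x)) hd1 s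
    have k2 := norm_sum_pow_le_card_pow (fun b => ∑ x ∈ P b, ψ (curve d M x)) (2 * s - 1)
    rw [sum_piece, hcard1] at k1
    rw [sum_piece, hcardm, show 2 * s - 1 + 1 = 2 * s by omega] at k2
    refine k1.trans ?_
    simp_rw [← Finset.sum_mul, ← Finset.mul_sum]
    rw [mul_comm (∑ f : Fin d ↪ ZMod (p ^ 1), _), ← mul_assoc ((((p : ℝ) ^ m) ^ (2 * s - 1)))]
    gcongr
  have hsum := Finset.sum_le_sum fun ψ (_ : ψ ∈ univ) => key ψ
  have x2 : ∑ ψ : AddChar (Fin d → ZMod M) ℂ, ∑ a,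
      ‖∑ x ∈ P₁ a, ψ (curve d M x)‖ ^ (2 * (s + d)) =
      ∑ a, (M : ℝ) ^ d * count d (fun _ : Fin (s + d) => P₁ a) 0 := by
    rw [Finset.sum_comm]; exact Finset.sum_congr rfl fun a _ => (e2 a).symm
  have x3 : ∑ ψ : AddChar (Fin d → ZMod M) ℂ, ∑ b, ∑ f : Fin d ↪ ZMod (p ^ 1),
        ((∏ i, ‖∑ x ∈ P₁ (f i), ψ (curve d M x)‖ ^ 2) *
          ‖∑ x ∈ P b, ψ (curve d M x)‖ ^ (2 * s)) =
      ∑ b, ∑ f, (M : ℝ) ^ d * count d (mix b f) 0 := by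
    rw [Finset.sum_comm]
    refine Finset.sum_congr rfl fun b _ => ?_
    rw [Finset.sum_comm]; exact Finset.sum_congr rfl fun f _ => (e3 b f).symm
  rw [← e1, Finset.sum_add_distrib, ← Finset.mul_sum, ← Finset.mul_sum, ← Finset.mul_sum,
    x2, x3] at hsum
  simp_rw [← Finset.mul_sum] at hsum
  have c2 : ∀ a, (count d (fun _ : Fin (s + d) => P₁ a) 0 : ℝ) ≤ vino d p (s + d) (L - 1) :=
    fun a => by exact_mod_cast count_piece_le hL a
  have c3 : ∀ b (f : Fin d ↪ ZMod (p ^ 1)),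
      (count d (mix b f) 0 : ℝ) ≤ ((p : ℝ) ^ (L - 1)) ^ d *
        ((p : ℝ) ^ m) ^ (d * (d - 1) / 2) * vino d p s (L - m) := by
    intro b f
    have h := count_sum_elim_le (s := s) hd hLm (fun i => P₁ (f i))
      (fun i => ZMod.ringEquivCongr (pow_one p) (f i)) ?_ ?_ b.val (P b) ?_
    · have hprod : ∏ i, #(P₁ (f i)) = (p ^ (L - 1)) ^ d := by
        simp [P₁, card_piece hL]
      rw [hprod] at h
      have h' := h.trans (Nat.mul_le_mul_left _ (count_piece_le hm b))
      exact_mod_cast h'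
    · intro i j hij
      exact f.injective ((ZMod.ringEquivCongr (pow_one p)).injective hij)
    · intro i x hx
      simp only [P₁, piece, Finset.mem_filter, Finset.mem_Ico] at hx
      refine ⟨hx.1, ?_⟩
      rw [← hx.2, map_intCast]
    · intro x hx
      simp only [P, piece, Finset.mem_filter] at hx
      rw [← Nat.cast_pow, ← ZMod.intCast_zmod_eq_zero_iff_dvd]
      push_cast
      rw [hx.2]
      simp
  have f2 : ∑ a, (count d (fun _ : Fin (s + d) => P₁ a) 0 : ℝ) ≤
      p * vino d p (s + d) (L - 1) := by
    refine (Finset.sum_le_card_nsmul _ _ _ fun a _ => c2 a).trans_eq ?_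
    rw [Finset.card_univ, nsmul_eq_mul, hcard1]
  have f3 : ∑ b, ∑ f, (count d (mix b f) 0 : ℝ) ≤
      (p : ℝ) ^ m * ((p : ℝ) ^ d * (((p : ℝ) ^ (L - 1)) ^ d *
        ((p : ℝ) ^ m) ^ (d * (d - 1) / 2) * vino d p s (L - m))) := by
    refine (Finset.sum_le_card_nsmul _ _ _ fun b _ =>
      (Finset.sum_le_card_nsmul _ _ _ fun f _ => c3 b f).trans (?_ : _ ≤ (p : ℝ) ^ d *
        (((p : ℝ) ^ (L - 1)) ^ d *
        ((p : ℝ) ^ m) ^ (d * (d - 1) / 2) * vino d p s (L - m)))).trans_eq ?_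
    · rw [nsmul_eq_mul]
      gcongr
      have := Fintype.card_le_of_injective (fun (f : Fin d ↪ ZMod (p ^ 1)) => (f : Fin d → _))
        DFunLike.coe_injective
      simp only [Fintype.card_fun, Fintype.card_fin, ZMod.card] at this
      have h' : (#(univ : Finset (Fin d ↪ ZMod (p ^ 1))) : ℝ) ≤ (((p ^ 1) ^ d : ℕ) : ℝ) := by
        exact_mod_cast this
      simpa using h'
    · rw [Finset.card_univ, nsmul_eq_mul, hcardm]
  have hq : ((p : ℝ) ^ m) ^ (2 * s) = ((p : ℝ) ^ m) ^ (2 * s - 1) * (p : ℝ) ^ m := by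
    rw [← pow_succ]; congr 1; omega
  refine le_of_mul_le_mul_left (hsum.trans ?_) hMpos
  calc _ = (M : ℝ) ^ d * ((2 * d) ^ (2 * (s + d)) *
        ∑ a, (count d (fun _ : Fin (s + d) => P₁ a) 0 : ℝ) + (2 * p) ^ (2 * d) *
          (((p : ℝ) ^ m) ^ (2 * s - 1) * ∑ b, ∑ f, (count d (mix b f) 0 : ℝ))) := by ring
    _ ≤ (M : ℝ) ^ d * ((2 * d) ^ (2 * (s + d)) * (p * vino d p (s + d) (L - 1)) +
        (2 * p) ^ (2 * d) * (((p : ℝ) ^ m) ^ (2 * s - 1) * ((p : ℝ) ^ m * ((p : ℝ) ^ d *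
        (((p : ℝ) ^ (L - 1)) ^ d *
        ((p : ℝ) ^ m) ^ (d * (d - 1) / 2) * vino d p s (L - m)))))) := by gcongr
    _ = _ := by rw [hq]; ring

lemma vino_le_trivial (d p s L : ℕ) : vino d p s L ≤ p ^ (2 * s * L) := by
  classical
  unfold vino count
  refine (Finset.card_filter_le _ _).trans_eq ?_
  have : #(Finset.Ico (0 : ℤ) ((p : ℤ) ^ L)) = p ^ L := by
    simp only [Int.card_Ico, sub_zero]
    exact_mod_cast Int.toNat_natCast (p ^ L)
  rw [Finset.card_product, Fintype.card_piFinset]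
  simp only [this, Finset.prod_const, Finset.card_univ, Fintype.card_fin]
  ring

/-- Vinogradov's mean value theorem, in Linnik's `p`-adic form. -/
theorem vino_le {p d : ℕ} [hp : Fact p.Prime] (hd1 : 1 ≤ d) (hpd : 8 * d ^ 2 ≤ p) (τ : ℕ) :
    ∀ L : ℕ, (vino d p (d ^ 2 + d * τ) L : ℝ) ≤ (2 * (2 * p) ^ (2 * d) * p ^ d ^ 2) ^ τ *
      (p : ℝ) ^ ((L : ℝ) * (2 * (d ^ 2 + d * τ) - d * (d + 1) / 2 +
        d * (d + 1) / 2 * (1 - 1 / d) ^ τ)) := by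
  have hd : d < p := by nlinarith
  have hp1 : (1 : ℝ) ≤ p := by exact_mod_cast hp.out.one_lt.le
  have hp0 : (0 : ℝ) < p := by linarith
  have hdR : (1 : ℝ) ≤ d := by exact_mod_cast hd1
  induction τ with
  | zero =>
    intro L
    have h := vino_le_trivial d p (d ^ 2) L
    simp only [mul_zero, add_zero, pow_zero, one_mul, mul_one, Nat.cast_zero]
    have e : ((L : ℝ) * (2 * (d : ℝ) ^ 2 - d * (d + 1) / 2 + d * (d + 1) / 2)) =
      ((2 * d ^ 2 * L : ℕ) : ℝ) := by push_cast; ring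
    rw [e, Real.rpow_natCast]
    exact_mod_cast h
  | succ τ ih =>
    set s := d ^ 2 + d * τ with hs
    have hs1 : 1 ≤ s := by nlinarith
    have hsR : (s : ℝ) = d ^ 2 + d * τ := by rw [hs]; push_cast; ring
    set C₁ : ℝ := (2 * p) ^ (2 * d) * p ^ d ^ 2 with hC₁
    have hC₁1 : 1 ≤ C₁ := one_le_mul_of_one_le_of_one_le
      (one_le_pow₀ (by linarith)) (one_le_pow₀ hp1)
    set δ : ℝ := d * (d + 1) / 2 * (1 - 1 / d) ^ τ with hδ
    set K : ℝ := d * (d + 1) / 2 with hK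
    have h1d : 0 ≤ 1 - 1 / (d : ℝ) := by
      rw [sub_nonneg, div_le_one (by linarith)]; exact hdR
    have h1d' : 1 - 1 / (d : ℝ) ≤ 1 := by
      have : 0 ≤ 1 / (d : ℝ) := by positivity
      linarith
    have hδ0 : 0 ≤ δ := by positivity
    have hδK : δ ≤ K := mul_le_of_le_one_right (by positivity) (pow_le_one₀ h1d h1d')
    have hKd : K ≤ d ^ 2 := by rw [hK]; nlinarith
    set E' : ℝ := 2 * (s + d) - K + δ * (1 - 1 / d) with hE'
    have hEE : ∀ L : ℝ, L * (2 * ((d : ℝ) ^ 2 + d * ((τ + 1 : ℕ) : ℝ)) - K +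
        K * (1 - 1 / d) ^ (τ + 1)) = L * E' := by
      intro L
      rw [hE', hδ, hsR]; push_cast; ring
    have hss : d ^ 2 + d * (τ + 1) = s + d := by rw [hs]; ring
    have hCC : 2 * (2 * (p : ℝ)) ^ (2 * d) * p ^ d ^ 2 = 2 * C₁ := by rw [hC₁]; ring
    have hfirst : (2 * (d : ℝ)) ^ (2 * (s + d)) * p * (p : ℝ) ^ (-E') ≤ 1 / 2 := by
      have a1 : (2 * (d : ℝ)) ^ (2 * (s + d)) ≤ (p / 2 : ℝ) ^ (s + d) := by
        rw [pow_mul]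
        gcongr
        have : (8 : ℝ) * d ^ 2 ≤ p := by exact_mod_cast hpd
        linarith
      have a2 : (2 : ℝ) ≤ 2 ^ (s + d) := by
        calc (2 : ℝ) = 2 ^ 1 := by norm_num
          _ ≤ _ := pow_le_pow_right₀ (by norm_num) (by omega)
      have a3 : (p : ℝ) ^ (s + d) * p * (p : ℝ) ^ (-E') ≤ 1 := by
        have : (p : ℝ) ^ (s + d) * p = (p : ℝ) ^ ((s : ℝ) + d + 1) := by
          rw [← pow_succ, ← Real.rpow_natCast]; push_cast; rfl
        rw [this, ← Real.rpow_add hp0]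
        apply Real.rpow_le_one_of_one_le_of_nonpos hp1
        have : 0 ≤ δ * (1 - 1 / d) := by positivity
        rw [hE', hsR, hK]
        have : 0 ≤ (d : ℝ) * τ := by positivity
        nlinarith
      calc (2 * (d : ℝ)) ^ (2 * (s + d)) * p * (p : ℝ) ^ (-E')
          ≤ (p / 2 : ℝ) ^ (s + d) * p * (p : ℝ) ^ (-E') := by gcongr
        _ = ((p : ℝ) ^ (s + d) * p * (p : ℝ) ^ (-E')) / 2 ^ (s + d) := by
          rw [div_pow]; ring
        _ ≤ 1 / 2 := by gcongr
    intro L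
    rw [hEE, hCC, hss]
    induction L with
    | zero =>
      have h := vino_le_trivial d p (s + d) 0
      simp only [mul_zero, pow_zero] at h
      simp only [Nat.cast_zero, zero_mul, Real.rpow_zero, mul_one]
      have : (vino d p (s + d) 0 : ℝ) ≤ 1 := by exact_mod_cast h
      exact this.trans (one_le_pow₀ (by linarith))
    | succ L ihL =>
      obtain ⟨m, hm1, hm2, hm3⟩ : ∃ m : ℕ, m ≤ L + 1 ∧ L + 1 ≤ m * d ∧ m * d ≤ L + 1 + d := by
        refine ⟨(L + d) / d, ?_, ?_, ?_⟩
        · apply Nat.div_le_of_le_mul; nlinarith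
        · have := Nat.lt_div_mul_add (a := L + d) (b := d) (by omega)
          omega
        · have := Nat.div_mul_le_self (L + d) d
          omega
      have hrec := vino_recursion hd1 hd hs1 (Nat.le_add_left 1 L) hm2 hm1
      rw [Nat.add_sub_cancel] at hrec
      have ih' := ih (L + 1 - m)
      rw [hCC, ← hsR] at ih'
      have hm3R : (m : ℝ) ≤ ((L : ℝ) + 1) / d + 1 := by
        rw [div_add_one (by positivity), le_div_iff₀ (by positivity)]
        exact_mod_cast hm3
      have t1 : (2 * (d : ℝ)) ^ (2 * (s + d)) * p * vino d p (s + d) L ≤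
          1 / 2 * ((2 * C₁) ^ (τ + 1) * (p : ℝ) ^ (((L + 1 : ℕ) : ℝ) * E')) := by
        calc _ ≤ (2 * (d : ℝ)) ^ (2 * (s + d)) * p *
              ((2 * C₁) ^ (τ + 1) * (p : ℝ) ^ ((L : ℝ) * E')) := by gcongr
          _ = ((2 * (d : ℝ)) ^ (2 * (s + d)) * p * (p : ℝ) ^ (-E')) *
              ((2 * C₁) ^ (τ + 1) * (p : ℝ) ^ (((L + 1 : ℕ) : ℝ) * E')) := by
            have : ((L : ℝ) * E') = -E' + (((L + 1 : ℕ) : ℝ) * E') := by push_cast; ring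
            rw [this, Real.rpow_add hp0]; ring
          _ ≤ _ := by gcongr
      have t2 : (2 * (p : ℝ)) ^ (2 * d) * p ^ d * ((p : ℝ) ^ m) ^ (2 * s) * ((p : ℝ) ^ L) ^ d *
          ((p : ℝ) ^ m) ^ (d * (d - 1) / 2) * vino d p s (L + 1 - m) ≤
          1 / 2 * ((2 * C₁) ^ (τ + 1) * (p : ℝ) ^ (((L + 1 : ℕ) : ℝ) * E')) := by
        have hpow : (p : ℝ) ^ d * ((p : ℝ) ^ m) ^ (2 * s) * ((p : ℝ) ^ L) ^ d *
            ((p : ℝ) ^ m) ^ (d * (d - 1) / 2) =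
            (p : ℝ) ^ ((d : ℝ) + m * (2 * s) + L * d + m * (d * (d - 1) / 2)) := by
          have e1 : ((d * (d - 1) / 2 : ℕ) : ℝ) = d * (d - 1) / 2 := by
            rw [Nat.cast_div (even_iff_two_dvd.mp (Nat.even_mul_pred_self d)) (by norm_num)]
            push_cast [Nat.cast_sub hd1]; ring
          rw [← e1]
          simp only [← pow_mul, ← pow_add]
          rw [← Real.rpow_natCast]
          push_cast
          rfl
        calc _ = (2 * (p : ℝ)) ^ (2 * d) * ((p : ℝ) ^ d * ((p : ℝ) ^ m) ^ (2 * s) *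
              ((p : ℝ) ^ L) ^ d * ((p : ℝ) ^ m) ^ (d * (d - 1) / 2)) *
              vino d p s (L + 1 - m) := by ring
          _ ≤ (2 * (p : ℝ)) ^ (2 * d) * (p : ℝ) ^ ((d : ℝ) + m * (2 * s) + L * d +
              m * (d * (d - 1) / 2)) * ((2 * C₁) ^ τ * (p : ℝ) ^ (((L + 1 - m : ℕ) : ℝ) *
              (2 * s - K + δ))) := by rw [hpow]; gcongr
          _ = (2 * (p : ℝ)) ^ (2 * d) * (2 * C₁) ^ τ * (p : ℝ) ^ ((d : ℝ) + m * (2 * s) + L * d +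
              m * (d * (d - 1) / 2) + (((L + 1 - m : ℕ) : ℝ) * (2 * s - K + δ))) := by
            rw [Real.rpow_add hp0 ((d : ℝ) + m * (2 * s) + L * d + m * (d * (d - 1) / 2))]; ring
          _ ≤ (2 * (p : ℝ)) ^ (2 * d) * (2 * C₁) ^ τ * (p : ℝ) ^ ((d ^ 2 : ℕ) +
              ((L + 1 : ℕ) : ℝ) * E') := by
            refine mul_le_mul_of_nonneg_left (Real.rpow_le_rpow_of_exponent_le hp1 ?_) (by positivity)
            · rw [Nat.cast_sub hm1]
              push_cast
              have hmm : (m : ℝ) * (d ^ 2 - δ) ≤ (((L : ℝ) + 1) / d + 1) * (d ^ 2 - δ) :=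
                mul_le_mul_of_nonneg_right hm3R (by linarith)
              have e2 : (((L : ℝ) + 1) / d + 1) * (d ^ 2 - δ) =
                  (L + 1) * (d - δ * (1 / d)) + d ^ 2 - δ := by
                field_simp
                ring
              rw [hE']
              have hK' : K = d * (d - 1) / 2 + d := by rw [hK]; ring
              have hK2 : (d : ℝ) * (d - 1) / 2 = d ^ 2 - K := by rw [hK]; ring
              rw [hK2]
              nlinarith
          _ = _ := by
            rw [Real.rpow_add hp0, Real.rpow_natCast, pow_succ (2 * C₁), hC₁]; ring
      calc _ ≤ _ := hrec
        _ ≤ _ := add_le_add t1 t2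
        _ = _ := by ring

section Bilinear

variable {ι G : Type*} [Fintype ι] [DecidableEq ι] [AddCommGroup G]

lemma prod_normSq_sum_eq (ψ : AddChar G ℂ) (hψ : ∀ g, ψ (-g) = starRingEnd ℂ (ψ g))
    (A : ι → Finset ℤ) (φ : ℤ → G) :
    ((∏ i, ‖∑ x ∈ A i, ψ (φ x)‖ ^ 2 : ℝ) : ℂ) =
      ∑ w ∈ Fintype.piFinset A ×ˢ Fintype.piFinset A,
        ψ (∑ i, φ (w.1 i) - ∑ i, φ (w.2 i)) := by
  have h1 : ((∏ i, ‖∑ x ∈ A i, ψ (φ x)‖ ^ 2 : ℝ) : ℂ) =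
      (∏ i, ∑ x ∈ A i, ψ (φ x)) * (∏ i, ∑ x ∈ A i, ψ (-φ x)) := by
    push_cast
    rw [← Finset.prod_mul_distrib]
    refine Finset.prod_congr rfl fun i _ => ?_
    rw [← Complex.mul_conj', map_sum]
    simp_rw [hψ]
  rw [h1, Finset.prod_univ_sum, Finset.prod_univ_sum, Finset.sum_mul_sum, Finset.sum_product]
  refine Finset.sum_congr rfl fun x _ => Finset.sum_congr rfl fun y _ => ?_
  rw [sub_eq_add_neg, AddChar.map_add_eq_mul, ← Finset.sum_neg_distrib, map_sum_char,
    map_sum_char]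

end Bilinear

/-- The vector of differences of power sums of a pair of tuples. -/
def powerDiff {s : ℕ} (d : ℕ) (w : (Fin s → ℤ) × (Fin s → ℤ)) : Fin d → ℤ :=
  fun j => ∑ i, w.1 i ^ (j + 1 : ℕ) - ∑ i, w.2 i ^ (j + 1 : ℕ)

lemma norm_sum_pow_eq (ψ : AddChar ℝ ℂ) (hψ : ∀ g, ψ (-g) = starRingEnd ℂ (ψ g))
    (d s : ℕ) (A : Finset ℤ) (β : Fin d → ℝ) :
    ((‖∑ x ∈ A, ψ (∑ j, β j * (x : ℝ) ^ (j + 1 : ℕ))‖ ^ (2 * s) : ℝ) : ℂ) =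
      ∑ w ∈ Fintype.piFinset (fun _ : Fin s => A) ×ˢ Fintype.piFinset (fun _ : Fin s => A),
        ψ (∑ j, β j * (powerDiff d w j : ℝ)) := by
  have h := prod_normSq_sum_eq ψ hψ (fun _ : Fin s => A)
    (fun x => ∑ j, β j * (x : ℝ) ^ (j + 1 : ℕ))
  rw [Finset.prod_const, Finset.card_univ, Fintype.card_fin, ← pow_mul] at h
  rw [h]
  refine Finset.sum_congr rfl fun w _ => congrArg ψ ?_
  rw [Finset.sum_comm, Finset.sum_comm (f := fun i j => β j * ((w.2 i : ℤ) : ℝ) ^ (j + 1 : ℕ)),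
    ← Finset.sum_sub_distrib]
  refine Finset.sum_congr rfl fun j _ => ?_
  rw [← Finset.mul_sum, ← Finset.mul_sum, ← mul_sub, powerDiff]
  push_cast
  rfl

lemma powerDiff_mem {s d a : ℕ} {w : (Fin s → ℤ) × (Fin s → ℤ)}
    (hw : w ∈ Fintype.piFinset (fun _ : Fin s => Finset.Ico (0 : ℤ) a) ×ˢ
      Fintype.piFinset (fun _ : Fin s => Finset.Ico (0 : ℤ) a)) :
    powerDiff d w ∈ Fintype.piFinset fun j : Fin d =>
      Finset.Icc (-((s * a ^ (j + 1 : ℕ) : ℕ) : ℤ)) ((s * a ^ (j + 1 : ℕ) : ℕ) : ℤ) := by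
  simp only [Finset.mem_product, Fintype.mem_piFinset, Finset.mem_Ico] at hw
  rw [Fintype.mem_piFinset]
  intro j
  have key : ∀ u : Fin s → ℤ, (∀ i, 0 ≤ u i ∧ u i < a) →
      0 ≤ ∑ i, u i ^ (j + 1 : ℕ) ∧ ∑ i, u i ^ (j + 1 : ℕ) ≤ s * (a : ℤ) ^ (j + 1 : ℕ) := by
    intro u hu
    refine ⟨Finset.sum_nonneg fun i _ => pow_nonneg (hu i).1 _, ?_⟩
    refine (Finset.sum_le_card_nsmul _ _ ((a : ℤ) ^ (j + 1 : ℕ)) fun i _ =>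
      pow_le_pow_left₀ (hu i).1 (hu i).2.le _).trans_eq ?_
    simp
  have h1 := key _ hw.1
  have h2 := key _ hw.2
  rw [Finset.mem_Icc, powerDiff]
  push_cast
  constructor <;> linarith

lemma sum_powerDiff_le {d s a : ℕ} (g : (Fin d → ℤ) → ℝ) (hg : ∀ l, 0 ≤ g l) :
    ∑ w ∈ Fintype.piFinset (fun _ : Fin s => Finset.Ico (0 : ℤ) a) ×ˢ
      Fintype.piFinset (fun _ : Fin s => Finset.Ico (0 : ℤ) a), g (powerDiff d w) ≤
    count d (fun _ : Fin s => Finset.Ico (0 : ℤ) a) 0 *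
      ∑ l ∈ Fintype.piFinset fun j : Fin d =>
        Finset.Icc (-((s * a ^ (j + 1 : ℕ) : ℕ) : ℤ)) ((s * a ^ (j + 1 : ℕ) : ℕ) : ℤ), g l := by
  classical
  rw [← Finset.sum_fiberwise_of_maps_to (fun w hw => powerDiff_mem (d := d) hw), Finset.mul_sum]
  refine Finset.sum_le_sum fun l _ => ?_
  rw [Finset.sum_congr rfl (g := fun _ => g l) (fun w hw => by
    rw [(Finset.mem_filter.mp hw).2]), Finset.sum_const, nsmul_eq_mul]
  refine mul_le_mul_of_nonneg_right ?_ (hg l)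
  have h := count_le_count_zero d (fun _ : Fin s => Finset.Ico (0 : ℤ) a) l
  refine le_trans ?_ (Nat.cast_le.mpr h)
  refine Nat.cast_le.mpr (Finset.card_le_card fun w hw => ?_)
  rw [Finset.mem_filter] at hw ⊢
  exact ⟨hw.1, fun j => congrFun hw.2 j⟩

lemma norm_eq_one_of_conj {ψ : AddChar ℝ ℂ} (hψ : ∀ g, ψ (-g) = starRingEnd ℂ (ψ g)) (x : ℝ) :
    ‖ψ x‖ = 1 := by
  have h : ψ x * ψ (-x) = 1 := by rw [← AddChar.map_add_eq_mul]; simp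
  rw [hψ, Complex.mul_conj'] at h
  have h2 : ‖ψ x‖ ^ 2 = 1 := by exact_mod_cast h
  exact (pow_eq_one_iff_of_nonneg (norm_nonneg _) two_ne_zero).mp h2

theorem bilinear_le (ψ : AddChar ℝ ℂ) (hψ : ∀ g, ψ (-g) = starRingEnd ℂ (ψ g))
    (d s a : ℕ) (hs : 1 ≤ s) (α : Fin d → ℝ) :
    ‖∑ x ∈ Finset.Ico (0 : ℤ) a, ∑ y ∈ Finset.Ico (0 : ℤ) a,
      ψ (∑ j, α j * (x : ℝ) ^ (j + 1 : ℕ) * (y : ℝ) ^ (j + 1 : ℕ))‖ ^ (2 * s * (2 * s)) ≤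
    ((a : ℝ) ^ (2 * s - 1)) ^ (2 * s) * ((a : ℝ) ^ (2 * s)) ^ (2 * s - 1) *
      (count d (fun _ : Fin s => Finset.Ico (0 : ℤ) a) 0) ^ 2 *
      ∏ j : Fin d, ∑ l ∈ Finset.Icc (-((s * a ^ (j + 1 : ℕ) : ℕ) : ℤ)) ((s * a ^ (j + 1 : ℕ) : ℕ) : ℤ),
        ‖∑ m ∈ Finset.Icc (-((s * a ^ (j + 1 : ℕ) : ℕ) : ℤ)) ((s * a ^ (j + 1 : ℕ) : ℕ) : ℤ),
          ψ (α j * l * m)‖ := by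
  classical
  set I := Finset.Ico (0 : ℤ) a with hI
  set T := Fintype.piFinset (fun _ : Fin s => I) ×ˢ Fintype.piFinset (fun _ : Fin s => I) with hT
  set B : Fin d → Finset ℤ := fun j =>
    Finset.Icc (-((s * a ^ (j + 1 : ℕ) : ℕ) : ℤ)) ((s * a ^ (j + 1 : ℕ) : ℕ) : ℤ) with hB
  set J := count d (fun _ : Fin s => I) 0 with hJ
  have hIcard : #I = a := by simp [hI]
  have hTcard : (#T : ℝ) = (a : ℝ) ^ (2 * s) := by
    rw [hT, Finset.card_product, Fintype.card_piFinset]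
    simp only [Finset.prod_const, Finset.card_univ, Fintype.card_fin, hIcard]
    push_cast; ring
  have hmean : ∀ {κ : Type} (S : Finset κ) (f : κ → ℝ), (∀ k ∈ S, 0 ≤ f k) →
      (∑ k ∈ S, f k) ^ (2 * s) ≤ (#S : ℝ) ^ (2 * s - 1) * ∑ k ∈ S, f k ^ (2 * s) := by
    intro κ S f hf
    rcases S.eq_empty_or_nonempty with rfl | hne
    · simp [show s ≠ 0 by omega]
    have h := pow_sum_div_card_le_sum_pow hf (2 * s - 1)
    rw [show 2 * s - 1 + 1 = 2 * s by omega] at h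
    rw [div_le_iff₀ (by have := hne.card_pos; positivity)] at h
    rwa [mul_comm ((#S : ℝ) ^ _)]
  let g : (Fin d → ℤ) → ℝ := fun l => ‖∑ x ∈ I, ψ (∑ j, (α j * l j) * (x : ℝ) ^ (j + 1 : ℕ))‖
  have step1 : ‖∑ x ∈ I, ∑ y ∈ I,
      ψ (∑ j, α j * (x : ℝ) ^ (j + 1 : ℕ) * (y : ℝ) ^ (j + 1 : ℕ))‖ ^ (2 * s) ≤
      (a : ℝ) ^ (2 * s - 1) * ∑ w ∈ T, g (powerDiff d w) := by
    calc _ ≤ (∑ x ∈ I, ‖∑ y ∈ I,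
          ψ (∑ j, α j * (x : ℝ) ^ (j + 1 : ℕ) * (y : ℝ) ^ (j + 1 : ℕ))‖) ^ (2 * s) := by
          gcongr; exact norm_sum_le _ _
      _ ≤ (a : ℝ) ^ (2 * s - 1) * ∑ x ∈ I, ‖∑ y ∈ I,
          ψ (∑ j, α j * (x : ℝ) ^ (j + 1 : ℕ) * (y : ℝ) ^ (j + 1 : ℕ))‖ ^ (2 * s) := by
          rw [← hIcard]; exact hmean _ _ fun _ _ => norm_nonneg _
      _ ≤ _ := by
          gcongr
          have hc : ((∑ x ∈ I, ‖∑ y ∈ I, ψ (∑ j, α j * (x : ℝ) ^ (j + 1 : ℕ) *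
              (y : ℝ) ^ (j + 1 : ℕ))‖ ^ (2 * s) : ℝ) : ℂ) =
              ∑ w ∈ T, ∑ x ∈ I, ψ (∑ j, (α j * powerDiff d w j) * (x : ℝ) ^ (j + 1 : ℕ)) := by
            rw [Complex.ofReal_sum, Finset.sum_comm]
            refine Finset.sum_congr rfl fun x _ => ?_
            rw [norm_sum_pow_eq ψ hψ]
            refine Finset.sum_congr rfl fun w _ => congrArg ψ
              (Finset.sum_congr rfl fun j _ => by ring)
          have hn : 0 ≤ ∑ x ∈ I, ‖∑ y ∈ I, ψ (∑ j, α j * (x : ℝ) ^ (j + 1 : ℕ) *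
              (y : ℝ) ^ (j + 1 : ℕ))‖ ^ (2 * s) := by positivity
          rw [← Real.norm_of_nonneg hn, ← Complex.norm_real, hc]
          exact norm_sum_le _ _
  have step2 : (∑ w ∈ T, g (powerDiff d w)) ^ (2 * s) ≤
      ((a : ℝ) ^ (2 * s)) ^ (2 * s - 1) * (J * ∑ l ∈ Fintype.piFinset B, g l ^ (2 * s)) := by
    refine (hmean _ _ fun _ _ => norm_nonneg _).trans ?_
    rw [hTcard]
    gcongr
    exact sum_powerDiff_le (fun l => g l ^ (2 * s)) fun l => by positivity
  have step3 : ∑ l ∈ Fintype.piFinset B, g l ^ (2 * s) ≤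
      J * ∏ j, ∑ l ∈ B j, ‖∑ m ∈ B j, ψ (α j * l * m)‖ := by
    have hc : ((∑ l ∈ Fintype.piFinset B, g l ^ (2 * s) : ℝ) : ℂ) =
        ∑ w ∈ T, ∏ j, ∑ m ∈ B j, ψ (α j * powerDiff d w j * m) := by
      rw [Complex.ofReal_sum]
      simp_rw [g, norm_sum_pow_eq ψ hψ, Finset.prod_univ_sum]
      rw [Finset.sum_comm]
      refine Finset.sum_congr rfl fun w _ => Finset.sum_congr rfl fun l _ => ?_
      rw [map_sum_char]
      exact Finset.prod_congr rfl fun j _ => congrArg ψ (by ring)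
    have hn : 0 ≤ ∑ l ∈ Fintype.piFinset B, g l ^ (2 * s) :=
      Finset.sum_nonneg fun l _ => by positivity
    rw [← Real.norm_of_nonneg hn, ← Complex.norm_real, hc, Finset.prod_univ_sum]
    refine (norm_sum_le _ _).trans ?_
    simp_rw [norm_prod]
    exact sum_powerDiff_le (fun l => ∏ j, ‖∑ m ∈ B j, ψ (α j * l j * m)‖)
      fun l => Finset.prod_nonneg fun j _ => norm_nonneg _
  calc _ = (‖∑ x ∈ I, ∑ y ∈ I,
      ψ (∑ j, α j * (x : ℝ) ^ (j + 1 : ℕ) * (y : ℝ) ^ (j + 1 : ℕ))‖ ^ (2 * s)) ^ (2 * s) := by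
        rw [← pow_mul]
    _ ≤ ((a : ℝ) ^ (2 * s - 1) * ∑ w ∈ T, g (powerDiff d w)) ^ (2 * s) := by gcongr
    _ = ((a : ℝ) ^ (2 * s - 1)) ^ (2 * s) * (∑ w ∈ T, g (powerDiff d w)) ^ (2 * s) := mul_pow _ _ _
    _ ≤ ((a : ℝ) ^ (2 * s - 1)) ^ (2 * s) * (((a : ℝ) ^ (2 * s)) ^ (2 * s - 1) *
          (J * (J * ∏ j, ∑ l ∈ B j, ‖∑ m ∈ B j, ψ (α j * l * m)‖))) := by
        gcongr
        refine step2.trans ?_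
        gcongr
    _ = _ := by ring

/-- The additive character `x ↦ exp (2 π i x)` with complex values. -/
noncomputable def expChar : AddChar ℝ ℂ := Circle.coeHom.compAddChar Real.fourierChar

lemma expChar_apply (x : ℝ) : expChar x = Complex.exp (2 * Real.pi * x * Complex.I) := by
  have : expChar x = (Real.fourierChar x : ℂ) := rfl
  rw [this, Real.fourierChar_apply]
  push_cast; ring_nf

lemma expChar_neg (x : ℝ) : expChar (-x) = starRingEnd ℂ (expChar x) := by
  rw [expChar_apply, expChar_apply, ← Complex.exp_conj]
  simp [Complex.conj_ofNat]

lemma norm_expChar (x : ℝ) : ‖expChar x‖ = 1 := norm_eq_one_of_conj expChar_neg x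

lemma four_mul_abs_le_norm_expChar_sub_one {β : ℝ} (hβ : |β| ≤ 1 / 2) :
    4 * |β| ≤ ‖expChar β - 1‖ := by
  have h1 : expChar β = Complex.exp (Complex.I * ((2 * Real.pi * β : ℝ) : ℂ)) := by
    rw [expChar_apply]; push_cast; ring_nf
  rw [h1, Complex.norm_exp_I_mul_ofReal_sub_one, norm_mul, Real.norm_two,
    show 2 * Real.pi * β / 2 = Real.pi * β by ring, Real.norm_eq_abs]
  have h2 : |Real.sin (Real.pi * β)| = |Real.sin (Real.pi * |β|)| := by
    rcases abs_cases β with ⟨h, _⟩ | ⟨h, _⟩ <;> rw [h]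
    rw [mul_neg, Real.sin_neg, abs_neg]
  have h3 := Real.mul_le_sin (x := Real.pi * |β|) (by positivity) (by
    nlinarith [Real.pi_pos])
  have h4 : 2 / Real.pi * (Real.pi * |β|) = 2 * |β| := by field_simp
  rw [h4] at h3
  rw [h2]
  linarith [le_abs_self (Real.sin (Real.pi * |β|))]

lemma norm_sum_expChar_le (Y : ℕ) {β : ℝ} (hβ0 : β ≠ 0) (hβ : |β| ≤ 1 / 2) :
    ‖∑ m ∈ Finset.Icc (-(Y : ℤ)) Y, expChar (β * m)‖ ≤ 1 / (2 * |β|) := by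
  have h1 : ∑ m ∈ Finset.Icc (-(Y : ℤ)) Y, expChar (β * m) =
      expChar (-(β * Y)) * ∑ k ∈ Finset.range (2 * Y + 1), expChar β ^ k := by
    rw [Finset.mul_sum]
    symm
    refine Finset.sum_bij (fun k _ => (k : ℤ) - Y) ?_ ?_ ?_ ?_
    · intro k hk
      rw [Finset.mem_range] at hk
      rw [Finset.mem_Icc]; omega
    · intro k _ k' _ h; omega
    · intro m hm
      rw [Finset.mem_Icc] at hm
      exact ⟨(m + Y).toNat, by rw [Finset.mem_range]; omega, by omega⟩
    · intro k _
      rw [← AddChar.map_nsmul_eq_pow, ← AddChar.map_add_eq_mul]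
      congr 1
      push_cast
      rw [nsmul_eq_mul]; ring
  have h2 : ‖∑ k ∈ Finset.range (2 * Y + 1), expChar β ^ k‖ * ‖expChar β - 1‖ ≤ 2 := by
    rw [← norm_mul, geom_sum_mul]
    refine (norm_sub_le _ _).trans ?_
    rw [norm_pow, norm_expChar, one_pow, norm_one]; norm_num
  rw [h1, norm_mul, norm_expChar, one_mul]
  have h3 := four_mul_abs_le_norm_expChar_sub_one hβ
  have h4 : 0 < |β| := abs_pos.mpr hβ0
  rw [le_div_iff₀ (by positivity)]
  nlinarith [norm_nonneg (∑ k ∈ Finset.range (2 * Y + 1), expChar β ^ k)]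

lemma sum_norm_sum_expChar_le (Y : ℕ) {α : ℝ} (hα0 : α ≠ 0) (hα : |α| * Y ≤ 1 / 2) :
    ∑ l ∈ Finset.Icc (-(Y : ℤ)) Y, ‖∑ m ∈ Finset.Icc (-(Y : ℤ)) Y, expChar (α * l * m)‖ ≤
      2 * Y + 1 + (1 + Real.log Y) / |α| := by
  have hpos : 0 < |α| := abs_pos.mpr hα0
  let h : ℤ → ℝ := fun l => if l = 0 then 2 * Y + 1 else 1 / (2 * |α| * |(l : ℝ)|)
  have hev : Function.Even h := fun l => by simp [h]
  have hle : ∀ l ∈ Finset.Icc (-(Y : ℤ)) Y,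
      ‖∑ m ∈ Finset.Icc (-(Y : ℤ)) Y, expChar (α * l * m)‖ ≤ h l := by
    intro l hl
    rw [Finset.mem_Icc] at hl
    by_cases hl0 : l = 0
    · subst hl0
      simp [h]
      have : ((Y : ℤ) + 1 + Y).toNat = 2 * Y + 1 := by omega
      rw [this]; push_cast; linarith
    · simp only [h, if_neg hl0]
      have hl0' : (l : ℝ) ≠ 0 := by exact_mod_cast hl0
      have hlY : |(l : ℝ)| ≤ Y := by
        rw [abs_le]; constructor
        · exact_mod_cast hl.1
        · exact_mod_cast hl.2
      have := norm_sum_expChar_le Y (mul_ne_zero hα0 hl0') (by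
        rw [abs_mul]
        exact (mul_le_mul_of_nonneg_left hlY hpos.le).trans hα)
      rwa [abs_mul, ← mul_assoc] at this
  refine (Finset.sum_le_sum hle).trans ?_
  rw [Finset.sum_Icc_of_even_eq_range hev, Finset.sum_range_succ']
  have hh : ∑ k ∈ Finset.range Y, h ((k + 1 : ℕ) : ℤ) = (harmonic Y : ℝ) / (2 * |α|) := by
    rw [harmonic, Rat.cast_sum, Finset.sum_div]
    refine Finset.sum_congr rfl fun k _ => ?_
    have hk : ((k + 1 : ℕ) : ℤ) ≠ 0 := by omega
    simp only [h, if_neg hk]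
    push_cast
    have hk' : (0 : ℝ) < (k : ℝ) + 1 := by positivity
    rw [abs_of_pos hk']
    field_simp
  rw [hh]
  have h0 : h ((0 : ℕ) : ℤ) = 2 * Y + 1 := by simp [h]
  have h0' : h 0 = 2 * Y + 1 := by simp [h]
  rw [h0, h0']
  have hH := harmonic_le_one_add_log Y
  have : (harmonic Y : ℝ) / (2 * |α|) * 2 ≤ (1 + Real.log Y) / |α| := by
    rw [← div_div, div_right_comm, div_mul_cancel₀ _ (two_ne_zero)]
    gcongr
  simp only [nsmul_eq_mul]
  push_cast
  linarith

lemma norm_expChar_sub_one_le (x : ℝ) : ‖expChar x - 1‖ ≤ 2 * Real.pi * |x| := by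
  have h1 : expChar x = Complex.exp (Complex.I * ((2 * Real.pi * x : ℝ) : ℂ)) := by
    rw [expChar_apply]; push_cast; ring_nf
  rw [h1]
  refine Real.norm_exp_I_mul_ofReal_sub_one_le.trans_eq ?_
  rw [Real.norm_eq_abs, abs_mul, abs_of_pos Real.two_pi_pos]

lemma norm_sum_sub_sum_shift_le (f : ℕ → ℂ) (hf : ∀ n, ‖f n‖ ≤ 1) {N N' : ℕ} (hN : N ≤ N')
    (h : ℕ) :
    ‖∑ n ∈ Finset.Ioc N N', f n - ∑ n ∈ Finset.Ioc N N', f (n + h)‖ ≤ 2 * h := by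
  have e1 := Finset.sum_Ioc_consecutive f hN (Nat.le_add_right N' h)
  have e2 := Finset.sum_Ioc_consecutive f (Nat.le_add_right N h)
    (Nat.add_le_add_right hN h)
  have e3 : ∑ n ∈ Finset.Ioc N N', f (n + h) = ∑ n ∈ Finset.Ioc (N + h) (N' + h), f n := by
    rw [← Finset.map_add_right_Ioc, Finset.sum_map]
    rfl
  have b : ∀ M : ℕ, ‖∑ n ∈ Finset.Ioc M (M + h), f n‖ ≤ h := fun M => by
    refine (norm_sum_le _ _).trans ((Finset.sum_le_card_nsmul _ _ 1 fun n _ => hf n).trans_eq ?_)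
    simp
  have : ∑ n ∈ Finset.Ioc N N', f n - ∑ n ∈ Finset.Ioc N N', f (n + h) =
      ∑ n ∈ Finset.Ioc N (N + h), f n - ∑ n ∈ Finset.Ioc N' (N' + h), f n := by
    rw [e3]; linear_combination e1 - e2
  rw [this]
  refine (norm_sub_le _ _).trans ?_
  linarith [b N, b N']

/-- The coefficients of the Taylor polynomial of the phase of `(n + h) ^ (-i t)`. -/
noncomputable def phaseCoeff (t n : ℝ) (j : ℕ) : ℝ :=
  t / (2 * Real.pi) * ((-1) ^ (j + 1) / ((j + 1) * n ^ (j + 1)))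

lemma norm_phase_sub_le {t n h : ℝ} (ht : 0 ≤ t) (hn : 0 < n) (h0 : 0 ≤ h) (hh : h ≤ n / 2)
    (d : ℕ) :
    ‖expChar (-(t / (2 * Real.pi)) * Real.log (n + h)) -
      expChar (-(t / (2 * Real.pi)) * Real.log n) *
        expChar (∑ j : Fin d, phaseCoeff t n j * h ^ (j + 1 : ℕ))‖ ≤
      2 * t * (h / n) ^ (d + 1) := by
  set u := h / n with hu
  have hu0 : 0 ≤ u := by positivity
  have hu1 : u ≤ 1 / 2 := by rw [hu, div_le_iff₀ hn]; linarith
  have hlog : Real.log (n + h) = Real.log n + Real.log (1 - -u) := by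
    rw [← Real.log_mul hn.ne' (by linarith)]
    congr 1
    rw [hu]; field_simp; ring
  have htaylor := Real.abs_log_sub_add_sum_range_le (x := -u) (by
    rw [abs_neg, abs_of_nonneg hu0]; linarith) d
  rw [abs_neg, abs_of_nonneg hu0] at htaylor
  set R := (∑ i ∈ Finset.range d, (-u) ^ (i + 1) / ((i : ℝ) + 1)) + Real.log (1 - -u) with hR
  have hpoly : ∑ j : Fin d, phaseCoeff t n j * h ^ (j + 1 : ℕ) =
      t / (2 * Real.pi) * ∑ i ∈ Finset.range d, (-u) ^ (i + 1) / ((i : ℝ) + 1) := by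
    rw [Fin.sum_univ_eq_sum_range (fun j => phaseCoeff t n j * h ^ (j + 1 : ℕ)), Finset.mul_sum]
    refine Finset.sum_congr rfl fun i _ => ?_
    rw [phaseCoeff, hu, neg_pow (h / n), div_pow]
    field_simp
  have hsplit : -(t / (2 * Real.pi)) * Real.log (n + h) =
      -(t / (2 * Real.pi)) * Real.log n + ∑ j : Fin d, phaseCoeff t n j * h ^ (j + 1 : ℕ) +
      -(t / (2 * Real.pi)) * R := by
    rw [hpoly, hlog, hR]; ring
  rw [hsplit, AddChar.map_add_eq_mul, AddChar.map_add_eq_mul, ← mul_sub_one, norm_mul, norm_mul,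
    norm_expChar, norm_expChar, one_mul, one_mul]
  refine (norm_expChar_sub_one_le _).trans ?_
  rw [abs_mul, abs_neg, abs_of_nonneg (by positivity)]
  have hR' : |R| ≤ 2 * u ^ (d + 1) := by
    refine htaylor.trans ?_
    rw [div_le_iff₀ (by linarith)]
    nlinarith [pow_nonneg hu0 (d + 1)]
  have : 2 * Real.pi * (t / (2 * Real.pi) * |R|) = t * |R| := by field_simp
  rw [this]
  nlinarith

/-- The bilinear exponential sum attached to a point `n` of the phase. -/
noncomputable def bilinSum (t n : ℝ) (d a : ℕ) : ℂ :=
  ∑ x ∈ Finset.Ico (0 : ℤ) a, ∑ y ∈ Finset.Ico (0 : ℤ) a,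
    expChar (∑ j : Fin d, phaseCoeff t n j * (x : ℝ) ^ (j + 1 : ℕ) * (y : ℝ) ^ (j + 1 : ℕ))

lemma norm_sum_phase_le {t : ℝ} (ht : 0 ≤ t) {N N' a d : ℕ} (ha : 1 ≤ a)
    (hN : N ≤ N') (hN' : N' ≤ 2 * N) (haN : 2 * a ^ 2 ≤ N) {w : ℝ} (hw0 : 0 ≤ w)
    (hw : ∀ n ∈ Finset.Ioc N N', ‖bilinSum t n d a‖ ≤ (a : ℝ) ^ 2 * w) :
    ‖∑ n ∈ Finset.Ioc N N', expChar (-(t / (2 * Real.pi)) * Real.log n)‖ ≤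
      2 * (a : ℝ) ^ 2 + N * (w + 2 * t * ((a : ℝ) ^ 2 / N) ^ (d + 1)) := by
  set f : ℕ → ℂ := fun n => expChar (-(t / (2 * Real.pi)) * Real.log n) with hf
  set I := Finset.Ico (0 : ℤ) a with hI
  set ρ : ℝ := 2 * t * ((a : ℝ) ^ 2 / N) ^ (d + 1) with hρ
  have hN0 : 0 < N := by nlinarith
  have hNR : (0 : ℝ) < N := by exact_mod_cast hN0
  have haR : (0 : ℝ) < a := by exact_mod_cast ha
  have hIcard : #I = a := by simp [hI]
  have hxy : ∀ x ∈ I, ∀ y ∈ I, 0 ≤ x * y ∧ x * y ≤ (a : ℤ) ^ 2 := by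
    intro x hx y hy
    rw [hI, Finset.mem_Ico] at hx hy
    exact ⟨mul_nonneg hx.1 hy.1, by nlinarith⟩
  have hshift : ∀ x ∈ I, ∀ y ∈ I,
      ‖∑ n ∈ Finset.Ioc N N', f n - ∑ n ∈ Finset.Ioc N N', f (n + (x * y).toNat)‖ ≤
        2 * (a : ℝ) ^ 2 := by
    intro x hx y hy
    refine (norm_sum_sub_sum_shift_le f (fun n => (norm_expChar _).le) hN _).trans ?_
    have h := (hxy x hx y hy)
    have : (((x * y).toNat : ℕ) : ℤ) ≤ (a : ℤ) ^ 2 := by rw [Int.toNat_of_nonneg h.1]; exact h.2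
    have : (((x * y).toNat : ℕ) : ℝ) ≤ (a : ℝ) ^ 2 := by exact_mod_cast this
    linarith
  have hcentre : ∀ n ∈ Finset.Ioc N N',
      ‖∑ x ∈ I, ∑ y ∈ I, f (n + (x * y).toNat)‖ ≤ (a : ℝ) ^ 2 * (w + ρ) := by
    intro n hn
    have hn' := Finset.mem_Ioc.mp hn
    have hnR : (N : ℝ) ≤ n := by exact_mod_cast hn'.1.le
    have hterm : ∀ x ∈ I, ∀ y ∈ I, ‖f (n + (x * y).toNat) - f n * expChar (∑ j : Fin d,
        phaseCoeff t n j * (x : ℝ) ^ (j + 1 : ℕ) * (y : ℝ) ^ (j + 1 : ℕ))‖ ≤ ρ := by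
      intro x hx y hy
      have h := (hxy x hx y hy)
      have hc : (((x * y).toNat : ℕ) : ℝ) = x * y := by
        have : (((x * y).toNat : ℕ) : ℤ) = x * y := Int.toNat_of_nonneg h.1
        exact_mod_cast congrArg (Int.cast (R := ℝ)) this
      have h0 : (0 : ℝ) ≤ x * y := by exact_mod_cast h.1
      have h1 : (x : ℝ) * y ≤ (a : ℝ) ^ 2 := by exact_mod_cast h.2
      have h2 : 2 * (a : ℝ) ^ 2 ≤ N := by exact_mod_cast haN
      have key := norm_phase_sub_le (d := d) ht (hNR.trans_le hnR) h0 (by linarith)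
      have hs : ∑ j : Fin d, phaseCoeff t n j * ((x : ℝ) * y) ^ (j + 1 : ℕ) =
          ∑ j : Fin d, phaseCoeff t n j * (x : ℝ) ^ (j + 1 : ℕ) * (y : ℝ) ^ (j + 1 : ℕ) :=
        Finset.sum_congr rfl fun j _ => by rw [mul_pow, mul_assoc]
      rw [hs] at key
      simp only [hf]
      push_cast
      rw [hc]
      refine key.trans ?_
      rw [hρ]
      gcongr
    have hsplit : ∑ x ∈ I, ∑ y ∈ I, f (n + (x * y).toNat) = f n * bilinSum t n d a +
        ∑ x ∈ I, ∑ y ∈ I, (f (n + (x * y).toNat) - f n * expChar (∑ j : Fin d,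
        phaseCoeff t n j * (x : ℝ) ^ (j + 1 : ℕ) * (y : ℝ) ^ (j + 1 : ℕ))) := by
      rw [bilinSum]
      simp_rw [Finset.sum_sub_distrib, Finset.mul_sum]
      ring
    rw [hsplit]
    refine (norm_add_le _ _).trans ?_
    rw [norm_mul, show ‖f n‖ = 1 from norm_expChar _, one_mul, mul_add]
    refine add_le_add (hw n hn) ?_
    refine (norm_sum_le _ _).trans ((Finset.sum_le_card_nsmul I _ (a * ρ) fun x hx =>
      (norm_sum_le _ _).trans ((Finset.sum_le_card_nsmul I _ ρ fun y hy =>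
        hterm x hx y hy).trans_eq ?_)).trans_eq ?_)
    · rw [hIcard, nsmul_eq_mul]
    · rw [hIcard, nsmul_eq_mul]; ring
  set S := ∑ n ∈ Finset.Ioc N N', f n with hS
  have hmain : ‖(a : ℂ) ^ 2 * S‖ ≤ (a : ℝ) ^ 2 * (2 * (a : ℝ) ^ 2 + N * (w + ρ)) := by
    have e : (a : ℂ) ^ 2 * S = ∑ x ∈ I, ∑ y ∈ I,
        (S - ∑ n ∈ Finset.Ioc N N', f (n + (x * y).toNat)) +
        ∑ n ∈ Finset.Ioc N N', ∑ x ∈ I, ∑ y ∈ I, f (n + (x * y).toNat) := by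
      have : ∑ n ∈ Finset.Ioc N N', ∑ x ∈ I, ∑ y ∈ I, f (n + (x * y).toNat) =
          ∑ x ∈ I, ∑ y ∈ I, ∑ n ∈ Finset.Ioc N N', f (n + (x * y).toNat) := by
        rw [Finset.sum_comm]
        exact Finset.sum_congr rfl fun x _ => Finset.sum_comm
      rw [this]
      simp_rw [Finset.sum_sub_distrib, Finset.sum_const, hIcard]
      simp only [nsmul_eq_mul]
      ring
    rw [e]
    refine (norm_add_le _ _).trans ?_
    rw [mul_add]
    refine add_le_add ?_ ?_
    · refine (norm_sum_le _ _).trans ((Finset.sum_le_card_nsmul I _ (a * (2 * (a : ℝ) ^ 2))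
        fun x hx => (norm_sum_le _ _).trans ((Finset.sum_le_card_nsmul I _ (2 * (a : ℝ) ^ 2)
        fun y hy => hshift x hx y hy).trans_eq ?_)).trans_eq ?_)
      · rw [hIcard, nsmul_eq_mul]
      · rw [hIcard, nsmul_eq_mul]; ring
    · refine (norm_sum_le _ _).trans ((Finset.sum_le_card_nsmul _ _ _ hcentre).trans ?_)
      rw [nsmul_eq_mul, Nat.card_Ioc]
      have : ((N' - N : ℕ) : ℝ) ≤ N := by exact_mod_cast (by omega : N' - N ≤ N)
      have hρ0 : 0 ≤ ρ := by positivity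
      calc _ ≤ (N : ℝ) * ((a : ℝ) ^ 2 * (w + ρ)) := by gcongr
        _ = _ := by ring
  rw [norm_mul, norm_pow, Complex.norm_natCast] at hmain
  exact le_of_mul_le_mul_left hmain (by positivity)

set_option maxHeartbeats 2000000 in
lemma sum_norm_sum_expChar_le_saving {X τ P Λ ν : ℝ} {j s Y : ℕ} {α : ℝ} (hτ : 1 ≤ τ)
    (hX : 10 ^ 6 * τ ^ 2 ≤ X) (hP : P ≤ X / 3900)
    (hΛ1 : X / 3 - P ≤ Λ) (hΛ2 : Λ ≤ X / 3) (hν1 : X ≤ ν) (hν2 : ν ≤ X + 1)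
    (hs1 : 72 * τ ^ 2 ≤ s) (hs2 : (s : ℝ) ≤ 128 * τ ^ 2)
    (hj1 : 3 / 2 * τ + 1 / 5 ≤ j) (hj2 : (j : ℝ) ≤ 5 / 2 * τ + 1 / 5)
    (hY : (Y : ℝ) = s * Real.exp (j * Λ))
    (hα : |α| = Real.exp (τ * X - j * ν) / (2 * Real.pi * j)) :
    ∑ l ∈ Finset.Icc (-(Y : ℤ)) Y, ‖∑ m ∈ Finset.Icc (-(Y : ℤ)) Y, expChar (α * l * m)‖ ≤
      (2 * Y + 1) ^ 2 * Real.exp (-(τ * X / 24)) := by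
  have hτ2 : 1 ≤ τ ^ 2 := one_le_pow₀ hτ
  have hX6 : 10 ^ 6 ≤ X := by nlinarith
  have hτX : X ≤ τ * X := by nlinarith
  have hj0 : (0 : ℝ) < j := by linarith
  have hj1' : (1 : ℝ) ≤ j := by linarith
  have hs0 : (1 : ℝ) ≤ s := by linarith
  have hpi := Real.pi_gt_three
  have hpi4 := Real.pi_lt_four
  have hα0 : α ≠ 0 := by
    rw [← abs_pos, hα]; positivity
  have hY1 : Real.exp (j * Λ) ≤ Y := by
    rw [hY]; exact le_mul_of_one_le_left (Real.exp_pos _).le hs0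
  have hYpos : (0 : ℝ) < Y := (Real.exp_pos _).trans_le hY1
  have hαY : |α| * Y ≤ 1 / 2 := by
    have h1 : |α| * Y = s * Real.exp (τ * X - j * ν + j * Λ) / (2 * Real.pi * j) := by
      rw [hα, hY, Real.exp_add]; ring
    have h2 : τ * X - j * ν + j * Λ ≤ -(2 * X / 15) := by nlinarith
    have h3 : (s : ℝ) ≤ Real.exp (2 * X / 15) := by
      have := Real.add_one_le_exp (2 * X / 15)
      linarith
    rw [h1, div_le_iff₀ (by positivity)]
    calc (s : ℝ) * Real.exp (τ * X - j * ν + j * Λ) ≤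
          Real.exp (2 * X / 15) * Real.exp (-(2 * X / 15)) :=
          mul_le_mul h3 (Real.exp_le_exp.mpr h2) (Real.exp_pos _).le (Real.exp_pos _).le
      _ = 1 := by rw [← Real.exp_add]; simp
      _ ≤ 1 / 2 * (2 * Real.pi * j) := by nlinarith
  refine (sum_norm_sum_expChar_le Y hα0 hαY).trans ?_
  have hE0 := Real.exp_pos (-(τ * X / 24))
  have part1 : 2 * (Y : ℝ) + 1 ≤ 1 / 2 * ((2 * Y + 1) ^ 2 * Real.exp (-(τ * X / 24))) := by
    have h1 : Real.exp (τ * X / 24) ≤ Y := by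
      refine le_trans (Real.exp_le_exp.mpr ?_) hY1
      have : 1 / 30 * X ≤ Λ := by linarith
      nlinarith
    have h2 : 1 ≤ Y * Real.exp (-(τ * X / 24)) := by
      rw [Real.exp_neg, ← div_eq_mul_inv, one_le_div (Real.exp_pos _)]; exact h1
    nlinarith
  have part2 : (1 + Real.log Y) / |α| ≤
      1 / 2 * ((2 * Y + 1) ^ 2 * Real.exp (-(τ * X / 24))) := by
    have hlogY : 1 + Real.log Y ≤ s * (1 + τ * X) := by
      rw [hY, Real.log_mul (by positivity) (Real.exp_pos _).ne', Real.log_exp]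
      have h1 := Real.log_le_sub_one_of_pos (show (0 : ℝ) < s by linarith)
      have h2 : j * Λ ≤ (5 / 2 * τ + 1 / 5) * (X / 3) := by
        refine mul_le_mul hj2 hΛ2 ?_ (by positivity)
        linarith
      have h3 : j * Λ ≤ τ * X := by nlinarith
      have h4 : τ * X ≤ s * (τ * X) := le_mul_of_one_le_left (by linarith) hs0
      linarith
    have hpj : Real.pi * j ≤ s := by nlinarith
    have hz : 1 + τ * X ≤ Real.exp (τ * X / 36) := by
      have := Real.quadratic_le_exp_of_nonneg (x := τ * X / 36) (by linarith)
      nlinarith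
    have hexp : j * ν - τ * X + τ * X / 36 ≤ 2 * (j * Λ) + -(τ * X / 24) := by
      have h1 : ν - 2 * Λ ≤ 334 / 1000 * X := by linarith
      have h2 : j * (ν - 2 * Λ) ≤ (5 / 2 * τ + 1 / 5) * (334 / 1000 * X) := by
        refine (mul_le_mul_of_nonneg_left h1 hj0.le).trans ?_
        exact mul_le_mul_of_nonneg_right hj2 (by linarith)
      nlinarith
    have hinv : (1 + Real.log Y) / |α| =
        (1 + Real.log Y) * (2 * (Real.pi * j)) * Real.exp (j * ν - τ * X) := by
      rw [hα, show (j * ν - τ * X) = -(τ * X - j * ν) by ring, Real.exp_neg]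
      field_simp
    rw [hinv]
    calc (1 + Real.log Y) * (2 * (Real.pi * j)) * Real.exp (j * ν - τ * X) ≤
          (s * Real.exp (τ * X / 36)) * (2 * s) * Real.exp (j * ν - τ * X) := by
          refine mul_le_mul_of_nonneg_right ?_ (Real.exp_pos _).le
          refine mul_le_mul (hlogY.trans ?_) (by linarith) (by positivity) (by positivity)
          exact mul_le_mul_of_nonneg_left hz (by linarith)
      _ = 2 * s ^ 2 * Real.exp (j * ν - τ * X + τ * X / 36) := by
          rw [Real.exp_add]; ring
      _ ≤ 2 * s ^ 2 * Real.exp (2 * (j * Λ) + -(τ * X / 24)) :=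
          mul_le_mul_of_nonneg_left (Real.exp_le_exp.mpr hexp) (by positivity)
      _ = 2 * Y ^ 2 * Real.exp (-(τ * X / 24)) := by
          rw [hY, Real.exp_add, two_mul (j * Λ), Real.exp_add]; ring
      _ ≤ 1 / 2 * ((2 * Y + 1) ^ 2 * Real.exp (-(τ * X / 24))) := by
          rw [← mul_assoc]
          exact mul_le_mul_of_nonneg_right (by nlinarith only [hYpos]) hE0.le
  linarith

lemma card_good_ge {τ : ℝ} (hτ : 1 ≤ τ) {d : ℕ} (hd : 3 * τ ≤ d) :
    τ / 2 ≤ #{j ∈ Finset.range d |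
      3 / 2 * τ + 1 / 5 ≤ ((j + 1 : ℕ) : ℝ) ∧ ((j + 1 : ℕ) : ℝ) ≤ 5 / 2 * τ + 1 / 5} := by
  classical
  set m := ⌈3 / 2 * τ + 1 / 5⌉₊ with hm
  have hm1 : 3 / 2 * τ + 1 / 5 ≤ m := Nat.le_ceil _
  have hm2 : (m : ℝ) < 3 / 2 * τ + 1 / 5 + 1 := Nat.ceil_lt_add_one (by linarith)
  have hmpos : 1 ≤ m := by
    have : (0 : ℝ) < m := by linarith
    exact_mod_cast this
  have hf1 : (⌊τ⌋₊ : ℝ) ≤ τ := Nat.floor_le (by linarith)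
  have hf2 : τ < ⌊τ⌋₊ + 1 := Nat.lt_floor_add_one τ
  have hf3 : (1 : ℝ) ≤ ⌊τ⌋₊ := by exact_mod_cast Nat.le_floor (by simpa using hτ)
  have hcard : ⌊τ⌋₊ ≤ #{j ∈ Finset.range d |
      3 / 2 * τ + 1 / 5 ≤ ((j + 1 : ℕ) : ℝ) ∧ ((j + 1 : ℕ) : ℝ) ≤ 5 / 2 * τ + 1 / 5} := by
    conv_lhs => rw [← Finset.card_range ⌊τ⌋₊]
    refine Finset.card_le_card_of_injOn (fun i => m - 1 + i) ?_ ?_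
    · intro i hi
      have hi' : i + 1 ≤ ⌊τ⌋₊ := by simpa using hi
      have hiR : (i : ℝ) + 1 ≤ ⌊τ⌋₊ := by exact_mod_cast hi'
      have hi0 : (0 : ℝ) ≤ i := by positivity
      have hc : ((m - 1 + i + 1 : ℕ) : ℝ) = m + i := by
        rw [show m - 1 + i + 1 = m + i by omega]; push_cast; rfl
      simp only [Finset.coe_filter, Set.mem_ofPred_eq, Finset.mem_range]
      rw [hc]
      refine ⟨?_, by linarith, by linarith⟩
      have : ((m - 1 + i + 1 : ℕ) : ℝ) ≤ d := by rw [hc]; linarith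
      have : m - 1 + i + 1 ≤ d := by exact_mod_cast this
      omega
    · intro i _ i' _ h
      simpa using h
  have : (⌊τ⌋₊ : ℝ) ≤ #{j ∈ Finset.range d |
      3 / 2 * τ + 1 / 5 ≤ ((j + 1 : ℕ) : ℝ) ∧ ((j + 1 : ℕ) : ℝ) ≤ 5 / 2 * τ + 1 / 5} := by
    exact_mod_cast hcard
  linarith

lemma sum_norm_sum_expChar_le_trivial (α : ℝ) (Y : ℕ) :
    ∑ l ∈ Finset.Icc (-(Y : ℤ)) Y, ‖∑ m ∈ Finset.Icc (-(Y : ℤ)) Y, expChar (α * l * m)‖ ≤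
      (2 * Y + 1) ^ 2 := by
  have hc : ((#(Finset.Icc (-(Y : ℤ)) Y) : ℕ) : ℝ) = 2 * Y + 1 := by
    rw [Int.card_Icc, show ((Y : ℤ) + 1 - -(Y : ℤ)).toNat = 2 * Y + 1 by omega]
    push_cast; ring
  calc ∑ l ∈ Finset.Icc (-(Y : ℤ)) Y, ‖∑ m ∈ Finset.Icc (-(Y : ℤ)) Y, expChar (α * l * m)‖
      ≤ ∑ l ∈ Finset.Icc (-(Y : ℤ)) Y, (2 * (Y : ℝ) + 1) := by
        refine Finset.sum_le_sum fun l _ => ?_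
        refine (norm_sum_le _ _).trans ?_
        simp only [norm_expChar, Finset.sum_const, nsmul_eq_mul, mul_one]
        exact hc.le
    _ = (2 * Y + 1) ^ 2 := by
        rw [Finset.sum_const, nsmul_eq_mul, hc]; ring

lemma prod_rpow_bound (d : ℕ) {s : ℝ} (hs : 1 ≤ s) {Λ : ℝ} (hΛ : 0 ≤ Λ) :
    ∏ j : Fin d, (2 * (s * Real.exp ((j + 1 : ℕ) * Λ)) + 1) ^ 2 ≤
      (3 * s) ^ (2 * d) * Real.exp (d * (d + 1) * Λ) := by
  rw [Fin.prod_univ_eq_prod_range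
    (fun j : ℕ => (2 * (s * Real.exp ((j + 1 : ℕ) * Λ)) + 1) ^ 2)]
  induction d with
  | zero => simp
  | succ d ih =>
    rw [Finset.prod_range_succ]
    have h1 : 2 * (s * Real.exp ((d + 1 : ℕ) * Λ)) + 1 ≤ 3 * s * Real.exp ((d + 1 : ℕ) * Λ) := by
      have : 1 ≤ Real.exp ((d + 1 : ℕ) * Λ) := Real.one_le_exp (by positivity)
      nlinarith
    refine (mul_le_mul ih (pow_le_pow_left₀ (by positivity) h1 2) (by positivity)
      (by positivity)).trans_eq ?_
    have e : Real.exp (((d + 1 : ℕ) : ℝ) * ((d + 1 : ℕ) + 1) * Λ) =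
        Real.exp (d * (d + 1) * Λ) * Real.exp ((d + 1 : ℕ) * Λ) ^ 2 := by
      rw [← Real.exp_nat_mul, ← Real.exp_add]
      congr 1; push_cast; ring
    rw [e]
    ring

lemma const_le_exp {p d : ℕ} (hd : 1 ≤ d) (hp1 : 8 * d ^ 2 ≤ p) (hp2 : p ≤ 16 * d ^ 2) :
    ((2 * (2 * (p : ℝ)) ^ (2 * d) * (p : ℝ) ^ d ^ 2) ^ (7 * d)) ^ 2 *
      (3 * (8 * (d : ℝ) ^ 2)) ^ (2 * d) ≤ Real.exp (264 * (d : ℝ) ^ 4) := by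
  have hd' : (1 : ℝ) ≤ d := by exact_mod_cast hd
  have hp1' : 8 * (d : ℝ) ^ 2 ≤ p := by exact_mod_cast hp1
  have hp2' : (p : ℝ) ≤ 16 * (d : ℝ) ^ 2 := by exact_mod_cast hp2
  have hp8 : (8 : ℝ) ≤ p := by nlinarith
  have h1 : 2 * (2 * (p : ℝ)) ^ (2 * d) * (p : ℝ) ^ d ^ 2 ≤ (p : ℝ) ^ (6 * d ^ 2) := by
    calc 2 * (2 * (p : ℝ)) ^ (2 * d) * (p : ℝ) ^ d ^ 2
        ≤ (p : ℝ) ^ 1 * ((p : ℝ) ^ 2) ^ (2 * d) * (p : ℝ) ^ d ^ 2 := by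
          refine mul_le_mul_of_nonneg_right ?_ (by positivity)
          refine mul_le_mul (by linarith) ?_ (by positivity) (by positivity)
          exact pow_le_pow_left₀ (by positivity) (by nlinarith) _
      _ = (p : ℝ) ^ (1 + 2 * (2 * d) + d ^ 2) := by
          rw [← pow_mul, ← pow_add, ← pow_add]
      _ ≤ _ := pow_le_pow_right₀ (by linarith) (by nlinarith)
  have h2 : (3 * (8 * (d : ℝ) ^ 2)) ^ (2 * d) ≤ ((p : ℝ) ^ 2) ^ (2 * d) :=
    pow_le_pow_left₀ (by positivity) (by nlinarith) _
  have hlog : Real.log p ≤ 3 * d := by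
    have h3 : Real.log p ≤ Real.log (16 * (d : ℝ) ^ 2) := Real.log_le_log (by linarith) hp2'
    rw [show (16 : ℝ) = 2 ^ 4 by norm_num, Real.log_mul (by positivity) (by positivity),
      Real.log_pow, Real.log_pow] at h3
    have := Real.log_two_lt_d9
    have := Real.log_le_sub_one_of_pos (show (0 : ℝ) < d by linarith)
    push_cast at h3
    linarith
  calc _ ≤ (((p : ℝ) ^ (6 * d ^ 2)) ^ (7 * d)) ^ 2 * ((p : ℝ) ^ 2) ^ (2 * d) := by
        refine mul_le_mul ?_ h2 (by positivity) (by positivity)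
        exact pow_le_pow_left₀ (by positivity) (pow_le_pow_left₀ (by positivity) h1 _) _
    _ = (p : ℝ) ^ (84 * d ^ 3 + 4 * d) := by
        rw [← pow_mul, ← pow_mul, ← pow_mul, ← pow_add]; congr 1; ring
    _ ≤ (p : ℝ) ^ (88 * d ^ 3) := by
        refine pow_le_pow_right₀ (by linarith) ?_
        have : d ≤ d ^ 3 := Nat.le_self_pow (by norm_num) d
        omega
    _ = Real.exp ((88 * d ^ 3 : ℕ) * Real.log p) := by
        rw [Real.exp_nat_mul, Real.exp_log (by linarith)]
    _ ≤ Real.exp (264 * (d : ℝ) ^ 4) := by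
        refine Real.exp_le_exp.mpr ?_
        push_cast
        have : 88 * (d : ℝ) ^ 3 * Real.log p ≤ 88 * (d : ℝ) ^ 3 * (3 * d) :=
          mul_le_mul_of_nonneg_left hlog (by positivity)
        calc _ ≤ _ := this
          _ = _ := by ring

lemma vino_sq_le {p d L : ℕ} [Fact p.Prime] {τ Λ : ℝ} (hτ : 1 ≤ τ) (hd1 : 3 * τ ≤ d)
    (hd2 : (d : ℝ) ≤ 4 * τ) (hpd : 8 * d ^ 2 ≤ p) (hΛ : Λ = L * Real.log p) :
    (vino d p (8 * d ^ 2) L : ℝ) ^ 2 ≤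
      ((2 * (2 * (p : ℝ)) ^ (2 * d) * (p : ℝ) ^ d ^ 2) ^ (7 * d)) ^ 2 *
        Real.exp (Λ * (32 * (d : ℝ) ^ 2 - d * (d + 1)) + τ ^ 2 / 50 * Λ) := by
  have hdR : (1 : ℝ) ≤ d := by linarith
  have hd : 1 ≤ d := by exact_mod_cast hdR
  have hp : 0 < (p : ℝ) := by exact_mod_cast (Fact.out : p.Prime).pos
  have hΛ0 : 0 ≤ Λ := by rw [hΛ]; exact mul_nonneg (by positivity) (Real.log_natCast_nonneg p)
  have h := vino_le hd hpd (7 * d)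
  specialize h L
  rw [show d ^ 2 + d * (7 * d) = 8 * d ^ 2 by ring] at h
  have hδ : (1 - 1 / (d : ℝ)) ^ (7 * d) ≤ 1 / 1000 := by
    have h1 : (1 - 1 / (d : ℝ)) ^ d ≤ Real.exp (-1) := by
      have := Real.one_sub_div_pow_le_exp_neg (n := d) (t := 1) (by exact_mod_cast hd)
      simpa using this
    have h0 : 0 ≤ 1 - 1 / (d : ℝ) := by
      rw [sub_nonneg, div_le_one (by linarith)]; exact hdR
    rw [mul_comm, pow_mul]
    refine (pow_le_pow_left₀ (pow_nonneg h0 _) h1 7).trans ?_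
    have := Real.exp_neg_one_lt_d9
    refine (pow_le_pow_left₀ (Real.exp_pos _).le this.le 7).trans ?_
    norm_num
  have hexp : (p : ℝ) ^ ((L : ℝ) * (2 * ((d : ℝ) ^ 2 + d * (7 * d : ℕ)) - d * (d + 1) / 2 +
        d * (d + 1) / 2 * (1 - 1 / d) ^ (7 * d))) ≤
      Real.exp (Λ * (16 * (d : ℝ) ^ 2 - d * (d + 1) / 2) + τ ^ 2 / 100 * Λ) := by
    rw [Real.rpow_def_of_pos hp]
    refine Real.exp_le_exp.mpr ?_
    have h1 : (d : ℝ) * (d + 1) / 2 * (1 - 1 / d) ^ (7 * d) ≤ τ ^ 2 / 100 := by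
      have h2 : (d : ℝ) * (d + 1) / 2 ≤ 10 * τ ^ 2 := by nlinarith
      calc _ ≤ 10 * τ ^ 2 * (1 / 1000) :=
            mul_le_mul h2 hδ (pow_nonneg (by
              rw [sub_nonneg, div_le_one (by linarith)]; exact hdR) _) (by positivity)
        _ = _ := by ring
    calc Real.log p * ((L : ℝ) * (2 * ((d : ℝ) ^ 2 + d * (7 * d : ℕ)) - d * (d + 1) / 2 +
        d * (d + 1) / 2 * (1 - 1 / d) ^ (7 * d))) =
          Λ * (16 * (d : ℝ) ^ 2 - d * (d + 1) / 2) +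
            (d * (d + 1) / 2 * (1 - 1 / d) ^ (7 * d)) * Λ := by
          rw [hΛ]; push_cast; ring
      _ ≤ _ := by
          have := mul_le_mul_of_nonneg_right h1 hΛ0
          linarith
  have h' := h.trans (mul_le_mul_of_nonneg_left hexp (by positivity))
  refine (pow_le_pow_left₀ (by positivity) h' 2).trans_eq ?_
  rw [mul_pow, ← Real.exp_nat_mul]
  congr 2
  push_cast; ring

lemma abs_phaseCoeff {t n : ℝ} (ht : 0 < t) (hn : 0 < n) (j : ℕ) :
    |phaseCoeff t n j| =
      Real.exp (Real.log t - (j + 1 : ℕ) * Real.log n) / (2 * Real.pi * (j + 1 : ℕ)) := by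
  have hpi := Real.pi_pos
  unfold phaseCoeff
  rw [Real.exp_sub, Real.exp_log ht, Real.exp_nat_mul, Real.exp_log hn, abs_mul, abs_div,
    abs_div, abs_pow, abs_neg, abs_one, one_pow, abs_of_pos ht, abs_of_pos (by positivity),
    abs_of_pos (by positivity)]
  push_cast
  field_simp

set_option maxHeartbeats 1000000 in
lemma norm_bilinSum_le {X τ : ℝ} {t n : ℝ} {d p L : ℕ} [hp : Fact p.Prime] (hτ : 1 ≤ τ)
    (hX : 10 ^ 6 * τ ^ 2 ≤ X) (hd1 : 3 * τ ≤ d) (hd2 : (d : ℝ) ≤ 4 * τ)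
    (hp1 : 8 * d ^ 2 ≤ p) (hp2 : p ≤ 16 * d ^ 2)
    (hΛ1 : X / 3 - Real.log p ≤ L * Real.log p) (hΛ2 : L * Real.log p ≤ X / 3)
    (ht : 0 < t) (ht' : Real.log t = τ * X) (hn : 0 < n)
    (hn1 : X ≤ Real.log n) (hn2 : Real.log n ≤ X + 1) :
    ‖bilinSum t n d (p ^ L)‖ ≤
      ((p ^ L : ℕ) : ℝ) ^ 2 * Real.exp (2 - X / (10 ^ 7 * τ ^ 2)) := by
  classical
  set Λ := L * Real.log p with hΛ
  set s := 8 * d ^ 2 with hs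
  set a := p ^ L with ha
  have hτ2 : 1 ≤ τ ^ 2 := one_le_pow₀ hτ
  have hdR : (1 : ℝ) ≤ d := by linarith
  have hd : 1 ≤ d := by exact_mod_cast hdR
  have hp0 : 0 < (p : ℝ) := by exact_mod_cast hp.out.pos
  have hΛ0 : 0 ≤ Λ := mul_nonneg (by positivity) (Real.log_natCast_nonneg p)
  have hsR : (s : ℝ) = 8 * (d : ℝ) ^ 2 := by rw [hs]; push_cast; ring
  have hs1 : 1 ≤ s := by rw [hs]; nlinarith
  have hs72 : 72 * τ ^ 2 ≤ s := by rw [hsR]; nlinarith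
  have hs128 : (s : ℝ) ≤ 128 * τ ^ 2 := by rw [hsR]; nlinarith
  have haR : (a : ℝ) = Real.exp Λ := by
    rw [hΛ, Real.exp_nat_mul, Real.exp_log hp0, ha]; push_cast; rfl
  have hP : Real.log p ≤ X / 3900 := by
    have h1 := Real.log_le_sub_one_of_pos hp0
    have h2 : (p : ℝ) ≤ 16 * (d : ℝ) ^ 2 := by exact_mod_cast hp2
    have h3 : (d : ℝ) ^ 2 ≤ 16 * τ ^ 2 := by nlinarith
    linarith
  have hJ := vino_sq_le (p := p) (L := L) hτ hd1 hd2 hp1 rfl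
  rw [← hΛ] at hJ
  have hbil := bilinear_le expChar (fun g => expChar_neg g) d s a hs1
    (fun j => phaseCoeff t n j)
  have hcount : count d (fun _ : Fin s => Finset.Ico (0 : ℤ) a) 0 = vino d p s L := by
    unfold vino; rw [ha]; push_cast; rfl
  rw [hcount] at hbil
  set good : ℕ → Prop := fun j =>
    3 / 2 * τ + 1 / 5 ≤ ((j + 1 : ℕ) : ℝ) ∧ ((j + 1 : ℕ) : ℝ) ≤ 5 / 2 * τ + 1 / 5 with hgood
  set g : ℝ := Real.exp (-(τ * X / 24)) with hg
  have hYj : ∀ j : ℕ, ((s * a ^ (j + 1 : ℕ) : ℕ) : ℝ) = s * Real.exp ((j + 1 : ℕ) * Λ) := by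
    intro j
    rw [Real.exp_nat_mul, ← haR]; push_cast; rfl
  have hprod : ∏ j : Fin d, ∑ l ∈ Finset.Icc (-((s * a ^ (j + 1 : ℕ) : ℕ) : ℤ))
        ((s * a ^ (j + 1 : ℕ) : ℕ) : ℤ), ‖∑ m ∈ Finset.Icc (-((s * a ^ (j + 1 : ℕ) : ℕ) : ℤ))
        ((s * a ^ (j + 1 : ℕ) : ℕ) : ℤ), expChar (phaseCoeff t n j * l * m)‖ ≤
      (3 * (8 * (d : ℝ) ^ 2)) ^ (2 * d) * Real.exp (d * (d + 1) * Λ) *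
        Real.exp (-(τ ^ 2 * X / 48)) := by
    have h1 : ∏ j : Fin d, ∑ l ∈ Finset.Icc (-((s * a ^ (j + 1 : ℕ) : ℕ) : ℤ))
        ((s * a ^ (j + 1 : ℕ) : ℕ) : ℤ), ‖∑ m ∈ Finset.Icc (-((s * a ^ (j + 1 : ℕ) : ℕ) : ℤ))
        ((s * a ^ (j + 1 : ℕ) : ℕ) : ℤ), expChar (phaseCoeff t n j * l * m)‖ ≤
        ∏ j : Fin d, ((2 * (s * Real.exp ((j + 1 : ℕ) * Λ)) + 1) ^ 2 *
          if good j then g else 1) := by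
      refine Finset.prod_le_prod (fun j _ => by positivity) fun j _ => ?_
      rw [← hYj]
      split_ifs with hj
      · exact sum_norm_sum_expChar_le_saving hτ hX hP hΛ1 hΛ2 hn1 hn2 hs72 hs128 hj.1 hj.2
          (hYj j) (by rw [abs_phaseCoeff ht hn, ht'])
      · rw [mul_one]
        exact sum_norm_sum_expChar_le_trivial _ _
    refine h1.trans ?_
    rw [Finset.prod_mul_distrib]
    have h2 := prod_rpow_bound d (s := (s : ℝ)) (by exact_mod_cast hs1) hΛ0
    have h3 : ∏ j : Fin d, (if good j then g else 1) ≤ Real.exp (-(τ ^ 2 * X / 48)) := by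
      rw [Fin.prod_univ_eq_prod_range (fun j : ℕ => if good j then g else 1),
        ← Finset.prod_filter, Finset.prod_const, hg, ← Real.exp_nat_mul]
      refine Real.exp_le_exp.mpr ?_
      have h4 := card_good_ge hτ hd1
      have h5 := mul_le_mul_of_nonneg_right h4 (show 0 ≤ τ * X / 24 by
        have : 0 ≤ X := by nlinarith
        positivity)
      have h6 : τ / 2 * (τ * X / 24) = τ ^ 2 * X / 48 := by ring
      rw [mul_neg, neg_le_neg_iff, ← h6]
      convert h5 using 3
    rw [hsR] at h2 ⊢
    refine mul_le_mul h2 h3 (Finset.prod_nonneg fun j _ => ?_) (by positivity)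
    split_ifs <;> positivity
  have hK := const_le_exp hd hp1 hp2
  set K0 : ℝ := ((2 * (2 * (p : ℝ)) ^ (2 * d) * (p : ℝ) ^ d ^ 2) ^ (7 * d)) ^ 2 with hK0
  have hpow : ((a : ℝ) ^ (2 * s - 1)) ^ (2 * s) * ((a : ℝ) ^ (2 * s)) ^ (2 * s - 1) =
      Real.exp (Λ * (8 * (8 * (d : ℝ) ^ 2) ^ 2 - 4 * (8 * (d : ℝ) ^ 2))) := by
    rw [haR, ← Real.exp_nat_mul, ← Real.exp_nat_mul, ← Real.exp_nat_mul, ← Real.exp_nat_mul,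
      ← Real.exp_add, Nat.cast_sub (by omega)]
    congr 1
    push_cast
    rw [hsR]; ring
  set u : ℝ := 2 * Λ + (2 - X / (10 ^ 7 * τ ^ 2)) with hu
  have hgoal : ((a : ℕ) : ℝ) ^ 2 * Real.exp (2 - X / (10 ^ 7 * τ ^ 2)) = Real.exp u := by
    rw [haR, ← Real.exp_nat_mul, ← Real.exp_add]
    congr 1
  rw [hgoal]
  refine le_of_pow_le_pow_left₀ (n := 2 * s * (2 * s)) (by positivity) (Real.exp_pos _).le ?_
  have hbil' : ‖bilinSum t n d a‖ ^ (2 * s * (2 * s)) ≤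
      ((a : ℝ) ^ (2 * s - 1)) ^ (2 * s) * ((a : ℝ) ^ (2 * s)) ^ (2 * s - 1) *
      (vino d p s L : ℝ) ^ 2 * ((3 * (8 * (d : ℝ) ^ 2)) ^ (2 * d) *
        Real.exp (d * (d + 1) * Λ) * Real.exp (-(τ ^ 2 * X / 48))) :=
    hbil.trans (mul_le_mul_of_nonneg_left hprod (by positivity))
  refine hbil'.trans ?_
  rw [hpow, ← Real.exp_nat_mul]
  calc _ ≤ Real.exp (Λ * (8 * (8 * (d : ℝ) ^ 2) ^ 2 - 4 * (8 * (d : ℝ) ^ 2))) *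
        (K0 * Real.exp (Λ * (32 * (d : ℝ) ^ 2 - d * (d + 1)) + τ ^ 2 / 50 * Λ)) *
        ((3 * (8 * (d : ℝ) ^ 2)) ^ (2 * d) *
        Real.exp (d * (d + 1) * Λ) * Real.exp (-(τ ^ 2 * X / 48))) := by
        refine mul_le_mul_of_nonneg_right ?_ (by positivity)
        exact mul_le_mul_of_nonneg_left hJ (Real.exp_pos _).le
    _ = (K0 * (3 * (8 * (d : ℝ) ^ 2)) ^ (2 * d)) *
        Real.exp (Λ * (8 * (8 * (d : ℝ) ^ 2) ^ 2) + τ ^ 2 / 50 * Λ - τ ^ 2 * X / 48) := by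
        have e : Real.exp (Λ * (8 * (8 * (d : ℝ) ^ 2) ^ 2) + τ ^ 2 / 50 * Λ - τ ^ 2 * X / 48) =
          Real.exp (Λ * (8 * (8 * (d : ℝ) ^ 2) ^ 2 - 4 * (8 * (d : ℝ) ^ 2))) *
          Real.exp (Λ * (32 * (d : ℝ) ^ 2 - d * (d + 1)) + τ ^ 2 / 50 * Λ) *
          Real.exp (d * (d + 1) * Λ) * Real.exp (-(τ ^ 2 * X / 48)) := by
          rw [← Real.exp_add, ← Real.exp_add, ← Real.exp_add]
          congr 1; ring
        rw [e]; ring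
    _ ≤ Real.exp (264 * (d : ℝ) ^ 4) *
        Real.exp (Λ * (8 * (8 * (d : ℝ) ^ 2) ^ 2) + τ ^ 2 / 50 * Λ - τ ^ 2 * X / 48) :=
        mul_le_mul_of_nonneg_right hK (Real.exp_pos _).le
    _ ≤ _ := by
        rw [← Real.exp_add]
        refine Real.exp_le_exp.mpr ?_
        push_cast
        rw [hsR, hu]
        have hX0 : 0 ≤ X := by nlinarith
        have h1 : τ ^ 2 / 50 * Λ ≤ τ ^ 2 / 50 * (X / 3) :=
          mul_le_mul_of_nonneg_left hΛ2 (by positivity)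
        have hd4 : (d : ℝ) ^ 4 ≤ 256 * τ ^ 4 := by
          calc (d : ℝ) ^ 4 ≤ (4 * τ) ^ 4 := pow_le_pow_left₀ (by positivity) hd2 4
            _ = _ := by ring
        have h2 : 256 * (d : ℝ) ^ 4 * (X / (10 ^ 7 * τ ^ 2)) ≤ τ ^ 2 * X / 96 := by
          calc 256 * (d : ℝ) ^ 4 * (X / (10 ^ 7 * τ ^ 2)) ≤
                256 * (256 * τ ^ 4) * (X / (10 ^ 7 * τ ^ 2)) := by
                refine mul_le_mul_of_nonneg_right (by linarith) (by positivity)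
            _ = 65536 / 10 ^ 7 * (τ ^ 2 * X) := by field_simp; ring
            _ ≤ _ := by
                have : 0 ≤ τ ^ 2 * X := by positivity
                linarith
        have h3 : 0 ≤ (d : ℝ) ^ 4 := by positivity
        have h4 : 0 ≤ τ ^ 2 * X := by positivity
        nlinarith only [h1, h2, h3, h4]

lemma norm_sum_expChar_log_le_trivial (t : ℝ) {N N' : ℕ} (hN' : N' ≤ 2 * N) :
    ‖∑ n ∈ Finset.Ioc N N', expChar (-(t / (2 * Real.pi)) * Real.log n)‖ ≤ N := by
  refine (norm_sum_le _ _).trans ?_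
  simp only [norm_expChar, Finset.sum_const, nsmul_eq_mul, mul_one, Nat.card_Ioc]
  exact_mod_cast (by omega : N' - N ≤ N)

lemma norm_zetaSum_le_of_large {X τ t : ℝ} {N N' : ℕ} (hN : 1 ≤ N) (hNN : N ≤ N')
    (hN' : N' ≤ 2 * N) (hX : X = Real.log N) (hτ : 1 ≤ τ) (hXτ : 10 ^ 6 * τ ^ 2 ≤ X)
    (ht : 0 < t) (ht' : Real.log t = τ * X) :
    ‖∑ n ∈ Finset.Ioc N N', expChar (-(t / (2 * Real.pi)) * Real.log n)‖ ≤
      (4 + Real.exp 2) * N * Real.exp (-(X / (10 ^ 7 * τ ^ 2))) := by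
  have hτ2 : 1 ≤ τ ^ 2 := one_le_pow₀ hτ
  have hX6 : 10 ^ 6 ≤ X := by nlinarith
  have hNpos : (0 : ℝ) < N := by exact_mod_cast hN
  have hNexp : (N : ℝ) = Real.exp X := by rw [hX, Real.exp_log hNpos]
  set d := ⌈3 * τ⌉₊ with hd
  have hd1 : 3 * τ ≤ d := Nat.le_ceil _
  have hd2 : (d : ℝ) ≤ 4 * τ := by
    have := Nat.ceil_lt_add_one (show 0 ≤ 3 * τ by linarith)
    rw [← hd] at this
    linarith
  have hd0 : 1 ≤ d := by
    have : (1 : ℝ) ≤ d := by linarith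
    exact_mod_cast this
  obtain ⟨p, hp, hp1, hp2⟩ := Nat.exists_prime_lt_and_le_two_mul (8 * d ^ 2) (by positivity)
  have hp3 : p ≤ 16 * d ^ 2 := by omega
  have : Fact p.Prime := ⟨hp⟩
  have hp0 : 0 < (p : ℝ) := by exact_mod_cast hp.pos
  have hpow : ∀ m : ℕ, ((p : ℝ) ^ 3) ^ m = Real.exp (3 * m * Real.log p) := by
    intro m
    rw [← pow_mul, show 3 * (m : ℝ) * Real.log p = ((3 * m : ℕ) : ℝ) * Real.log p by
      push_cast; ring, Real.exp_nat_mul, Real.exp_log hp0]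
  set L := Nat.log (p ^ 3) N with hL
  have hp31 : 1 < p ^ 3 := Nat.one_lt_pow (by norm_num) hp.one_lt
  have hL1 : ((p : ℝ) ^ 3) ^ L ≤ N := by exact_mod_cast Nat.pow_log_le_self (p ^ 3) (by omega)
  have hL2 : (N : ℝ) ≤ ((p : ℝ) ^ 3) ^ (L + 1) := by
    exact_mod_cast (Nat.lt_pow_succ_log_self hp31 N).le
  rw [hpow, hNexp, Real.exp_le_exp] at hL1 hL2
  push_cast at hL2
  set Λ := L * Real.log p with hΛ
  set a := p ^ L with ha
  have haR : (a : ℝ) = Real.exp Λ := by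
    rw [hΛ, Real.exp_nat_mul, Real.exp_log hp0, ha]; push_cast; rfl
  have hΛ2 : Λ ≤ X / 3 := by linarith
  have hΛ1 : X / 3 - Real.log p ≤ Λ := by linarith
  have ha2 : (a : ℝ) ^ 2 ≤ N * Real.exp (-(X / 3)) := by
    rw [haR, ← Real.exp_nat_mul, hNexp, ← Real.exp_add]
    refine Real.exp_le_exp.mpr ?_
    push_cast; linarith
  have h2 : 2 * Real.exp (-(X / 3)) ≤ 1 := by
    rw [Real.exp_neg, ← div_eq_mul_inv, div_le_one (Real.exp_pos _)]
    have := Real.add_one_le_exp (X / 3)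
    linarith
  have haN : 2 * a ^ 2 ≤ N := by
    have : (2 : ℝ) * (a : ℝ) ^ 2 ≤ N := by nlinarith
    exact_mod_cast this
  have hmain := norm_sum_phase_le (d := d) ht.le (Nat.pos_of_ne_zero (by
    rw [ha]; exact pow_ne_zero _ hp.ne_zero)) hNN hN' haN
    (Real.exp_pos (2 - X / (10 ^ 7 * τ ^ 2))).le (fun n hn => by
      rw [Finset.mem_Ioc] at hn
      have hn1 : (N : ℝ) ≤ n := by exact_mod_cast hn.1.le
      have hn2 : (n : ℝ) ≤ 2 * N := by exact_mod_cast hn.2.trans hN'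
      have hn0 : (0 : ℝ) < n := hNpos.trans_le hn1
      refine norm_bilinSum_le hτ hXτ hd1 hd2 hp1.le hp3 hΛ1 hΛ2 ht ht' hn0 ?_ ?_
      · rw [hX]; exact Real.log_le_log hNpos hn1
      · have h3 := Real.log_le_log hn0 hn2
        rw [Real.log_mul (by norm_num) hNpos.ne', ← hX] at h3
        have := Real.log_two_lt_d9
        linarith)
  refine hmain.trans ?_
  set E := Real.exp (-(X / (10 ^ 7 * τ ^ 2))) with hE
  have hE1 : Real.exp (-(X / 3)) ≤ E := by
    refine Real.exp_le_exp.mpr (neg_le_neg ?_)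
    exact div_le_div_of_nonneg_left (by linarith) (by norm_num) (by linarith)
  have h3 : t * ((a : ℝ) ^ 2 / N) ^ (d + 1) ≤ Real.exp (-(X / 3)) := by
    have h4 : (a : ℝ) ^ 2 / N ≤ Real.exp (-(X / 3)) := by
      rw [div_le_iff₀ hNpos, mul_comm]; exact ha2
    calc t * ((a : ℝ) ^ 2 / N) ^ (d + 1) ≤ Real.exp (τ * X) * Real.exp (-(X / 3)) ^ (d + 1) := by
          refine mul_le_mul ?_ (pow_le_pow_left₀ (by positivity) h4 _) (by positivity)
            (Real.exp_pos _).le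
          rw [← ht', Real.exp_log ht]
      _ = Real.exp (τ * X + (d + 1 : ℕ) * (-(X / 3))) := by
          rw [← Real.exp_nat_mul, ← Real.exp_add]
      _ ≤ _ := by
          refine Real.exp_le_exp.mpr ?_
          push_cast
          nlinarith
  have h5 : Real.exp (2 - X / (10 ^ 7 * τ ^ 2)) = Real.exp 2 * E := by
    rw [hE, ← Real.exp_add]; rfl
  rw [h5]
  have h6 : (N : ℝ) * Real.exp (-(X / 3)) ≤ N * E := mul_le_mul_of_nonneg_left hE1 hNpos.le
  have h7 : (N : ℝ) * (t * ((a : ℝ) ^ 2 / N) ^ (d + 1)) ≤ N * E :=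
    mul_le_mul_of_nonneg_left (h3.trans hE1) hNpos.le
  nlinarith only [h6, h7, ha2]

/-- Vinogradov's bound for zeta sums. -/
theorem norm_zetaSum_le {t : ℝ} {N N' : ℕ} (hN : 1 ≤ N) (hNN : N ≤ N')
    (hN' : N' ≤ 2 * N) (ht : N ≤ t) :
    ‖∑ n ∈ Finset.Ioc N N', expChar (-(t / (2 * Real.pi)) * Real.log n)‖ ≤
      (4 + Real.exp 2) * N * Real.exp (-(Real.log N ^ 3 / (10 ^ 7 * Real.log t ^ 2))) := by
  have hNpos : (0 : ℝ) < N := by exact_mod_cast hN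
  have hN1 : (1 : ℝ) ≤ N := by exact_mod_cast hN
  set X := Real.log N with hX
  have hX0 : 0 ≤ X := Real.log_natCast_nonneg N
  have ht0 : 0 < t := by linarith
  have hlt : X ≤ Real.log t := Real.log_le_log hNpos ht
  have he : 2 ≤ Real.exp 2 := by linarith [Real.add_one_le_exp (2 : ℝ)]
  have hdich : X ^ 3 / (10 ^ 7 * Real.log t ^ 2) ≤ 1 / 10 ∨
      (0 < X ∧ 10 ^ 6 * (Real.log t / X) ^ 2 ≤ X) := by
    rcases hX0.eq_or_lt with h0 | h0
    · left; rw [← h0]; norm_num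
    · by_cases h : 10 ^ 6 * (Real.log t / X) ^ 2 ≤ X
      · exact Or.inr ⟨h0, h⟩
      · left
        push Not at h
        rw [div_pow, mul_div_assoc', lt_div_iff₀ (by positivity)] at h
        rw [div_le_iff₀ (by nlinarith)]
        nlinarith
  rcases hdich with h | ⟨h0, h⟩
  · refine (norm_sum_expChar_log_le_trivial t hN').trans ?_
    have h1 : 1 - 1 / 10 ≤ Real.exp (-(X ^ 3 / (10 ^ 7 * Real.log t ^ 2))) := by
      have := Real.add_one_le_exp (-(X ^ 3 / (10 ^ 7 * Real.log t ^ 2)))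
      linarith
    calc (N : ℝ) ≤ 6 * N * (1 - 1 / 10) := by linarith
      _ ≤ _ := mul_le_mul (mul_le_mul_of_nonneg_right (by linarith) hNpos.le) h1 (by norm_num)
          (by positivity)
  · have hτ : 1 ≤ Real.log t / X := by rw [one_le_div h0]; exact hlt
    refine (norm_zetaSum_le_of_large hN hNN hN' hX hτ h ht0 (by field_simp)).trans_eq ?_
    have hl : 0 < Real.log t := by linarith
    congr 3
    field_simp

lemma norm_ofReal_cpow_neg_sub_le {s : ℂ} (hs : 1 / 2 ≤ s.re) {a : ℝ} (ha : 0 < a) {u v : ℝ}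
    (hu : a ≤ u) (huv : u ≤ v) :
    ‖((v : ℂ) ^ (-s) - (u : ℂ) ^ (-s))‖ ≤ ‖s‖ * a ^ (-(s.re + 1)) * (v - u) := by
  have hs0 : -s ≠ 0 := by
    intro h
    have : s.re = 0 := by rw [neg_eq_zero.mp h]; rfl
    linarith
  refine norm_image_sub_le_of_norm_deriv_le_segment' (f := fun x : ℝ => (x : ℂ) ^ (-s))
    (f' := fun x : ℝ => -s * (x : ℂ) ^ (-s - 1)) ?_ ?_ v ⟨huv, le_rfl⟩
  · intro x hx
    have hx0 : x ≠ 0 := (ha.trans_le (hu.trans hx.1)).ne'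
    exact (hasDerivAt_ofReal_cpow_const hx0 hs0).hasDerivWithinAt
  · intro x hx
    have hx0 : 0 < x := ha.trans_le (hu.trans hx.1)
    rw [norm_mul, norm_neg, Complex.norm_cpow_eq_rpow_re_of_pos hx0]
    refine mul_le_mul_of_nonneg_left ?_ (norm_nonneg s)
    have h1 : (-s - 1).re = -(s.re + 1) := by simp; ring
    rw [h1]
    exact Real.rpow_le_rpow_of_nonpos ha (hu.trans hx.1) (by linarith)

/-- The `n`-th term of the remainder in Euler's summation formula for `(s - 1) ζ(s)`. -/
noncomputable def eulerTerm (n : ℕ) (s : ℂ) : ℂ :=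
  (s - 1) * ((n + 1 : ℕ) : ℂ) ^ (-s) - (n : ℂ) ^ (1 - s) + ((n + 1 : ℕ) : ℂ) ^ (1 - s)

lemma norm_eulerTerm_le {n : ℕ} (hn : 1 ≤ n) {s : ℂ} (hs : 1 / 2 ≤ s.re) :
    ‖eulerTerm n s‖ ≤ ‖s - 1‖ * ‖s‖ * (n : ℝ) ^ (-(3 / 2) : ℝ) := by
  have hn0 : (0 : ℝ) < n := by exact_mod_cast hn
  have hn1 : (1 : ℝ) ≤ n := by exact_mod_cast hn
  rcases eq_or_ne s 1 with rfl | hs1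
  · simp [eulerTerm]
  have hs1' : s - 1 ≠ 0 := sub_ne_zero.mpr hs1
  have key := norm_image_sub_le_of_norm_deriv_le_segment' (a := (n : ℝ)) (b := n + 1)
    (f := fun x : ℝ => (x : ℂ) ^ (1 - s) + (s - 1) * ((n + 1 : ℕ) : ℂ) ^ (-s) * x)
    (f' := fun x : ℝ => (s - 1) * (((n + 1 : ℕ) : ℂ) ^ (-s) - (x : ℂ) ^ (-s)))
    (C := ‖s - 1‖ * ‖s‖ * (n : ℝ) ^ (-(3 / 2) : ℝ)) ?_ ?_ (n + 1) ⟨by linarith, le_rfl⟩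
  · refine le_trans (le_of_eq ?_) (key.trans_eq (by ring))
    congr 1
    unfold eulerTerm
    push_cast
    ring
  · intro x hx
    have hx0 : x ≠ 0 := (hn0.trans_le hx.1).ne'
    have h1 := hasDerivAt_ofReal_cpow_const hx0 (r := 1 - s) (sub_ne_zero.mpr hs1.symm)
    have h2 := h1.add
      ((Complex.ofRealCLM.hasDerivAt (x := x)).const_mul ((s - 1) * ((n + 1 : ℕ) : ℂ) ^ (-s)))
    refine (h2.congr_deriv ?_).hasDerivWithinAt
    simp only [Complex.ofRealCLM_apply, Complex.ofReal_one]
    rw [show 1 - s - 1 = -s by ring]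
    ring
  · intro x hx
    rw [norm_mul, mul_assoc]
    refine mul_le_mul_of_nonneg_left ?_ (norm_nonneg _)
    have h1 := norm_ofReal_cpow_neg_sub_le hs hn0 hx.1 (v := n + 1) hx.2.le
    push_cast at h1 ⊢
    refine h1.trans ?_
    have h2 : (n : ℝ) ^ (-(s.re + 1)) ≤ (n : ℝ) ^ (-(3 / 2) : ℝ) :=
      Real.rpow_le_rpow_of_exponent_le hn1 (by linarith)
    have h3 : ((n : ℝ) + 1 - x) ≤ 1 := by linarith [hx.1]
    have h4 : 0 ≤ (n : ℝ) + 1 - x := by linarith [hx.2]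
    calc ‖s‖ * (n : ℝ) ^ (-(s.re + 1)) * (n + 1 - x) ≤ ‖s‖ * (n : ℝ) ^ (-(s.re + 1)) * 1 :=
          mul_le_mul_of_nonneg_left h3 (by positivity)
      _ ≤ _ := by rw [mul_one]; exact mul_le_mul_of_nonneg_left h2 (norm_nonneg _)

lemma summable_rpow_shift (N : ℕ) :
    Summable fun m : ℕ => ((N + m : ℕ) : ℝ) ^ (-(3 / 2) : ℝ) := by
  have h : Summable fun m : ℕ => ((m : ℕ) : ℝ) ^ (-(3 / 2) : ℝ) :=
    Real.summable_nat_rpow.mpr (by norm_num)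
  exact ((summable_nat_add_iff N).mpr h).congr fun m => by rw [add_comm]

lemma sum_range_eulerTerm (N M : ℕ) (s : ℂ) :
    ∑ m ∈ Finset.range M, eulerTerm (N + m) s =
      (s - 1) * (∑ n ∈ Finset.range M, ((N + n + 1 : ℕ) : ℂ) ^ (-s)) - (N : ℂ) ^ (1 - s) +
        ((N + M : ℕ) : ℂ) ^ (1 - s) := by
  induction M with
  | zero => simp
  | succ M ih =>
    rw [Finset.sum_range_succ, ih, Finset.sum_range_succ, eulerTerm]
    push_cast
    ring_nf

lemma riemannZeta₁_eq_of_one_lt_re {s : ℂ} (hs : 1 < s.re) {N : ℕ} (hN : 1 ≤ N) :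
    riemannZeta₁ s = (s - 1) * ∑ n ∈ Finset.range N, ((n + 1 : ℕ) : ℂ) ^ (-s) +
      (N : ℂ) ^ (1 - s) + ∑' m : ℕ, eulerTerm (N + m) s := by
  have hs1 : s ≠ 1 := by rintro rfl; simp at hs
  have hz : riemannZeta₁ s = (s - 1) * riemannZeta s := by
    rw [riemannZeta_eq_inv_sub_mul hs1, mul_inv_cancel_left₀ (sub_ne_zero.mpr hs1)]
  have hsum : Summable fun n : ℕ => ((n + 1 : ℕ) : ℂ) ^ (-s) := by
    have := (Complex.summable_one_div_nat_cpow (p := s)).mpr hs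
    refine ((summable_nat_add_iff 1).mpr this).congr fun n => ?_
    rw [Complex.cpow_neg, one_div]
  have hzeta : riemannZeta s = ∑' n : ℕ, ((n + 1 : ℕ) : ℂ) ^ (-s) := by
    rw [zeta_eq_tsum_one_div_nat_add_one_cpow hs]
    refine tsum_congr fun n => ?_
    rw [Complex.cpow_neg, one_div]; push_cast; rfl
  have hS : Summable fun m : ℕ => eulerTerm (N + m) s := by
    refine Summable.of_norm_bounded ((summable_rpow_shift N).mul_left (‖s - 1‖ * ‖s‖))
      fun m => ?_
    exact norm_eulerTerm_le (by omega) (by linarith)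
  have h1 := hS.hasSum.tendsto_sum_nat
  have h2 : Filter.Tendsto (fun M => ∑ m ∈ Finset.range M, eulerTerm (N + m) s) Filter.atTop
      (nhds ((s - 1) * (∑' n : ℕ, ((n + N + 1 : ℕ) : ℂ) ^ (-s)) - (N : ℂ) ^ (1 - s) + 0)) := by
    simp_rw [sum_range_eulerTerm]
    have hs' := ((summable_nat_add_iff N).mpr hsum)
    refine ((Filter.Tendsto.const_mul _ ?_).sub_const _).add ?_
    · refine hs'.hasSum.tendsto_sum_nat.congr fun M => ?_
      refine Finset.sum_congr rfl fun n _ => ?_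
      rw [show N + n + 1 = n + N + 1 by ring]
    · rw [tendsto_zero_iff_norm_tendsto_zero]
      have h3 : Filter.Tendsto (fun M : ℕ => ((N + M : ℕ) : ℝ) ^ (-(s.re - 1))) Filter.atTop
          (nhds 0) := by
        refine (tendsto_rpow_neg_atTop (by linarith)).comp ?_
        refine tendsto_natCast_atTop_atTop.comp ?_
        exact Filter.tendsto_atTop_mono (fun M => Nat.le_add_left M N) Filter.tendsto_id
      refine h3.congr fun M => ?_
      rw [Complex.norm_natCast_cpow_of_pos (by omega)]
      simp
  have h3 := tendsto_nhds_unique h1 h2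
  rw [h3, hz, hzeta, ← hsum.sum_add_tsum_nat_add N]
  ring

lemma riemannZeta₁_eq_of_half_lt_re {s : ℂ} (hs : 1 / 2 < s.re) {N : ℕ} (hN : 1 ≤ N) :
    riemannZeta₁ s = (s - 1) * ∑ n ∈ Finset.range N, ((n + 1 : ℕ) : ℂ) ^ (-s) +
      (N : ℂ) ^ (1 - s) + ∑' m : ℕ, eulerTerm (N + m) s := by
  have hpow : ∀ n : ℕ, 1 ≤ n → Differentiable ℂ fun s : ℂ => (n : ℂ) ^ (-s) := fun n hn z =>
    (differentiableAt_id.neg).const_cpow (Or.inl (by exact_mod_cast (by omega : n ≠ 0)))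
  have hpow1 : ∀ n : ℕ, 1 ≤ n → Differentiable ℂ fun s : ℂ => (n : ℂ) ^ (1 - s) := fun n hn z =>
    ((differentiableAt_const _).sub differentiableAt_id).const_cpow
      (Or.inl (by exact_mod_cast (by omega : n ≠ 0)))
  set R : ℝ := ‖s‖ + 3 with hR
  set U : Set ℂ := {z : ℂ | 1 / 2 < z.re} ∩ Metric.ball 0 R with hU
  have hUo : IsOpen U := (isOpen_lt continuous_const Complex.continuous_re).inter Metric.isOpen_ball
  have hUc : IsPreconnected U :=
    ((convex_halfSpace_re_gt _).inter (convex_ball _ _)).isPreconnected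
  have hsU : s ∈ U := ⟨hs, by simp [hR]⟩
  have h2U : (2 : ℂ) ∈ U := ⟨by norm_num, by
    have := norm_nonneg s
    simp [hR]; linarith⟩
  have hdiff : DifferentiableOn ℂ (fun z => ∑' m : ℕ, eulerTerm (N + m) z) U := by
    refine Complex.differentiableOn_tsum_of_summable_norm
      ((summable_rpow_shift N).mul_left ((R + 1) * R)) (fun m => ?_) hUo fun m w hw => ?_
    · unfold eulerTerm
      exact ((((differentiable_id.sub_const 1).mul (hpow _ (by omega))).sub
        (hpow1 _ (by omega))).add (hpow1 _ (by omega))).differentiableOn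
    · refine (norm_eulerTerm_le (by omega) hw.1.le).trans ?_
      have hw2 : ‖w‖ ≤ R := by simpa using (Metric.mem_ball.mp hw.2).le
      have hw3 : ‖w - 1‖ ≤ R + 1 := (norm_sub_le _ _).trans (by simpa using hw2)
      gcongr
  have hfin : Differentiable ℂ fun z : ℂ =>
      (z - 1) * ∑ n ∈ Finset.range N, ((n + 1 : ℕ) : ℂ) ^ (-z) + (N : ℂ) ^ (1 - z) :=
    ((differentiable_id.sub_const 1).mul
      (Differentiable.fun_sum fun n _ => hpow _ (by omega))).add (hpow1 _ hN)
  have hf : AnalyticOnNhd ℂ riemannZeta₁ U :=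
    differentiable_riemannZeta₁.differentiableOn.analyticOnNhd hUo
  have hg : AnalyticOnNhd ℂ (fun z : ℂ =>
      (z - 1) * ∑ n ∈ Finset.range N, ((n + 1 : ℕ) : ℂ) ^ (-z) + (N : ℂ) ^ (1 - z) +
        ∑' m : ℕ, eulerTerm (N + m) z) U :=
    (hfin.differentiableOn.add hdiff).analyticOnNhd hUo
  refine hf.eqOn_of_preconnected_of_eventuallyEq hg hUc h2U ?_ hsU
  have : {z : ℂ | 1 < z.re} ∈ nhds (2 : ℂ) :=
    (isOpen_lt continuous_const Complex.continuous_re).mem_nhds (by norm_num)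
  filter_upwards [this] with z hz
  exact riemannZeta₁_eq_of_one_lt_re hz hN

lemma norm_sum_sub_mul_le {x g : ℕ → ℂ} {V : ℕ → ℝ} {A B : ℕ} (hAB : A ≤ B)
    (hx : ∀ n, ‖x n‖ ≤ 1) (hg : ∀ n, A ≤ n → ‖g n‖ ≤ V n)
    (hV : ∀ n, A ≤ n → ‖g (n + 1) - g n‖ ≤ V (n + 1) - V n) :
    ‖∑ n ∈ Finset.Ico A B, (x n - x (n + 1)) * g n‖ ≤ 2 * V B := by
  have hid : ∀ B, A ≤ B → ∑ n ∈ Finset.Ico A B, (x n - x (n + 1)) * g n =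
      x A * g A - x B * g B + ∑ n ∈ Finset.Ico A B, x (n + 1) * (g (n + 1) - g n) := by
    intro B hB
    induction B, hB using Nat.le_induction with
    | base => simp
    | succ B hB ih =>
      rw [Finset.sum_Ico_succ_top hB, ih, Finset.sum_Ico_succ_top hB]; ring
  have htel : ∑ n ∈ Finset.Ico A B, (V (n + 1) - V n) = V B - V A :=
    Finset.sum_Ico_sub V hAB
  have hb : ∀ n, A ≤ n → ‖x n * g n‖ ≤ V n := fun n hn => by
    rw [norm_mul]
    exact (mul_le_of_le_one_left (norm_nonneg _) (hx n)).trans (hg n hn)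
  have hs : ‖∑ n ∈ Finset.Ico A B, x (n + 1) * (g (n + 1) - g n)‖ ≤ V B - V A := by
    rw [← htel]
    refine norm_sum_le_of_le _ fun n hn => ?_
    rw [norm_mul]
    exact (mul_le_of_le_one_left (norm_nonneg _) (hx _)).trans (hV n (Finset.mem_Ico.mp hn).1)
  rw [hid B hAB]
  calc _ ≤ ‖x A * g A‖ + ‖x B * g B‖ + (V B - V A) :=
        (norm_add_le _ _).trans (add_le_add (norm_sub_le _ _) hs)
    _ ≤ 2 * V B := by linarith [hb A le_rfl, hb B hAB]

/-- The Kusmin–Landau bound for zeta sums longer than the height. -/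
lemma norm_zetaSum_le_of_height_le {t : ℝ} (ht : 0 < t) {N N' : ℕ} (hN : 1 ≤ N) (hNN : N ≤ N')
    (hN' : N' ≤ 2 * N) (htN : t ≤ N) :
    ‖∑ n ∈ Finset.Ioc N N', expChar (-(t / (2 * Real.pi)) * Real.log n)‖ ≤ 16 * Real.pi * N / t := by
  have hpi := Real.pi_pos
  have hpi3 := Real.pi_gt_three
  have hNpos : (0 : ℝ) < N := by exact_mod_cast hN
  set δ : ℕ → ℝ := fun n => t / (2 * Real.pi) * (Real.log (n + 1 : ℕ) - Real.log n) with hδ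
  have hlog : ∀ n : ℕ, 1 ≤ n →
      Real.log (n + 1 : ℕ) - Real.log n = Real.log (1 + 1 / n) := fun n hn => by
    have hn0 : (0 : ℝ) < n := by exact_mod_cast hn
    rw [← Real.log_div (by positivity) hn0.ne']
    congr 1; push_cast; field_simp
  have hδpos : ∀ n, 1 ≤ n → 0 < δ n := fun n hn => by
    have hn0 : (0 : ℝ) < n := by exact_mod_cast hn
    simp only [hδ]; rw [hlog n hn]
    exact mul_pos (by positivity) (Real.log_pos (by simp; positivity))
  have hδle : ∀ n, N ≤ n → δ n ≤ 1 / 2 := fun n hn => by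
    have hn0 : (0 : ℝ) < n := by exact_mod_cast (by omega : 0 < n)
    have hn1 : (N : ℝ) ≤ n := by exact_mod_cast hn
    simp only [hδ]; rw [hlog n (by omega)]
    have h1 : Real.log (1 + 1 / n) ≤ 1 / n := by
      have := Real.log_le_sub_one_of_pos (show (0 : ℝ) < 1 + 1 / n by positivity)
      linarith
    calc t / (2 * Real.pi) * Real.log (1 + 1 / n) ≤ n / (2 * Real.pi) * (1 / n) := by
          refine mul_le_mul ?_ h1 (Real.log_nonneg (by simp)) (by positivity)
          exact div_le_div_of_nonneg_right (htN.trans hn1) (by positivity)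
      _ = 1 / (2 * Real.pi) := by field_simp
      _ ≤ 1 / 2 := one_div_le_one_div_of_le (by norm_num) (by linarith)
  have hδanti : ∀ n, 1 ≤ n → δ (n + 1) ≤ δ n := fun n hn => by
    have hn0 : (0 : ℝ) < n := by exact_mod_cast hn
    simp only [hδ]
    rw [hlog n hn, hlog (n + 1) (by omega)]
    refine mul_le_mul_of_nonneg_left (Real.log_le_log (by positivity) ?_) (by positivity)
    have : 1 / ((n + 1 : ℕ) : ℝ) ≤ 1 / n := one_div_le_one_div_of_le hn0 (by push_cast; linarith)
    linarith
  have hge : ∀ n, N ≤ n → 4 * δ n ≤ ‖1 - expChar (-δ n)‖ := fun n hn => by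
    rw [norm_sub_rev]
    have h := four_mul_abs_le_norm_expChar_sub_one (β := -δ n) (by
      rw [abs_neg, abs_of_pos (hδpos n (by omega))]; exact hδle n hn)
    rwa [abs_neg, abs_of_pos (hδpos n (by omega))] at h
  have hne : ∀ n, N ≤ n → 1 - expChar (-δ n) ≠ 0 := fun n hn h => by
    have h1 := hge n hn
    rw [h, norm_zero] at h1
    linarith [hδpos n (by omega)]
  set x : ℕ → ℂ := fun n => expChar (-(t / (2 * Real.pi)) * Real.log n) with hx
  set g : ℕ → ℂ := fun n => (1 - expChar (-δ n))⁻¹ with hg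
  have hxs : ∀ n, x (n + 1) = x n * expChar (-δ n) := fun n => by
    simp only [hx, hδ]
    rw [← AddChar.map_add_eq_mul]
    congr 1; ring
  have hsum : ∑ n ∈ Finset.Ioc N N', x n = ∑ n ∈ Finset.Ico (N + 1) (N' + 1),
      (x n - x (n + 1)) * g n := by
    refine Finset.sum_congr (by ext n; simp) fun n hn => ?_
    have hn' : N ≤ n := (Nat.le_succ N).trans (Finset.mem_Ico.mp hn).1
    rw [hxs, show x n - x n * expChar (-δ n) = x n * (1 - expChar (-δ n)) by ring, mul_assoc,
      mul_inv_cancel₀ (hne n hn'), mul_one]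
  rw [hsum]
  have hmain := norm_sum_sub_mul_le (x := x) (g := g) (V := fun n => Real.pi / 8 / δ n)
    (A := N + 1) (B := N' + 1) (by omega) (fun n => (norm_expChar _).le) ?_ ?_
  · refine hmain.trans ?_
    have hlow : t / (8 * Real.pi * N) ≤ δ (N' + 1) := by
      simp only [hδ]
      rw [hlog (N' + 1) (by omega)]
      have h1 := Real.one_sub_inv_le_log_of_pos (x := 1 + 1 / ((N' + 1 : ℕ) : ℝ)) (by positivity)
      have hle : ((N' : ℝ) + 2) ≤ 4 * N := by
        have : N' + 2 ≤ 4 * N := by omega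
        exact_mod_cast this
      have h2 : 1 / (4 * (N : ℝ)) ≤ 1 - (1 + 1 / ((N' + 1 : ℕ) : ℝ))⁻¹ := by
        have : 1 - (1 + 1 / ((N' + 1 : ℕ) : ℝ))⁻¹ = 1 / ((N' : ℝ) + 2) := by
          push_cast; field_simp; ring
        rw [this]
        exact one_div_le_one_div_of_le (by positivity) hle
      calc t / (8 * Real.pi * N) = t / (2 * Real.pi) * (1 / (4 * N)) := by field_simp; ring
        _ ≤ _ := mul_le_mul_of_nonneg_left (h2.trans h1) (by positivity)
    calc 2 * (Real.pi / 8 / δ (N' + 1)) ≤ 2 * (Real.pi / 8 / (t / (8 * Real.pi * N))) := by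
          refine mul_le_mul_of_nonneg_left ?_ (by norm_num)
          exact div_le_div_of_nonneg_left (by positivity) (by positivity) hlow
      _ = 2 * Real.pi * Real.pi * N / t := by field_simp
      _ ≤ 16 * Real.pi * N / t := by
          refine div_le_div_of_nonneg_right ?_ ht.le
          have := Real.pi_lt_four
          have : 0 ≤ Real.pi * N := by positivity
          nlinarith
  · intro n hn
    have h0 := hδpos n (by omega)
    simp only [hg]
    rw [norm_inv]
    calc ‖1 - expChar (-δ n)‖⁻¹ ≤ (4 * δ n)⁻¹ := inv_anti₀ (by positivity) (hge n (by omega))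
      _ = 1 / 4 / δ n := by field_simp
      _ ≤ Real.pi / 8 / δ n := div_le_div_of_nonneg_right (by linarith) h0.le
  · intro n hn
    have h0 := hδpos n (by omega)
    have h1 := hδpos (n + 1) (by omega)
    have ha := hδanti n (by omega)
    have hn1 := hne n (by omega)
    have hn2 := hne (n + 1) (by omega)
    have e1 : g (n + 1) - g n = (expChar (-δ (n + 1)) - expChar (-δ n)) *
        ((1 - expChar (-δ (n + 1)))⁻¹ * (1 - expChar (-δ n))⁻¹) := by
      simp only [hg]; field_simp; ring
    have e2 : ‖expChar (-δ (n + 1)) - expChar (-δ n)‖ ≤ 2 * Real.pi * (δ n - δ (n + 1)) := by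
      have : expChar (-δ (n + 1)) - expChar (-δ n) =
          expChar (-δ n) * (expChar (δ n - δ (n + 1)) - 1) := by
        rw [mul_sub, mul_one, ← AddChar.map_add_eq_mul]
        congr 2; ring
      rw [this, norm_mul, norm_expChar, one_mul]
      refine (norm_expChar_sub_one_le _).trans_eq ?_
      rw [abs_of_nonneg (by linarith)]
    rw [e1, norm_mul, norm_mul, norm_inv, norm_inv]
    calc _ ≤ 2 * Real.pi * (δ n - δ (n + 1)) * ((4 * δ (n + 1))⁻¹ * (4 * δ n)⁻¹) := by
          refine mul_le_mul e2 ?_ (by positivity) (mul_nonneg (by positivity) (by linarith))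
          exact mul_le_mul (inv_anti₀ (by positivity) (hge _ (by omega)))
            (inv_anti₀ (by positivity) (hge _ (by omega))) (by positivity) (by positivity)
      _ = Real.pi / 8 / δ (n + 1) - Real.pi / 8 / δ n := by field_simp; ring

lemma norm_sum_antitone_mul_le {w : ℕ → ℝ} {z : ℕ → ℂ} {N N' : ℕ} {K : ℝ} (hNN : N ≤ N')
    (hw0 : ∀ n, N ≤ n → 0 ≤ w n) (hw : ∀ n, N ≤ n → w (n + 1) ≤ w n)
    (hz : ∀ M, N ≤ M → M ≤ N' → ‖∑ n ∈ Finset.Ioc N M, z n‖ ≤ K) :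
    ‖∑ n ∈ Finset.Ioc N N', (w n : ℂ) * z n‖ ≤ w N * K := by
  set S : ℕ → ℂ := fun M => ∑ n ∈ Finset.Ioc N M, z n with hS
  have hid : ∀ M, N ≤ M → ∑ n ∈ Finset.Ioc N M, (w n : ℂ) * z n =
      w M * S M + ∑ n ∈ Finset.Ico N M, ((w n - w (n + 1) : ℝ) : ℂ) * S n := by
    intro M hM
    induction M, hM using Nat.le_induction with
    | base => simp [hS]
    | succ M hM ih =>
      rw [Finset.sum_Ioc_succ_top (by omega), ih, Finset.sum_Ico_succ_top hM]
      simp only [hS]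
      rw [Finset.sum_Ioc_succ_top (by omega)]
      push_cast; ring
  rw [hid N' hNN]
  have htel : ∑ n ∈ Finset.Ico N N', (w n - w (n + 1)) = w N - w N' := by
    have := Finset.sum_Ico_sub w hNN
    rw [← neg_inj, ← Finset.sum_neg_distrib]
    simpa using this
  have h1 : ‖∑ n ∈ Finset.Ico N N', ((w n - w (n + 1) : ℝ) : ℂ) * S n‖ ≤ (w N - w N') * K := by
    rw [← htel, Finset.sum_mul]
    refine norm_sum_le_of_le _ fun n hn => ?_
    obtain ⟨hn1, hn2⟩ := Finset.mem_Ico.mp hn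
    rw [norm_mul, Complex.norm_real, Real.norm_of_nonneg (by linarith [hw n hn1])]
    exact mul_le_mul_of_nonneg_left (hz n hn1 hn2.le) (by linarith [hw n hn1])
  have h2 : ‖(w N' : ℂ) * S N'‖ ≤ w N' * K := by
    rw [norm_mul, Complex.norm_real, Real.norm_of_nonneg (hw0 _ hNN)]
    exact mul_le_mul_of_nonneg_left (hz _ hNN le_rfl) (hw0 _ hNN)
  calc _ ≤ w N' * K + (w N - w N') * K := (norm_add_le _ _).trans (add_le_add h2 h1)
    _ = w N * K := by ring

lemma natCast_cpow_neg_eq {n : ℕ} (hn : 1 ≤ n) (s : ℂ) :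
    (n : ℂ) ^ (-s) = ((n : ℝ) ^ (-s.re) : ℝ) * expChar (-(s.im / (2 * Real.pi)) * Real.log n) := by
  have hn0 : (0 : ℝ) < n := by exact_mod_cast hn
  rw [expChar_apply, Complex.cpow_def_of_ne_zero (by exact_mod_cast hn0.ne'),
    Real.rpow_def_of_pos hn0, Complex.ofReal_exp, ← Complex.exp_add]
  congr 1
  rw [← Complex.natCast_log]
  conv_lhs => rw [← Complex.re_add_im s]
  have : (Real.pi : ℂ) ≠ 0 := by exact_mod_cast Real.pi_ne_zero
  push_cast
  field_simp
  ring

lemma norm_sum_cpow_le {s : ℂ} (hs : 0 ≤ s.re) {N N' : ℕ} (hN : 1 ≤ N) (hNN : N ≤ N') {K : ℝ}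
    (hK : ∀ M, N ≤ M → M ≤ N' →
      ‖∑ n ∈ Finset.Ioc N M, expChar (-(s.im / (2 * Real.pi)) * Real.log n)‖ ≤ K) :
    ‖∑ n ∈ Finset.Ioc N N', (n : ℂ) ^ (-s)‖ ≤ (N : ℝ) ^ (-s.re) * K := by
  have h := norm_sum_antitone_mul_le (w := fun n : ℕ => (n : ℝ) ^ (-s.re))
    (z := fun n : ℕ => expChar (-(s.im / (2 * Real.pi)) * Real.log n)) hNN
    (fun n _ => by positivity) (fun n hn => by
      have hn0 : (0 : ℝ) < n := by exact_mod_cast hN.trans hn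
      exact Real.rpow_le_rpow_of_nonpos hn0 (by push_cast; linarith) (by linarith)) hK
  rwa [Finset.sum_congr rfl fun n hn => natCast_cpow_neg_eq
    (by have := (Finset.mem_Ioc.mp hn).1; omega) s]

lemma mul_sub_cube_le {X l lam : ℝ} (hX : 0 ≤ X) (hl : 0 < l) (hlam : 0 < lam) :
    lam ^ 2 * X - X ^ 3 / (10 ^ 7 * l ^ 2) ≤ 4000 * (lam ^ 3 * l) := by
  rcases le_or_gt X (4000 * (lam * l)) with h | h
  · have h1 : 0 ≤ X ^ 3 / (10 ^ 7 * l ^ 2) := by positivity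
    have h2 := mul_le_mul_of_nonneg_left h (sq_nonneg lam)
    calc _ ≤ lam ^ 2 * (4000 * (lam * l)) := by linarith
      _ = _ := by ring
  · have h1 : lam ^ 2 * X ≤ X ^ 3 / (10 ^ 7 * l ^ 2) := by
      rw [le_div_iff₀ (by positivity)]
      have h2 : (4000 * (lam * l)) ^ 2 ≤ X ^ 2 := pow_le_pow_left₀ (by positivity) h.le 2
      have h3 : 10 ^ 7 * (lam * l) ^ 2 ≤ X ^ 2 := by nlinarith [sq_nonneg (lam * l)]
      calc lam ^ 2 * X * (10 ^ 7 * l ^ 2) = X * (10 ^ 7 * (lam * l) ^ 2) := by ring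
        _ ≤ X * X ^ 2 := mul_le_mul_of_nonneg_left h3 hX
        _ = X ^ 3 := by ring
    have : 0 ≤ 4000 * (lam ^ 3 * l) := by positivity
    linarith

lemma exp_two_le : Real.exp 2 ≤ 8 := by
  have h := Real.exp_one_lt_d9
  have : Real.exp 2 = Real.exp 1 ^ 2 := by rw [← Real.exp_nat_mul]; norm_num
  rw [this]
  nlinarith [Real.exp_pos 1]

lemma norm_block_le {s : ℂ} {l lam : ℝ} (hl : 10 ≤ l) (hlam : 0 < lam)
    (hlam3 : lam ^ 3 * l = Real.log l) (hlam2 : lam ^ 2 ≤ 1 / 2) (hs : 1 - lam ^ 2 ≤ s.re)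
    (him1 : 2 ≤ s.im) (him2 : s.im ≤ Real.exp l) {N N' : ℕ} (hN : 1 ≤ N) (hNN : N ≤ N')
    (hN' : N' ≤ 2 * N) (hNt : (N : ℝ) ≤ 2 * s.im ^ 2) :
    ‖∑ n ∈ Finset.Ioc N N', (n : ℂ) ^ (-s)‖ ≤ 100 * l ^ 4000 := by
  set t := s.im with ht
  have hl0 : 0 < l := by linarith
  have hN0 : (0 : ℝ) < N := by exact_mod_cast hN
  have hN1 : (1 : ℝ) ≤ N := by exact_mod_cast hN
  have hpowN : (N : ℝ) ^ (-s.re) * N ≤ (N : ℝ) ^ (lam ^ 2) := by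
    rw [← Real.rpow_add_one hN0.ne']
    exact Real.rpow_le_rpow_of_exponent_le hN1 (by linarith)
  have hl1 : 1 ≤ l ^ 4000 := one_le_pow₀ (by linarith)
  rcases le_or_gt (N : ℝ) t with h | h
  · have hb := norm_sum_cpow_le (s := s) (by linarith) hN hNN
      (K := 12 * N * Real.exp (-(Real.log N ^ 3 / (10 ^ 7 * l ^ 2)))) fun M hM1 hM2 => by
        refine (norm_zetaSum_le hN hM1 (hM2.trans hN') h).trans ?_
        have h1 : Real.log N ^ 3 / (10 ^ 7 * l ^ 2) ≤ Real.log N ^ 3 / (10 ^ 7 * Real.log t ^ 2) := by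
          have hlt0 : 0 < Real.log t := Real.log_pos (by linarith)
          have hlt : Real.log t ≤ l := by
            rw [← Real.log_exp l]; exact Real.log_le_log (by linarith) him2
          have : Real.log t ^ 2 ≤ l ^ 2 := pow_le_pow_left₀ hlt0.le hlt 2
          refine div_le_div_of_nonneg_left ?_ (by positivity) (by linarith)
          exact pow_nonneg (Real.log_natCast_nonneg N) 3
        refine mul_le_mul ?_ (Real.exp_le_exp.mpr (neg_le_neg h1)) (Real.exp_pos _).le
          (by positivity)
        exact mul_le_mul_of_nonneg_right (by linarith [exp_two_le]) hN0.le
    refine hb.trans ?_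
    calc (N : ℝ) ^ (-s.re) * (12 * N * Real.exp (-(Real.log N ^ 3 / (10 ^ 7 * l ^ 2))))
        = 12 * ((N : ℝ) ^ (-s.re) * N) * Real.exp (-(Real.log N ^ 3 / (10 ^ 7 * l ^ 2))) := by
          ring
      _ ≤ 12 * (N : ℝ) ^ (lam ^ 2) * Real.exp (-(Real.log N ^ 3 / (10 ^ 7 * l ^ 2))) := by
          refine mul_le_mul_of_nonneg_right ?_ (Real.exp_pos _).le
          linarith
      _ = 12 * Real.exp (lam ^ 2 * Real.log N - Real.log N ^ 3 / (10 ^ 7 * l ^ 2)) := by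
          rw [Real.rpow_def_of_pos hN0, mul_assoc, ← Real.exp_add]
          congr 2; ring
      _ ≤ 12 * Real.exp (4000 * (lam ^ 3 * l)) := by
          refine mul_le_mul_of_nonneg_left (Real.exp_le_exp.mpr ?_) (by norm_num)
          exact mul_sub_cube_le (Real.log_natCast_nonneg N) hl0 hlam
      _ = 12 * l ^ 4000 := by
          rw [hlam3, show (4000 : ℝ) = ((4000 : ℕ) : ℝ) by norm_num, Real.exp_nat_mul,
            Real.exp_log hl0]
      _ ≤ 100 * l ^ 4000 := by linarith
  · have hb := norm_sum_cpow_le (s := s) (by linarith) hN hNN (K := 16 * Real.pi * N / t)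
      fun M hM1 hM2 => norm_zetaSum_le_of_height_le (by linarith) hN hM1 (hM2.trans hN') h.le
    refine hb.trans ?_
    have hroot : (N : ℝ) ^ (lam ^ 2) ≤ 3 / 2 * t := by
      calc (N : ℝ) ^ (lam ^ 2) ≤ (N : ℝ) ^ (1 / 2 : ℝ) :=
            Real.rpow_le_rpow_of_exponent_le hN1 hlam2
        _ = √N := (Real.sqrt_eq_rpow _).symm
        _ ≤ 3 / 2 * t := by
            rw [Real.sqrt_le_left (by linarith)]
            nlinarith
    have hpi := Real.pi_lt_four
    have hpi0 := Real.pi_pos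
    calc (N : ℝ) ^ (-s.re) * (16 * Real.pi * N / t) =
          16 * Real.pi / t * ((N : ℝ) ^ (-s.re) * N) := by ring
      _ ≤ 16 * Real.pi / t * (3 / 2 * t) :=
          mul_le_mul_of_nonneg_left (hpowN.trans hroot) (div_nonneg (by positivity) (by linarith))
      _ = 24 * Real.pi := by
          have : t ≠ 0 := by linarith
          field_simp; norm_num
      _ ≤ 100 * l ^ 4000 := by linarith

lemma sum_range_two_pow (f : ℕ → ℂ) (k : ℕ) :
    ∑ n ∈ Finset.range (2 ^ k), f (n + 1) =
      f 1 + ∑ i ∈ Finset.range k, ∑ n ∈ Finset.Ioc (2 ^ i) (2 ^ (i + 1)), f n := by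
  induction k with
  | zero => simp
  | succ k ih =>
    rw [Finset.sum_range_succ, ← add_assoc, ← ih, ← Finset.sum_range_add_sum_Ico _
      (Nat.pow_le_pow_right (by norm_num) (Nat.le_succ k) : 2 ^ k ≤ 2 ^ (k + 1))]
    congr 1
    rw [Finset.sum_Ico_add' f]
    exact Finset.sum_congr (by ext n; simp) fun _ _ => rfl

lemma tsum_rpow_shift_le {N : ℕ} (hN : 1 ≤ N) :
    ∑' m : ℕ, ((N + m : ℕ) : ℝ) ^ (-(3 / 2) : ℝ) ≤ 6 * (N : ℝ) ^ (-(1 / 2) : ℝ) := by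
  have hstep : ∀ n : ℕ, 1 ≤ n → (n : ℝ) ^ (-(3 / 2) : ℝ) ≤
      6 * ((n : ℝ) ^ (-(1 / 2) : ℝ) - ((n + 1 : ℕ) : ℝ) ^ (-(1 / 2) : ℝ)) := by
    intro n hn
    have hn0 : (0 : ℝ) < n := by exact_mod_cast hn
    have hn1 : (1 : ℝ) ≤ n := by exact_mod_cast hn
    set a := √(n : ℝ) with ha
    set b := √((n + 1 : ℕ) : ℝ) with hb
    have ha0 : 0 < a := Real.sqrt_pos.mpr hn0
    have hb0 : 0 < b := Real.sqrt_pos.mpr (by positivity)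
    have ha2 : a ^ 2 = n := Real.sq_sqrt hn0.le
    have hb2 : b ^ 2 = n + 1 := by rw [hb, Real.sq_sqrt (by positivity)]; push_cast; rfl
    have e1 : (n : ℝ) ^ (-(1 / 2) : ℝ) = 1 / a := by
      rw [Real.rpow_neg hn0.le, ← Real.sqrt_eq_rpow, one_div]
    have e2 : ((n + 1 : ℕ) : ℝ) ^ (-(1 / 2) : ℝ) = 1 / b := by
      rw [Real.rpow_neg (by positivity), ← Real.sqrt_eq_rpow, one_div]
    have e3 : (n : ℝ) ^ (-(3 / 2) : ℝ) = 1 / a ^ 3 := by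
      rw [show (-(3 / 2) : ℝ) = -(1 / 2) - 1 by norm_num, Real.rpow_sub_one hn0.ne', e1, ← ha2]
      field_simp
    rw [e1, e2, e3]
    have hba : b ≤ 3 / 2 * a := by
      rw [hb, Real.sqrt_le_left (by positivity)]
      push_cast; nlinarith
    have hab : a < b := by nlinarith
    rw [div_sub_div _ _ ha0.ne' hb0.ne', mul_div_assoc', div_le_div_iff₀ (by positivity)
      (by positivity)]
    have h1 : (b - a) * (b + a) = 1 := by nlinarith
    have h2 : 1 / (5 / 2 * a) ≤ b - a := by
      rw [div_le_iff₀ (by positivity)]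
      nlinarith
    have h3 : 1 ≤ (b - a) * (5 / 2 * a) := by rwa [div_le_iff₀ (by positivity)] at h2
    calc 1 * (a * b) ≤ a * (3 / 2 * a) := by nlinarith
      _ ≤ (3 / 2 * a ^ 2) * ((b - a) * (5 / 2 * a)) := by nlinarith [sq_nonneg a]
      _ ≤ 6 * (1 * b - a * 1) * a ^ 3 := by
          have : 0 ≤ (b - a) * a ^ 3 := mul_nonneg (by linarith) (by positivity)
          nlinarith
  have hpart : ∀ M : ℕ, ∑ m ∈ Finset.range M, ((N + m : ℕ) : ℝ) ^ (-(3 / 2) : ℝ) ≤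
      6 * (N : ℝ) ^ (-(1 / 2) : ℝ) := by
    intro M
    have : ∑ m ∈ Finset.range M, ((N + m : ℕ) : ℝ) ^ (-(3 / 2) : ℝ) ≤
        6 * ((N : ℝ) ^ (-(1 / 2) : ℝ) - ((N + M : ℕ) : ℝ) ^ (-(1 / 2) : ℝ)) := by
      induction M with
      | zero => simp
      | succ M ih =>
        rw [Finset.sum_range_succ]
        have := hstep (N + M) (by omega)
        rw [← add_assoc N M 1]
        linarith
    have h0 : 0 ≤ ((N + M : ℕ) : ℝ) ^ (-(1 / 2) : ℝ) := by positivity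
    linarith
  exact (summable_rpow_shift N).tsum_le_of_sum_range_le hpart

/-- The Vinogradov–Korobov upper bound for `ζ` near the line `Re s = 1`. -/
theorem norm_riemannZeta_le {s : ℂ} {l lam : ℝ} (hl : 10 ≤ l) (hlam : 0 < lam)
    (hlam3 : lam ^ 3 * l = Real.log l) (hlam2 : lam ^ 2 < 1 / 2) (hs : 1 - lam ^ 2 ≤ s.re)
    (hs3 : s.re ≤ 3) (him1 : 2 ≤ s.im) (him2 : s.im ≤ Real.exp l) :
    ‖riemannZeta s‖ ≤ l ^ 4010 := by
  have hl0 : 0 < l := by linarith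
  obtain ⟨k, hk1, hk2⟩ := exists_nat_pow_near (x := s.im ^ 2) (y := 2) (by nlinarith) (by norm_num)
  set t := s.im with ht
  have ht0 : 0 < t := by linarith
  set N := 2 ^ (k + 1) with hN
  have hN1 : 1 ≤ N := Nat.one_le_two_pow
  have hNR : (N : ℝ) = 2 ^ (k + 1) := by rw [hN]; push_cast; rfl
  have hNlow : t ^ 2 ≤ N := by rw [hNR]; exact hk2.le
  have hNhigh : (N : ℝ) ≤ 2 * t ^ 2 := by rw [hNR, pow_succ]; linarith
  have hN0 : (0 : ℝ) < N := by exact_mod_cast hN1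
  have hs1 : s ≠ 1 := by
    rintro rfl
    simp at ht
    linarith
  have hsub : t ≤ ‖s - 1‖ := by
    have := Complex.abs_im_le_norm (s - 1)
    simp only [Complex.sub_im, Complex.one_im, sub_zero] at this
    exact (le_abs_self _).trans this
  have hnorm : ‖s‖ ≤ 3 + t := by
    refine (Complex.norm_le_abs_re_add_abs_im s).trans ?_
    rw [abs_of_nonneg (by linarith), abs_of_pos ht0]
    linarith
  have hkl : (k + 1 : ℝ) ≤ 4 * l := by
    have h1 : (2 : ℝ) ^ k ≤ Real.exp l ^ 2 := hk1.trans (pow_le_pow_left₀ ht0.le him2 2)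
    have h2 := Real.log_le_log (by positivity) h1
    rw [Real.log_pow, Real.log_pow, Real.log_exp] at h2
    have := Real.log_two_gt_d9
    push_cast at h2
    nlinarith
  have hfin : ‖∑ n ∈ Finset.range N, ((n + 1 : ℕ) : ℂ) ^ (-s)‖ ≤ 1 + 4 * l * (100 * l ^ 4000) := by
    rw [hN, sum_range_two_pow (fun n => (n : ℂ) ^ (-s))]
    refine (norm_add_le _ _).trans (add_le_add (by simp) ?_)
    have : ‖∑ i ∈ Finset.range (k + 1),
        ∑ n ∈ Finset.Ioc ((2 : ℕ) ^ i) (2 ^ (i + 1)), ((n : ℕ) : ℂ) ^ (-s)‖ ≤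
        ∑ i ∈ Finset.range (k + 1), 100 * l ^ 4000 := by
      refine norm_sum_le_of_le _ fun i hi => ?_
      refine norm_block_le hl hlam hlam3 hlam2.le hs him1 him2 Nat.one_le_two_pow
        (Nat.pow_le_pow_right (by norm_num) (Nat.le_succ i)) (by rw [pow_succ]; omega) ?_
      have : (2 : ℝ) ^ i ≤ 2 ^ k :=
        pow_le_pow_right₀ (by norm_num) (by have := Finset.mem_range.mp hi; omega)
      push_cast
      nlinarith
    refine this.trans ?_
    rw [Finset.sum_const, Finset.card_range, nsmul_eq_mul]
    push_cast
    exact mul_le_mul_of_nonneg_right hkl (by positivity)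
  have hsqrtN : t ≤ √N := Real.le_sqrt_of_sq_le hNlow
  have hpow : ‖(N : ℂ) ^ (1 - s)‖ ≤ 3 / 2 * t := by
    rw [Complex.norm_natCast_cpow_of_pos (by omega)]
    calc (N : ℝ) ^ (1 - s).re ≤ (N : ℝ) ^ (1 / 2 : ℝ) :=
          Real.rpow_le_rpow_of_exponent_le (by exact_mod_cast hN1) (by simp; linarith)
      _ = √N := (Real.sqrt_eq_rpow _).symm
      _ ≤ 3 / 2 * t := by
          rw [Real.sqrt_le_left (by linarith)]
          nlinarith
  have htail : ‖∑' m : ℕ, eulerTerm (N + m) s‖ ≤ ‖s - 1‖ * 15 := by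
    have h1 : ‖∑' m : ℕ, eulerTerm (N + m) s‖ ≤
        ∑' m : ℕ, ‖s - 1‖ * ‖s‖ * ((N + m : ℕ) : ℝ) ^ (-(3 / 2) : ℝ) :=
      tsum_of_norm_bounded ((summable_rpow_shift N).mul_left _).hasSum fun m =>
        norm_eulerTerm_le (by omega) (by linarith)
    refine h1.trans ?_
    rw [tsum_mul_left, mul_assoc]
    refine mul_le_mul_of_nonneg_left ?_ (norm_nonneg _)
    have h2 : (N : ℝ) ^ (-(1 / 2) : ℝ) ≤ 1 / t := by
      rw [Real.rpow_neg hN0.le, ← Real.sqrt_eq_rpow, ← one_div]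
      exact one_div_le_one_div_of_le ht0 hsqrtN
    calc ‖s‖ * ∑' m : ℕ, ((N + m : ℕ) : ℝ) ^ (-(3 / 2) : ℝ) ≤ (3 + t) * (6 * (1 / t)) := by
          refine mul_le_mul hnorm ((tsum_rpow_shift_le hN1).trans ?_)
            (tsum_nonneg fun m => by positivity) (by linarith)
          linarith
      _ ≤ 15 := by
          rw [← mul_assoc, mul_one_div, div_le_iff₀ ht0]; linarith
  have hz : riemannZeta s = (s - 1)⁻¹ * riemannZeta₁ s := riemannZeta_eq_inv_sub_mul hs1
  have hS0 : 0 < ‖s - 1‖ := ht0.trans_le hsub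
  rw [hz, norm_mul, norm_inv, inv_mul_le_iff₀ hS0, riemannZeta₁_eq_of_half_lt_re (by linarith) hN1]
  have hl4 : 1 ≤ l ^ 4000 := one_le_pow₀ (by linarith)
  have hl10 : 500 * l ≤ l ^ 10 := by
    have h9 : (10 : ℝ) ^ 9 ≤ l ^ 9 := pow_le_pow_left₀ (by norm_num) hl 9
    have : l ^ 10 = l ^ 9 * l := by ring
    rw [this]
    exact mul_le_mul_of_nonneg_right (by linarith) hl0.le
  calc _ ≤ ‖s - 1‖ * (1 + 4 * l * (100 * l ^ 4000)) + 3 / 2 * t + ‖s - 1‖ * 15 := by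
        refine (norm_add_le _ _).trans (add_le_add ((norm_add_le _ _).trans
          (add_le_add ?_ hpow)) htail)
        rw [norm_mul]
        exact mul_le_mul_of_nonneg_left hfin (norm_nonneg _)
    _ ≤ ‖s - 1‖ * (500 * l * l ^ 4000) := by
        have h1 : 10 ≤ l * l ^ 4000 := by nlinarith
        have h2 : ‖s - 1‖ * (17.5 + 400 * (l * l ^ 4000)) ≤ ‖s - 1‖ * (500 * (l * l ^ 4000)) :=
          mul_le_mul_of_nonneg_left (by linarith) hS0.le
        linarith
    _ ≤ ‖s - 1‖ * (l ^ 10 * l ^ 4000) := by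
        refine mul_le_mul_of_nonneg_left ?_ hS0.le
        exact mul_le_mul_of_nonneg_right hl10 (by positivity)
    _ = ‖s - 1‖ * l ^ 4010 := by rw [← pow_add]

open Metric in
lemma exists_eq_mul_exp {f : ℂ → ℂ} {r : ℝ} (hr : 0 < r) (hf : DifferentiableOn ℂ f (ball 0 r))
    (h0 : ∀ z ∈ ball (0 : ℂ) r, f z ≠ 0) :
    ∃ h : ℂ → ℂ, DifferentiableOn ℂ h (ball 0 r) ∧ h 0 = 0 ∧
      ∀ z ∈ ball (0 : ℂ) r, f z = f 0 * Complex.exp (h z) := by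
  have hd : DifferentiableOn ℂ (fun z => deriv f z / f z) (ball 0 r) :=
    (hf.deriv isOpen_ball).div hf h0
  obtain ⟨h, hh0, hh⟩ := hd.isExactOn_ball.with_val_at 0 0
  have hhd : DifferentiableOn ℂ h (ball 0 r) := fun z hz =>
    (hh z hz).differentiableAt.differentiableWithinAt
  refine ⟨h, hhd, hh0, fun z hz => ?_⟩
  have hconst : ∀ w ∈ ball (0 : ℂ) r, f w * Complex.exp (-h w) = f 0 * Complex.exp (-h 0) := by
    intro w hw
    refine isOpen_ball.is_const_of_deriv_eq_zero (convex_ball _ _).isPreconnected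
      (hf.mul hhd.neg.cexp) (fun v hv => ?_) hw (mem_ball_self hr)
    have h1 : HasDerivAt f (deriv f v) v := (hf.differentiableAt (isOpen_ball.mem_nhds hv)).hasDerivAt
    have h2 := h1.mul (hh v hv).fun_neg.cexp
    refine h2.deriv.trans ?_
    have := h0 v hv
    simp only [Pi.zero_apply]
    field_simp
    ring
  have := hconst z hz
  rw [hh0, neg_zero, Complex.exp_zero, mul_one] at this
  rw [← this, mul_assoc, ← Complex.exp_add, neg_add_cancel, Complex.exp_zero, mul_one]

open Metric in
/-- Borel–Carathéodory for the logarithm of a zero-free function. -/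
lemma exists_eq_mul_exp_of_norm_le {f : ℂ → ℂ} {r B : ℝ} (hr : 0 < r) (hB : 1 < B)
    (hf : DifferentiableOn ℂ f (ball 0 r)) (h0 : ∀ z ∈ ball (0 : ℂ) r, f z ≠ 0)
    (hfB : ∀ z ∈ ball (0 : ℂ) r, ‖f z‖ ≤ B * ‖f 0‖) :
    ∃ h : ℂ → ℂ, DifferentiableOn ℂ h (ball 0 r) ∧ h 0 = 0 ∧
      (∀ z ∈ ball (0 : ℂ) r, f z = f 0 * Complex.exp (h z)) ∧
      ∀ z ∈ ball (0 : ℂ) r, ‖h z‖ ≤ 2 * Real.log B * ‖z‖ / (r - ‖z‖) := by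
  obtain ⟨h, hd, hh0, hh⟩ := exists_eq_mul_exp hr hf h0
  refine ⟨h, hd, hh0, hh, fun z hz =>
    Complex.borelCaratheodory_zero (Real.log_pos hB) hd (fun w hw => ?_) hr hz hh0⟩
  have h1 := hfB w hw
  rw [hh w hw, norm_mul, mul_comm, Complex.norm_exp] at h1
  have h2 := le_of_mul_le_mul_right h1 (norm_pos_iff.mpr (h0 0 (mem_ball_self hr)))
  exact (Real.le_log_iff_exp_le (by linarith)).mpr h2

open Metric in
lemma norm_logDeriv_le_of_ne_zero {f : ℂ → ℂ} {r B : ℝ} (hr : 0 < r) (hB : 1 < B)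
    (hf : DifferentiableOn ℂ f (ball 0 r)) (h0 : ∀ z ∈ ball (0 : ℂ) r, f z ≠ 0)
    (hfB : ∀ z ∈ ball (0 : ℂ) r, ‖f z‖ ≤ B * ‖f 0‖) :
    ‖deriv f 0 / f 0‖ ≤ 4 * Real.log B / r := by
  obtain ⟨h, hd, hh0, hh, hhB⟩ := exists_eq_mul_exp_of_norm_le hr hB hf h0 hfB
  have hf0 := h0 0 (mem_ball_self hr)
  have hderiv : deriv f 0 / f 0 = deriv h 0 := by
    have h1 : HasDerivAt h (deriv h 0) 0 :=
      (hd.differentiableAt (isOpen_ball.mem_nhds (mem_ball_self hr))).hasDerivAt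
    have h2 : HasDerivAt f (f 0 * (Complex.exp (h 0) * deriv h 0)) 0 := by
      refine (h1.cexp.const_mul (f 0)).congr_of_eventuallyEq ?_
      filter_upwards [isOpen_ball.mem_nhds (mem_ball_self hr)] with z hz using hh z hz
    rw [h2.deriv, hh0, Complex.exp_zero, one_mul, mul_div_cancel_left₀ _ hf0]
  rw [hderiv]
  have hsub : closedBall (0 : ℂ) (r / 2) ⊆ ball 0 r := closedBall_subset_ball (by linarith)
  have := Complex.norm_deriv_le_of_forall_mem_sphere_norm_le (f := h) (c := 0) (R := r / 2)
    (C := 2 * Real.log B) (by linarith)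
    ((hd.mono (by rw [closure_ball _ (by linarith)]; exact hsub)).diffContOnCl) fun z hz => ?_
  · calc _ ≤ _ := this
      _ = _ := by field_simp; ring
  · have hz' : ‖z‖ = r / 2 := by simpa using hz
    have := hhB z (hsub (sphere_subset_closedBall hz))
    rw [hz'] at this
    calc _ ≤ _ := this
      _ = _ := by field_simp; ring

open Metric in
/-- Division by a zero: the quotient inherits a bound improved by the factor `‖a‖ / (R - ‖a‖)`. -/
lemma exists_eq_sub_mul {f : ℂ → ℂ} {R B : ℝ} {a : ℂ} (hB : 0 ≤ B) (ha : ‖a‖ < R / 4)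
    (ha0 : a ≠ 0) (hf : DifferentiableOn ℂ f (ball 0 R)) (hfa : f a = 0) (hf0 : f 0 ≠ 0)
    (hfB : ∀ z ∈ ball (0 : ℂ) R, ‖f z‖ ≤ B * ‖f 0‖) :
    ∃ g : ℂ → ℂ, DifferentiableOn ℂ g (ball 0 R) ∧ (∀ z, f z = (z - a) * g z) ∧ g 0 ≠ 0 ∧
      (∀ z ∈ ball (0 : ℂ) R, ‖g z‖ ≤ B / 3 * ‖g 0‖) ∧
      deriv f 0 / f 0 = -1 / a + deriv g 0 / g 0 := by
  have hR : 0 < R := by linarith [norm_nonneg a]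
  have haR : a ∈ ball (0 : ℂ) R := by rw [mem_ball_zero_iff]; linarith
  set g := dslope f a with hg
  have hgd : DifferentiableOn ℂ g (ball 0 R) :=
    (Complex.differentiableOn_dslope (isOpen_ball.mem_nhds haR)).mpr hf
  have hfg : ∀ z, f z = (z - a) * g z := by
    intro z
    have := sub_smul_dslope f a z
    rw [hfa, sub_zero, smul_eq_mul] at this
    exact this.symm
  have hg0 : g 0 ≠ 0 := by
    intro h
    exact hf0 (by rw [hfg, h, mul_zero])
  have hapos : 0 < ‖a‖ := norm_pos_iff.mpr ha0
  have hf0g : ‖f 0‖ = ‖a‖ * ‖g 0‖ := by rw [hfg, norm_mul]; simp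
  refine ⟨g, hgd, hfg, hg0, fun z hz => ?_, ?_⟩
  · have key : ∀ ρ : ℝ, ‖z‖ < ρ → R / 4 < ρ → ρ < R →
        ‖g z‖ * (ρ - R / 4) ≤ B * (R / 4 * ‖g 0‖) := by
      intro ρ hzρ h4 hρR
      have hsub : closedBall (0 : ℂ) ρ ⊆ ball 0 R := closedBall_subset_ball hρR
      rw [← le_div_iff₀ (by linarith)]
      refine Complex.norm_le_of_forall_mem_frontier_norm_le (U := ball (0 : ℂ) ρ) isBounded_ball
        ((hgd.mono (by rw [closure_ball _ (by linarith)]; exact hsub)).diffContOnCl)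
        (fun w hw => ?_) (subset_closure (by simpa using hzρ))
      rw [frontier_ball _ (by linarith)] at hw
      have hwn : ‖w‖ = ρ := by simpa using hw
      have h1 := hfB w (hsub (sphere_subset_closedBall hw))
      rw [hfg, norm_mul, hf0g] at h1
      have h2 : ρ - R / 4 ≤ ‖w - a‖ := by
        have := norm_sub_norm_le w a
        rw [hwn] at this; linarith
      rw [le_div_iff₀ (by linarith)]
      calc ‖g w‖ * (ρ - R / 4) ≤ ‖g w‖ * ‖w - a‖ := mul_le_mul_of_nonneg_left h2 (norm_nonneg _)
        _ ≤ B * (‖a‖ * ‖g 0‖) := by linarith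
        _ ≤ _ := by gcongr
    have hlim : ‖g z‖ * (R - R / 4) ≤ B * (R / 4 * ‖g 0‖) := by
      have hz' : ‖z‖ < R := by simpa using hz
      refine le_of_tendsto (x := nhdsWithin R (Set.Iio R))
        (f := fun ρ : ℝ => ‖g z‖ * (ρ - R / 4)) ?_ ?_
      · exact ((continuous_const.mul (continuous_id.sub continuous_const)).tendsto R).mono_left
          nhdsWithin_le_nhds
      · filter_upwards [Ioo_mem_nhdsLT (max_lt hz' (by linarith : R / 4 < R))] with ρ hρ
        exact key ρ ((le_max_left _ _).trans_lt hρ.1) ((le_max_right _ _).trans_lt hρ.1) hρ.2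
    have : R * ‖g z‖ ≤ R * (B / 3 * ‖g 0‖) := by linarith
    exact le_of_mul_le_mul_left this hR
  · have h1 : HasDerivAt g (deriv g 0) 0 :=
      (hgd.differentiableAt (isOpen_ball.mem_nhds (mem_ball_self hR))).hasDerivAt
    have h2 : HasDerivAt f (1 * g 0 + (0 - a) * deriv g 0) 0 := by
      rw [show f = fun z => (z - a) * g z from funext hfg]
      exact ((hasDerivAt_id (0 : ℂ)).sub_const a).mul h1
    rw [h2.deriv, hfg 0]
    field_simp
    ring

open Metric in
/-- Landau's one-sided bound for the logarithmic derivative of a function whose zeros all lie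
in the left half-plane. -/
lemma neg_re_logDeriv_le {R : ℝ} (hR : 0 < R) {f : ℂ → ℂ} {B : ℝ} (hB : 1 < B)
    (hf : DifferentiableOn ℂ f (ball 0 R)) (hf0 : f 0 ≠ 0)
    (hfB : ∀ z ∈ ball (0 : ℂ) R, ‖f z‖ ≤ B * ‖f 0‖)
    (hzero : ∀ z ∈ ball (0 : ℂ) R, f z = 0 → z.re < 0) :
    -(deriv f 0 / f 0).re ≤ 16 * Real.log B / R := by
  obtain ⟨n, hn⟩ := pow_unbounded_of_one_lt B (by norm_num : (1 : ℝ) < 3)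
  induction n generalizing f B with
  | zero => simp at hn; linarith
  | succ n ih =>
    by_cases h : ∃ a ∈ ball (0 : ℂ) (R / 4), f a = 0
    · obtain ⟨a, ha, hfa⟩ := h
      have ha0 : a ≠ 0 := by rintro rfl; exact hf0 hfa
      have haR : a ∈ ball (0 : ℂ) R := ball_subset_ball (by linarith) ha
      obtain ⟨g, hgd, hfg, hg0, hgB, hder⟩ :=
        exists_eq_sub_mul (by linarith) (by simpa using ha) ha0 hf hfa hf0 hfB
      have hB3 : 1 ≤ B / 3 := by
        have := hgB 0 (mem_ball_self hR)
        exact le_of_mul_le_mul_right (by linarith) (norm_pos_iff.mpr hg0)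
      have hare : 0 ≤ (-1 / a).re := by
        rw [Complex.div_re]
        have := hzero a haR hfa
        have : 0 ≤ -a.re / Complex.normSq a := div_nonneg (by linarith) (Complex.normSq_nonneg _)
        simpa using this
      rw [hder, Complex.add_re]
      have : -(deriv g 0 / g 0).re ≤ 16 * Real.log B / R := by
        have hB3' : 1 < B / 2 := by linarith
        have hgz : ∀ z ∈ ball (0 : ℂ) R, g z = 0 → z.re < 0 := fun z hz hgz =>
          hzero z hz (by rw [hfg, hgz, mul_zero])
        by_cases h1 : 1 < B / 3
        · refine (ih h1 hgd hg0 hgB hgz ?_).trans ?_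
          · rw [pow_succ] at hn; linarith
          · gcongr
            linarith
        · have hB1 : B / 3 = 1 := le_antisymm (not_lt.mp h1) hB3
          rcases Nat.eq_zero_or_pos n with rfl | hnpos
          · simp at hn; linarith
          refine (ih hB3' hgd hg0 (fun z hz => (hgB z hz).trans ?_) hgz ?_).trans ?_
          · gcongr; linarith
          · have : (3 : ℝ) ^ 1 ≤ 3 ^ n := pow_le_pow_right₀ (by norm_num) hnpos
            linarith
          · gcongr
            linarith
      linarith
    · push Not at h
      have hsub : ball (0 : ℂ) (R / 4) ⊆ ball 0 R := ball_subset_ball (by linarith)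
      have := norm_logDeriv_le_of_ne_zero (by linarith : 0 < R / 4) hB (hf.mono hsub) h
        fun z hz => hfB z (hsub hz)
      calc _ ≤ |(deriv f 0 / f 0).re| := neg_le_abs _
        _ ≤ _ := Complex.abs_re_le_norm _
        _ ≤ _ := this
        _ = _ := by field_simp; ring

open Metric in
lemma neg_re_logDeriv_le_of_zero {R x : ℝ} (hx : 0 < x) (hxR : x < R / 4) {f : ℂ → ℂ} {B : ℝ}
    (hB : 1 < B) (hf : DifferentiableOn ℂ f (ball 0 R)) (hf0 : f 0 ≠ 0)
    (hfB : ∀ z ∈ ball (0 : ℂ) R, ‖f z‖ ≤ B * ‖f 0‖)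
    (hzero : ∀ z ∈ ball (0 : ℂ) R, f z = 0 → z.re < 0) (hfx : f (-x : ℝ) = 0) :
    -(deriv f 0 / f 0).re ≤ 16 * Real.log B / R - 1 / x := by
  have hR : 0 < R := by linarith
  obtain ⟨g, hgd, hfg, hg0, hgB, hder⟩ :=
    exists_eq_sub_mul (a := ((-x : ℝ) : ℂ)) (by linarith)
      (by rw [Complex.norm_real, norm_neg, Real.norm_of_nonneg hx.le]; exact hxR)
      (by exact_mod_cast (neg_lt_zero.mpr hx).ne) hf hfx hf0 hfB
  have := neg_re_logDeriv_le hR hB hgd hg0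
    (fun z hz => (hgB z hz).trans (by gcongr; linarith))
    fun z hz hgz => hzero z hz (by rw [hfg, hgz, mul_zero])
  rw [hder, Complex.add_re]
  have h1 : (-1 / ((-x : ℝ) : ℂ)).re = 1 / x := by
    rw [show (-1 / ((-x : ℝ) : ℂ)) = ((1 / x : ℝ) : ℂ) by push_cast; field_simp]
    simp
  rw [h1]; linarith

lemma re_term_vonMangoldt (σ y : ℝ) (n : ℕ) :
    (LSeries.term (fun n => (ArithmeticFunction.vonMangoldt n : ℂ)) (σ + y * Complex.I) n).re =
      ArithmeticFunction.vonMangoldt n * Real.exp (-(σ * Real.log n)) * Real.cos (y * Real.log n) := by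
  rcases eq_or_ne n 0 with rfl | hn
  · simp
  · have hn' : (n : ℂ) ≠ 0 := Nat.cast_ne_zero.mpr hn
    rw [LSeries.term_of_ne_zero hn, div_eq_mul_inv, ← Complex.cpow_neg,
      Complex.cpow_def_of_ne_zero hn', ← Complex.natCast_log, Complex.re_ofReal_mul,
      Complex.exp_re]
    have h1 : ((Real.log n : ℂ) * -(σ + y * Complex.I)).re = -(σ * Real.log n) := by
      rw [Complex.re_ofReal_mul]; simp; ring
    have h2 : ((Real.log n : ℂ) * -(σ + y * Complex.I)).im = -(y * Real.log n) := by
      rw [Complex.im_ofReal_mul]; simp; ring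
    rw [h1, h2, Real.cos_neg, mul_assoc]

/-- The `3-4-1` inequality for the logarithmic derivative of `ζ`. -/
lemma logDeriv_riemannZeta_combination_nonneg {σ : ℝ} (hσ : 1 < σ) (t : ℝ) :
    0 ≤ 3 * -(deriv riemannZeta σ / riemannZeta σ).re +
      4 * -(deriv riemannZeta (σ + t * Complex.I) / riemannZeta (σ + t * Complex.I)).re +
      -(deriv riemannZeta (σ + (2 * t : ℝ) * Complex.I) /
        riemannZeta (σ + (2 * t : ℝ) * Complex.I)).re := by
  have key : ∀ y : ℝ, HasSum (fun n : ℕ => ArithmeticFunction.vonMangoldt n *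
      Real.exp (-(σ * Real.log n)) * Real.cos (y * Real.log n))
      (-(deriv riemannZeta (σ + y * Complex.I) / riemannZeta (σ + y * Complex.I)).re) := by
    intro y
    have hs : 1 < ((σ : ℂ) + y * Complex.I).re := by simpa using hσ
    have h1 := (ArithmeticFunction.LSeriesSummable_vonMangoldt hs).LSeriesHasSum
    rw [ArithmeticFunction.LSeries_vonMangoldt_eq_deriv_riemannZeta_div hs] at h1
    have h2 := Complex.hasSum_re h1
    simp only [re_term_vonMangoldt, neg_div, Complex.neg_re] at h2
    exact h2
  have h0 := key 0
  simp only [Complex.ofReal_zero, zero_mul, add_zero, Real.cos_zero, mul_one] at h0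
  refine (((h0.mul_left 3).add ((key t).mul_left 4)).add (key (2 * t))).nonneg fun n => ?_
  have hv : 0 ≤ ArithmeticFunction.vonMangoldt n * Real.exp (-(σ * Real.log n)) :=
    mul_nonneg ArithmeticFunction.vonMangoldt_nonneg (Real.exp_pos _).le
  have hc : 0 ≤ 3 + 4 * Real.cos (t * Real.log n) + Real.cos (2 * t * Real.log n) := by
    rw [mul_assoc 2, Real.cos_two_mul]
    nlinarith [sq_nonneg (Real.cos (t * Real.log n) + 1)]
  calc (0 : ℝ) ≤ _ := mul_nonneg hv hc
    _ = _ := by ring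

lemma riemannZeta₁_eq_sub_one_mul {s : ℂ} (hs : s ≠ 1) :
    riemannZeta₁ s = (s - 1) * riemannZeta s := by
  rw [riemannZeta_eq_inv_sub_mul hs, mul_inv_cancel_left₀ (sub_ne_zero.mpr hs)]

lemma riemannZeta₁_ne_zero_of_one_le_re {s : ℂ} (hs : 1 ≤ s.re) : riemannZeta₁ s ≠ 0 := by
  rcases eq_or_ne s 1 with rfl | h1
  · simp
  · rw [riemannZeta₁_eq_sub_one_mul h1]
    exact mul_ne_zero (sub_ne_zero.mpr h1) (riemannZeta_ne_zero_of_one_le_re hs)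

lemma exists_riemannZeta_real_bounds : ∃ C₀ : ℝ, 1 ≤ C₀ ∧ ∀ σ : ℝ, 1 < σ → σ ≤ 2 →
    ‖riemannZeta σ‖ ≤ C₀ / (σ - 1) ∧
    -(deriv riemannZeta σ / riemannZeta σ).re ≤ 1 / (σ - 1) + C₀ := by
  have hc1 : ContinuousOn (fun σ : ℝ => ‖riemannZeta₁ σ‖) (Set.Icc 1 2) :=
    (differentiable_riemannZeta₁.continuous.comp Complex.continuous_ofReal).norm.continuousOn
  have hc2 : ContinuousOn (fun σ : ℝ => ‖deriv riemannZeta₁ σ / riemannZeta₁ σ‖) (Set.Icc 1 2) := by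
    refine ContinuousOn.norm (ContinuousOn.div ?_ ?_ fun σ hσ => ?_)
    · exact (differentiable_riemannZeta₁.deriv.continuous.comp
        Complex.continuous_ofReal).continuousOn
    · exact (differentiable_riemannZeta₁.continuous.comp Complex.continuous_ofReal).continuousOn
    · exact riemannZeta₁_ne_zero_of_one_le_re (by simpa using hσ.1)
  obtain ⟨a, ha⟩ := isCompact_Icc.bddAbove_image hc1
  obtain ⟨b, hb⟩ := isCompact_Icc.bddAbove_image hc2
  refine ⟨max 1 (max a b), le_max_left _ _, fun σ h1 h2 => ?_⟩
  have hσ0 : 0 < σ - 1 := by linarith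
  have hne : (σ : ℂ) ≠ 1 := by exact_mod_cast h1.ne'
  have hz0 : riemannZeta₁ σ ≠ 0 := riemannZeta₁_ne_zero_of_one_le_re (by simpa using h1.le)
  have ha' : ‖riemannZeta₁ σ‖ ≤ a := ha ⟨σ, ⟨h1.le, h2⟩, rfl⟩
  have hb' : ‖deriv riemannZeta₁ σ / riemannZeta₁ σ‖ ≤ b := hb ⟨σ, ⟨h1.le, h2⟩, rfl⟩
  have hsub : (σ : ℂ) - 1 = ((σ - 1 : ℝ) : ℂ) := by push_cast; rfl
  constructor
  · rw [riemannZeta_eq_inv_sub_mul hne, norm_mul, norm_inv, hsub, Complex.norm_real,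
      Real.norm_of_nonneg hσ0.le, inv_mul_eq_div]
    have : a ≤ max 1 (max a b) := (le_max_left _ _).trans (le_max_right _ _)
    gcongr
    linarith
  · have hd : deriv riemannZeta σ / riemannZeta σ =
        -((1 / (σ - 1) : ℝ) : ℂ) + deriv riemannZeta₁ σ / riemannZeta₁ σ := by
      have h0 : (σ : ℂ) - 1 ≠ 0 := sub_ne_zero.mpr hne
      rw [deriv_riemannZeta_eq_neg_inv_sub_sq_mul_add hne, riemannZeta_eq_inv_sub_mul hne]
      push_cast
      field_simp
    rw [hd, Complex.add_re, Complex.neg_re, Complex.ofReal_re]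
    have h3 := (Complex.abs_re_le_norm _).trans hb'
    have h4 := neg_le_abs (deriv riemannZeta₁ σ / riemannZeta₁ σ).re
    have : b ≤ max 1 (max a b) := (le_max_right _ _).trans (le_max_right _ _)
    linarith

/-- `|1/ζ(σ + it)| ≤ ζ(σ)` for `σ > 1`. -/
lemma norm_inv_riemannZeta_le {s : ℂ} (hs : 1 < s.re) :
    ‖(riemannZeta s)⁻¹‖ ≤ ‖riemannZeta (s.re : ℂ)‖ := by
  have hs' : 1 < ((s.re : ℝ) : ℂ).re := by simpa using hs
  have hinv : (riemannZeta s)⁻¹ = LSeries (fun n => (ArithmeticFunction.moebius n : ℂ)) s := by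
    have := ArithmeticFunction.LSeries_zeta_mul_Lseries_moebius hs
    rw [ArithmeticFunction.LSeries_zeta_eq_riemannZeta hs] at this
    exact inv_eq_of_mul_eq_one_right this
  have hsum := LSeriesHasSum_one hs'
  have hsumr := Complex.hasSum_re hsum
  rw [hinv]
  refine (tsum_of_norm_bounded hsumr fun n => ?_).trans (Complex.re_le_norm _)
  rcases eq_or_ne n 0 with rfl | hn
  · simp
  · rw [LSeries.norm_term_eq, if_neg hn, LSeries.term_of_ne_zero hn]
    have e1 : ((1 : ℕ → ℂ) n / (n : ℂ) ^ ((s.re : ℝ) : ℂ)).re = 1 / (n : ℝ) ^ s.re := by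
      rw [Pi.one_apply, show ((n : ℕ) : ℂ) = (((n : ℕ) : ℝ) : ℂ) by simp,
        ← Complex.ofReal_cpow (Nat.cast_nonneg n)]
      rw [← Complex.ofReal_one, ← Complex.ofReal_div, Complex.ofReal_re]
    rw [e1]
    gcongr
    have := ArithmeticFunction.abs_moebius_le_one (n := n)
    rw [Complex.norm_intCast]
    exact_mod_cast this

section Kernel

/-- Parameters of the Vinogradov–Korobov region at height `exp l`, where `lam ^ 3 = log l / l`
and `C₀` controls `ζ` to the right of its pole. -/
structure RegionParam (C₀ l lam : ℝ) : Prop where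
  ten_le : 10 ≤ l
  lam_pos : 0 < lam
  cube_eq : lam ^ 3 * l = Real.log l
  lam_le : 770304 * lam ≤ 1
  one_le : 1 ≤ C₀
  le_l : C₀ ≤ l
  three_mul_le : 3 * C₀ ≤ 64192 * (lam * l)
  norm_le : ∀ σ : ℝ, 1 < σ → σ ≤ 2 → ‖riemannZeta σ‖ ≤ C₀ / (σ - 1)
  neg_re_le : ∀ σ : ℝ, 1 < σ → σ ≤ 2 →
    -(deriv riemannZeta σ / riemannZeta σ).re ≤ 1 / (σ - 1) + C₀

namespace RegionParam

variable {C₀ l lam : ℝ}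

lemma lam_sq_le (h : RegionParam C₀ l lam) : lam ^ 2 ≤ 1 / 4 := by
  have := h.lam_pos; have := h.lam_le
  nlinarith

lemma log_pos (h : RegionParam C₀ l lam) : 1 ≤ Real.log l := by
  rw [Real.le_log_iff_exp_le (by linarith [h.ten_le])]
  linarith [Real.exp_one_lt_d9, h.ten_le]

lemma norm_riemannZeta_inv_le (h : RegionParam C₀ l lam) {η t : ℝ} (hη : 1 / l ≤ η) (hη1 : η ≤ 1) :
    ‖(riemannZeta ((1 + η : ℝ) + t * Complex.I))⁻¹‖ ≤ l ^ 2 := by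
  have hl := h.ten_le
  have hη0 : 0 < η := lt_of_lt_of_le (by positivity) hη
  have h1 := norm_inv_riemannZeta_le (s := (1 + η : ℝ) + t * Complex.I) (by simp; linarith)
  have h2 := h.norm_le (1 + η) (by linarith) (by linarith)
  have hre : (((1 + η : ℝ) : ℂ) + t * Complex.I).re = 1 + η := by simp
  rw [hre] at h1
  refine h1.trans (h2.trans ?_)
  rw [add_sub_cancel_left, div_le_iff₀ hη0]
  rw [div_le_iff₀ (by linarith)] at hη
  calc C₀ ≤ l * 1 := by linarith [h.le_l]
    _ ≤ l * (η * l) := by gcongr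
    _ = l ^ 2 * η := by ring

lemma norm_riemannZeta_add_le (h : RegionParam C₀ l lam) {η t : ℝ} (hη : 1 / l ≤ η)
    (hη1 : η ≤ 1) (ht : 3 ≤ t) (htl : t + 1 ≤ Real.exp l) {z : ℂ}
    (hz : z ∈ Metric.ball (0 : ℂ) (lam ^ 2)) :
    ‖riemannZeta ((1 + η : ℝ) + t * Complex.I + z)‖ ≤
      l ^ 4012 * ‖riemannZeta ((1 + η : ℝ) + t * Complex.I)‖ := by
  have hl := h.ten_le
  have hη0 : 0 < η := lt_of_lt_of_le (by positivity) hη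
  have hz' : ‖z‖ < lam ^ 2 := by simpa using hz
  have hsq := h.lam_sq_le
  have hzr := abs_le.mp ((Complex.abs_re_le_norm z).trans hz'.le)
  have hzi := abs_le.mp ((Complex.abs_im_le_norm z).trans hz'.le)
  have h1 : ‖riemannZeta ((1 + η : ℝ) + t * Complex.I + z)‖ ≤ l ^ 4010 := by
    refine norm_riemannZeta_le hl h.lam_pos h.cube_eq (by linarith) ?_ ?_ ?_ ?_ <;>
      simp <;> linarith
  have h2 := h.norm_riemannZeta_inv_le (t := t) hη hη1
  have hne : riemannZeta ((1 + η : ℝ) + t * Complex.I) ≠ 0 :=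
    riemannZeta_ne_zero_of_one_le_re (by simp; linarith)
  have hpos := norm_pos_iff.mpr hne
  rw [norm_inv, inv_le_iff_one_le_mul₀ hpos] at h2
  calc _ ≤ l ^ 4010 * 1 := by linarith
    _ ≤ l ^ 4010 * (l ^ 2 * _) := mul_le_mul_of_nonneg_left h2 (by positivity)
    _ = _ := by rw [← mul_assoc, ← pow_add]

lemma differentiableOn_riemannZeta_add (h : RegionParam C₀ l lam) {σ t : ℝ} (ht : 3 ≤ t) :
    DifferentiableOn ℂ (fun z => riemannZeta (σ + t * Complex.I + z))
      (Metric.ball 0 (lam ^ 2)) := by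
  intro z hz
  have hz' : ‖z‖ < lam ^ 2 := by simpa using hz
  have hsq := h.lam_sq_le
  have hzi := abs_le.mp ((Complex.abs_im_le_norm z).trans hz'.le)
  have hne : (σ : ℂ) + t * Complex.I + z ≠ 1 := by
    intro h1
    have := congrArg Complex.im h1
    simp at this
    linarith
  exact ((differentiableAt_riemannZeta hne).comp z
    ((differentiableAt_id).const_add _)).differentiableWithinAt

lemma deriv_riemannZeta_add (s : ℂ) :
    deriv (fun z => riemannZeta (s + z)) 0 = deriv riemannZeta s := by
  rw [deriv_comp_const_add, add_zero]

/-- The Vinogradov–Korobov zero-free region. -/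
lemma riemannZeta_ne_zero (h : RegionParam C₀ l lam) {β t : ℝ} (ht : 3 ≤ t)
    (htl : 2 * t + 1 ≤ Real.exp l) (hβ : 1 - 1 / (7 * (770304 * (lam * l))) < β) :
    riemannZeta (β + t * Complex.I) ≠ 0 := by
  intro hzero
  have hl := h.ten_le
  have hl0 : 0 < l := by linarith
  have hlam := h.lam_pos
  have hlog := h.log_pos
  have hsq := h.lam_sq_le
  set P := 64192 * (lam * l) with hP
  have hPpos : 0 < P := by positivity
  set η := 1 / (12 * P) with hη
  have hη0 : 0 < η := by positivity
  have hηl : 1 / l ≤ η := by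
    rw [hη]
    refine one_div_le_one_div_of_le (by positivity) ?_
    have := mul_le_mul_of_nonneg_right h.lam_le hl0.le
    rw [hP]; linarith
  have hPC := h.three_mul_le
  have hη1 : η ≤ 1 := by
    rw [hη, div_le_one (by positivity)]
    linarith [h.one_le]
  have hβη : 1 - η / 7 < β := by
    have : 1 / (7 * (770304 * (lam * l))) = η / 7 := by rw [hη, hP]; field_simp; norm_num
    linarith
  have hβ1 : β < 1 := by
    by_contra hcon
    exact riemannZeta_ne_zero_of_one_le_re (by simpa using hcon) hzero
  set x := 1 + η - β with hx
  have hx0 : 0 < x := by linarith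
  have hPlam : P * lam ^ 2 = 64192 * Real.log l := by rw [hP, ← h.cube_eq]; ring
  have hxR : x < lam ^ 2 / 4 := by
    have h1 : x < 8 / 7 * η := by linarith
    have h2 : 8 / 7 * η ≤ lam ^ 2 / 4 := by
      rw [hη, mul_one_div, div_le_iff₀ (by positivity)]
      nlinarith
    linarith
  have hB : 1 < l ^ 4012 := one_lt_pow₀ (by linarith) (by norm_num)
  have hlogB : 16 * Real.log (l ^ 4012) / lam ^ 2 = P := by
    rw [Real.log_pow, div_eq_iff (by positivity), hPlam]
    push_cast; ring
  have hre_neg : ∀ y : ℝ, ∀ z : ℂ, riemannZeta ((1 + η : ℝ) + y * Complex.I + z) = 0 →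
      z.re < 0 := by
    intro y z hz
    by_contra hcon
    exact riemannZeta_ne_zero_of_one_le_re (by simp; linarith) hz
  have hne : ∀ y : ℝ, riemannZeta ((1 + η : ℝ) + y * Complex.I + 0) ≠ 0 := fun y =>
    riemannZeta_ne_zero_of_one_le_re (by simp; linarith)
  have hb1 := neg_re_logDeriv_le_of_zero hx0 hxR hB
    (h.differentiableOn_riemannZeta_add (σ := 1 + η) ht) (hne t)
    (fun z hz => by
      rw [add_zero]
      exact h.norm_riemannZeta_add_le hηl hη1 ht (by linarith) hz)
    (fun z _ hz => hre_neg t z hz) (by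
      rw [← hzero]
      congr 1
      rw [hx]; push_cast; ring)
  have hb2 := neg_re_logDeriv_le (by positivity : 0 < lam ^ 2) hB
    (h.differentiableOn_riemannZeta_add (σ := 1 + η) (by linarith : 3 ≤ 2 * t)) (hne (2 * t))
    (fun z hz => by
      rw [add_zero]
      exact h.norm_riemannZeta_add_le hηl hη1 (by linarith) htl hz)
    (fun z _ hz => hre_neg (2 * t) z hz)
  have hb0 := h.neg_re_le (1 + η) (by linarith) (by linarith)
  have hcomb := logDeriv_riemannZeta_combination_nonneg (by linarith : 1 < 1 + η) t
  rw [hlogB, deriv_riemannZeta_add, add_zero] at hb1 hb2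
  rw [add_sub_cancel_left] at hb0
  have hη' : 1 / η = 12 * P := by rw [hη, one_div_one_div]
  have h4 : 4 * (1 / x) ≤ 42 * P := by
    rw [hη'] at hb0
    linarith
  have h5 : 7 / (8 * η) < 1 / x := by
    rw [div_lt_div_iff₀ (by positivity) hx0]
    linarith
  have h6 : 7 / (8 * η) = 21 / 2 * P := by rw [hη]; field_simp; norm_num
  linarith

lemma norm_riemannZeta_inv_le_of_near (h : RegionParam C₀ l lam) {σ t : ℝ} (ht : 4 ≤ t)
    (htl : 2 * t + 3 ≤ Real.exp l) (hσ : 1 - 1 / (14 * (770304 * (lam * l))) ≤ σ) (hσ2 : σ ≤ 2) :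
    riemannZeta (σ + t * Complex.I) ≠ 0 ∧
      ‖(riemannZeta (σ + t * Complex.I))⁻¹‖ ≤ l ^ 130000 := by
  have hl := h.ten_le
  have hl0 : 0 < l := by linarith
  have hlam := h.lam_pos
  have hlog := h.log_pos
  have hsq := h.lam_sq_le
  set P := 64192 * (lam * l) with hP
  have hPpos : 0 < P := by positivity
  set η := 1 / (12 * P) with hη
  have hη0 : 0 < η := by positivity
  have hηl : 1 / l ≤ η := by
    rw [hη]
    refine one_div_le_one_div_of_le (by positivity) ?_
    have := mul_le_mul_of_nonneg_right h.lam_le hl0.le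
    rw [hP]; linarith
  have hη1 : η ≤ 1 := by
    rw [hη, div_le_one (by positivity)]
    linarith [h.one_le, h.three_mul_le]
  have hη7 : 1 / (7 * (770304 * (lam * l))) = η / 7 := by rw [hη, hP]; field_simp; norm_num
  have hη14 : 1 / (14 * (770304 * (lam * l))) = η / 14 := by rw [hη, hP]; field_simp; norm_num
  rw [hη14] at hσ
  have hmono : ∀ n : ℕ, n ≤ 130000 → l ^ n ≤ l ^ 130000 := fun n hn =>
    pow_le_pow_right₀ (by linarith) hn
  rcases le_or_gt (1 + η) σ with hbig | hsmall
  · refine ⟨riemannZeta_ne_zero_of_one_le_re (by simp; linarith), ?_⟩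
    have := h.norm_riemannZeta_inv_le (η := σ - 1) (t := t) (by linarith) (by linarith)
    rw [add_sub_cancel] at this
    exact this.trans (hmono 2 (by norm_num))
  · have hPlam : P * lam ^ 2 = 64192 * Real.log l := by rw [hP, ← h.cube_eq]; ring
    have hr : 8 / 7 * η ≤ lam ^ 2 := by
      rw [hη, mul_one_div, div_le_iff₀ (by positivity)]
      nlinarith
    have hsub : Metric.ball (0 : ℂ) (8 / 7 * η) ⊆ Metric.ball 0 (lam ^ 2) :=
      Metric.ball_subset_ball hr
    have hball : ∀ z ∈ Metric.ball (0 : ℂ) (8 / 7 * η),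
        riemannZeta ((1 + η : ℝ) + t * Complex.I + z) ≠ 0 := by
      intro z hz
      have hz' : ‖z‖ < 8 / 7 * η := by simpa using hz
      have hzr := abs_lt.mp ((Complex.abs_re_le_norm z).trans_lt hz')
      have hzi := abs_lt.mp ((Complex.abs_im_le_norm z).trans_lt hz')
      have := h.riemannZeta_ne_zero (β := 1 + η + z.re) (t := t + z.im) (by linarith)
        (by linarith) (by rw [hη7]; linarith)
      convert this using 2
      apply Complex.ext <;> simp
    have hB : 1 < l ^ 4012 := one_lt_pow₀ (by linarith) (by norm_num)
    obtain ⟨g, -, -, hg, hgB⟩ := exists_eq_mul_exp_of_norm_le (by positivity : 0 < 8 / 7 * η) hB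
      ((h.differentiableOn_riemannZeta_add (σ := 1 + η) (by linarith : 3 ≤ t)).mono hsub) hball
      (fun z hz => by
        rw [add_zero]
        exact h.norm_riemannZeta_add_le hηl hη1 (by linarith) (by linarith) (hsub hz))
    set z : ℂ := ((σ - (1 + η) : ℝ) : ℂ) with hz
    have hzn : ‖z‖ = 1 + η - σ := by
      rw [hz, Complex.norm_real, Real.norm_eq_abs, abs_of_neg (by linarith)]; ring
    have hzb : z ∈ Metric.ball (0 : ℂ) (8 / 7 * η) := by
      rw [mem_ball_zero_iff, hzn]; linarith
    have heq : ((1 + η : ℝ) : ℂ) + t * Complex.I + z = σ + t * Complex.I := by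
      rw [hz]; push_cast; ring
    have h1 := hg z hzb
    have h2 := hgB z hzb
    have hne := hball z hzb
    simp only [heq, add_zero] at h1 hne
    refine ⟨hne, ?_⟩
    have h3 : ‖g z‖ ≤ 120360 * Real.log l := by
      refine h2.trans ?_
      rw [Real.log_pow, hzn, div_le_iff₀ (by linarith)]
      push_cast
      have : 0 ≤ Real.log l * (15 * (8 / 7 * η - (1 + η - σ)) - (1 + η - σ)) :=
        mul_nonneg (by linarith) (by linarith)
      nlinarith
    have hpow : Real.exp (120360 * Real.log l) = l ^ 120360 := by
      rw [← Real.exp_log (by positivity : 0 < l ^ 120360), Real.log_pow]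
      norm_num
    rw [h1, mul_inv, norm_mul, ← Complex.exp_neg, Complex.norm_exp]
    calc _ ≤ l ^ 2 * l ^ 120360 := by
          refine mul_le_mul (h.norm_riemannZeta_inv_le hηl hη1) ?_ (Real.exp_pos _).le
            (by positivity)
          rw [← hpow]
          refine Real.exp_le_exp.mpr (le_trans ?_ h3)
          rw [Complex.neg_re]
          exact (neg_le_abs _).trans (Complex.abs_re_le_norm _)
      _ = l ^ 120362 := by rw [← pow_add]
      _ ≤ _ := hmono _ (by norm_num)

end RegionParam

end Kernel

lemma exists_riemannZeta₁_lower_bound : ∃ ε : ℝ, 0 < ε ∧ ∃ m : ℝ, 0 < m ∧ ∀ s : ℂ,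
    1 - ε ≤ s.re → s.re ≤ 2 → |s.im| ≤ 4 → m ≤ ‖riemannZeta₁ s‖ := by
  have hcont : Continuous riemannZeta₁ := differentiable_riemannZeta₁.continuous
  have hK : IsCompact (Set.Icc (1 : ℝ) 2 ×ℂ Set.Icc (-4 : ℝ) 4) :=
    isCompact_Icc.reProdIm isCompact_Icc
  have hK' : IsCompact (Set.Icc (0 : ℝ) 2 ×ℂ Set.Icc (-4 : ℝ) 4) :=
    isCompact_Icc.reProdIm isCompact_Icc
  obtain ⟨s₀, hs₀, hmin⟩ := hK.exists_isMinOn (f := fun s => ‖riemannZeta₁ s‖)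
    ⟨1, by simp [Complex.mem_reProdIm]⟩ hcont.norm.continuousOn
  have hm : 0 < ‖riemannZeta₁ s₀‖ :=
    norm_pos_iff.mpr (riemannZeta₁_ne_zero_of_one_le_re (Complex.mem_reProdIm.mp hs₀).1.1)
  set m := ‖riemannZeta₁ s₀‖
  have huc := hK'.uniformContinuousOn_of_continuous hcont.continuousOn
  obtain ⟨δ, hδ, hunif⟩ := Metric.uniformContinuousOn_iff.mp huc (m / 2) (by linarith)
  refine ⟨min (δ / 2) 1, by positivity, m / 2, by linarith, fun s h1 h2 h3 => ?_⟩
  have hd1 : min (δ / 2) 1 ≤ δ / 2 := min_le_left _ _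
  have hd2 : min (δ / 2) 1 ≤ 1 := min_le_right _ _
  rcases le_or_gt 1 s.re with hge | hlt
  · have : m ≤ ‖riemannZeta₁ s‖ := hmin (Complex.mem_reProdIm.mpr ⟨⟨hge, h2⟩, abs_le.mp h3⟩)
    linarith
  · set s' : ℂ := s + ((1 - s.re : ℝ) : ℂ) with hs'
    have hre : s'.re = 1 := by simp [hs']
    have him : s'.im = s.im := by simp [hs']
    have hs'K : m ≤ ‖riemannZeta₁ s'‖ := hmin (Complex.mem_reProdIm.mpr
      ⟨by rw [hre]; norm_num, by rw [him]; exact abs_le.mp h3⟩)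
    have hdist : dist s s' < δ := by
      rw [dist_eq_norm, hs', sub_add_cancel_left, norm_neg, Complex.norm_real,
        Real.norm_of_nonneg (by linarith)]
      linarith
    have := hunif s (Complex.mem_reProdIm.mpr ⟨⟨by linarith, h2⟩, abs_le.mp h3⟩) s'
      (Complex.mem_reProdIm.mpr ⟨by rw [hre]; norm_num, by rw [him]; exact abs_le.mp h3⟩) hdist
    rw [dist_eq_norm] at this
    have h5 := norm_sub_norm_le (riemannZeta₁ s') (riemannZeta₁ s)
    rw [norm_sub_rev] at h5
    linarith

/-- The reciprocal of `ζ` is bounded by a power of `l` in the Vinogradov–Korobov region. -/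
theorem exists_norm_sub_one_div_riemannZeta₁_le : ∃ c : ℝ, 0 < c ∧ ∃ A : ℕ, ∃ l₀ : ℝ, 10 ≤ l₀ ∧
    ∀ l : ℝ, l₀ ≤ l → ∀ s : ℂ, |s.im| ≤ Real.exp l / 3 →
      1 - c / (l ^ (2 / 3 : ℝ) * Real.log l ^ (1 / 3 : ℝ)) ≤ s.re → s.re ≤ 2 →
        riemannZeta₁ s ≠ 0 ∧ ‖(s - 1) / riemannZeta₁ s‖ ≤ l ^ A := by
  obtain ⟨C₀, hC1, hC⟩ := exists_riemannZeta_real_bounds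
  obtain ⟨ε, hε, m, hm, hsmall⟩ := exists_riemannZeta₁_lower_bound
  have hlim : Filter.Tendsto (fun l : ℝ => Real.log l / l) Filter.atTop (nhds 0) :=
    Real.isLittleO_log_id_atTop.tendsto_div_nhds_zero
  have hev := hlim.eventually (gt_mem_nhds (show (0 : ℝ) < (1 / 770304) ^ 3 by positivity))
  have hpow : Filter.Tendsto (fun l : ℝ => l ^ (2 / 3 : ℝ)) Filter.atTop Filter.atTop :=
    tendsto_rpow_atTop (by norm_num)
  obtain ⟨l₀, hl₀⟩ := Filter.eventually_atTop.mp
    ((((hev.and (hpow.eventually_ge_atTop (C₀ + 1 / ε))).and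
      (Filter.eventually_ge_atTop C₀)).and (Filter.eventually_ge_atTop (10 / m))))
  refine ⟨1 / 10784256, by norm_num, 130000, max 10 l₀, le_max_left _ _, fun l hl s him h1 h2 => ?_⟩
  have hl10 : 10 ≤ l := (le_max_left _ _).trans hl
  have hl0 : 0 < l := by linarith
  obtain ⟨⟨⟨hlog3, hl23⟩, hlC⟩, hlm⟩ := hl₀ l ((le_max_right _ _).trans hl)
  have hlog1 : 1 ≤ Real.log l := by
    rw [Real.le_log_iff_exp_le hl0]
    linarith [Real.exp_one_lt_d9]
  set lam := (Real.log l / l) ^ (1 / 3 : ℝ) with hlam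
  have hq : 0 < Real.log l / l := by positivity
  have hlam3 : lam ^ 3 = Real.log l / l := by
    rw [hlam, ← Real.rpow_natCast, ← Real.rpow_mul hq.le]; norm_num
  have hlaml : lam * l = l ^ (2 / 3 : ℝ) * Real.log l ^ (1 / 3 : ℝ) := by
    rw [hlam, Real.div_rpow (by linarith) hl0.le]
    have : l = l ^ (2 / 3 : ℝ) * l ^ (1 / 3 : ℝ) := by
      rw [← Real.rpow_add hl0]; norm_num
    calc Real.log l ^ (1 / 3 : ℝ) / l ^ (1 / 3 : ℝ) * l =
          Real.log l ^ (1 / 3 : ℝ) / l ^ (1 / 3 : ℝ) * (l ^ (2 / 3 : ℝ) * l ^ (1 / 3 : ℝ)) := by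
          rw [← this]
      _ = _ := by field_simp
  have hlog13 : 1 ≤ Real.log l ^ (1 / 3 : ℝ) := Real.one_le_rpow hlog1 (by norm_num)
  have hlaml' : C₀ + 1 / ε ≤ lam * l := by
    rw [hlaml]
    calc _ ≤ l ^ (2 / 3 : ℝ) * 1 := by linarith
      _ ≤ _ := by gcongr
  have hε' : 0 < 1 / ε := by positivity
  have hpar : RegionParam C₀ l lam := by
    refine ⟨hl10, by positivity, by rw [hlam3]; field_simp, ?_, hC1, hlC, by linarith,
      fun σ a b => (hC σ a b).1, fun σ a b => (hC σ a b).2⟩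
    by_contra hcon
    push Not at hcon
    have : (1 / 770304 : ℝ) ^ 3 < lam ^ 3 :=
      pow_lt_pow_left₀ (by linarith) (by norm_num) (by norm_num)
    rw [hlam3] at this
    linarith
  rw [← hlaml] at h1
  have hden : 1 / 10784256 / (lam * l) = 1 / (14 * (770304 * (lam * l))) := by
    field_simp; norm_num
  rw [hden] at h1
  have hexp : 9 ≤ Real.exp l := by linarith [Real.add_one_le_exp l]
  have hpos : 4 ≤ |s.im| → riemannZeta₁ s ≠ 0 ∧ ‖(s - 1) / riemannZeta₁ s‖ ≤ l ^ 130000 := by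
    intro h4
    have hs1 : s ≠ 1 := by rintro rfl; simp at h4; linarith
    have key := hpar.norm_riemannZeta_inv_le_of_near h4 (by linarith) h1 h2
    have hconj : riemannZeta (s.re + |s.im| * Complex.I) ≠ 0 ∧
        ‖(riemannZeta (s.re + |s.im| * Complex.I))⁻¹‖ ≤ l ^ 130000 →
        riemannZeta s ≠ 0 ∧ ‖(riemannZeta s)⁻¹‖ ≤ l ^ 130000 := by
      rcases le_total 0 s.im with hnn | hneg
      · rw [abs_of_nonneg hnn, Complex.re_add_im]; exact id
      · have : ((s.re : ℂ) + (|s.im| : ℝ) * Complex.I) = (starRingEnd ℂ) s := by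
          rw [abs_of_nonpos hneg]
          apply Complex.ext <;> simp
        rw [this, riemannZeta_conj, ← map_inv₀, RCLike.norm_conj]
        rintro ⟨a, b⟩
        exact ⟨fun h => a (by rw [h, map_zero]), b⟩
    obtain ⟨ha, hb⟩ := hconj key
    rw [riemannZeta₁_eq_sub_one_mul hs1]
    have hs1' := sub_ne_zero.mpr hs1
    refine ⟨mul_ne_zero hs1' ha, ?_⟩
    rwa [div_mul_eq_div_div, div_self hs1', one_div]
  rcases le_or_gt 4 |s.im| with h4 | h4
  · exact hpos h4
  · have hε2 : 1 / (14 * (770304 * (lam * l))) ≤ ε := by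
      rw [div_le_iff₀ (by positivity)]
      have : 1 ≤ ε * (lam * l) := by
        calc 1 = ε * (1 / ε) := by field_simp
          _ ≤ _ := by gcongr; linarith
      nlinarith
    have hlow := hsmall s (by linarith) h2 h4.le
    have hne : riemannZeta₁ s ≠ 0 := norm_pos_iff.mp (hm.trans_le hlow)
    refine ⟨hne, ?_⟩
    rw [norm_div, div_le_iff₀ (by linarith)]
    have hre : |(s - 1).re| ≤ 1 + 1 := by
      simp only [Complex.sub_re, Complex.one_re]
      have : 1 / (14 * (770304 * (lam * l))) ≤ 1 := by
        rw [div_le_one (by positivity)]; nlinarith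
      rw [abs_le]; constructor <;> linarith
    have hn := Complex.norm_le_abs_re_add_abs_im (s - 1)
    have himeq : (s - 1).im = s.im := by simp
    rw [himeq] at hn
    have h10 : 10 ≤ l * m := by rwa [div_le_iff₀ hm] at hlm
    calc ‖s - 1‖ ≤ 10 := by linarith
      _ ≤ l * m := h10
      _ ≤ l ^ 130000 * ‖riemannZeta₁ s‖ := by
          gcongr
          exact le_self_pow₀ (by linarith) (by norm_num)

lemma norm_one_div_mul_add_one_le {s : ℂ} (hs : 1 ≤ s.re) :
    ‖1 / (s * (s + 1))‖ ≤ (1 + s.im ^ 2)⁻¹ := by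
  have h1 : 1 + s.im ^ 2 ≤ ‖s‖ ^ 2 := by
    rw [← Complex.normSq_eq_norm_sq, Complex.normSq_apply]; nlinarith
  have h2 : ‖s‖ ^ 2 ≤ ‖s + 1‖ ^ 2 := by
    simp only [← Complex.normSq_eq_norm_sq, Complex.normSq_apply, Complex.add_re, Complex.one_re,
      Complex.add_im, Complex.one_im]; nlinarith
  have h3 : ‖s‖ ≤ ‖s + 1‖ := by
    exact (sq_le_sq₀ (norm_nonneg _) (norm_nonneg _)).mp h2
  rw [norm_div, norm_one, norm_mul, one_div]
  apply inv_anti₀ (by positivity)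
  nlinarith [norm_nonneg s]

lemma hasMellin_tent {s : ℂ} (hs : 0 < s.re) :
    HasMellin (fun u : ℝ => ((max 0 (1 - u) : ℝ) : ℂ)) s (1 / (s * (s + 1))) := by
  have h1 := hasMellin_one_Ioc hs
  have h2 := hasMellin_cpow_Ioc 1 (s := s) (by simp; linarith)
  have h := hasMellin_sub h1.1 h2.1
  rw [h1.2, h2.2] at h
  have hs0 : s ≠ 0 := fun h => by simp [h] at hs
  have hs1 : s + 1 ≠ 0 := fun h => by
    have := congrArg Complex.re h
    simp at this; linarith
  have hval : 1 / s - 1 / (s + 1) = 1 / (s * (s + 1)) := by field_simp; ring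
  rw [hval] at h
  have hcongr : Set.EqOn (fun u : ℝ => (u : ℂ) ^ (s - 1) •
      (Set.indicator (Set.Ioc 0 1) (fun _ => 1 : ℝ → ℂ) u -
        Set.indicator (Set.Ioc 0 1) (fun t => (t : ℂ) ^ (1 : ℂ) : ℝ → ℂ) u))
      (fun u : ℝ => (u : ℂ) ^ (s - 1) • ((max 0 (1 - u) : ℝ) : ℂ)) (Set.Ioi 0) := by
    intro u hu
    have hu0 : (0 : ℝ) < u := hu
    by_cases hu1 : u ≤ 1
    · have hm : u ∈ Set.Ioc (0 : ℝ) 1 := ⟨hu0, hu1⟩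
      simp [Set.indicator_of_mem hm, max_eq_right (sub_nonneg.mpr hu1)]
    · have hm : u ∉ Set.Ioc (0 : ℝ) 1 := fun h => hu1 h.2
      simp [Set.indicator_of_notMem hm, max_eq_left (sub_nonpos.mpr (not_le.mp hu1).le)]
  refine ⟨?_, ?_⟩
  · exact (MeasureTheory.integrableOn_congr_fun hcongr measurableSet_Ioi).mp h.1
  · rw [← h.2]
    exact (MeasureTheory.setIntegral_congr_fun measurableSet_Ioi hcongr).symm

/-- The point of height `y` on the vertical line of abscissa `σ`. -/
def lineAt (σ y : ℝ) : ℂ := σ + y * Complex.I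

@[simp] lemma lineAt_re (σ y : ℝ) : (lineAt σ y).re = σ := by simp [lineAt]
@[simp] lemma lineAt_im (σ y : ℝ) : (lineAt σ y).im = y := by simp [lineAt]

lemma continuous_lineAt (σ : ℝ) : Continuous (lineAt σ) := by
  unfold lineAt; fun_prop

lemma lineAt_mul_add_one_ne_zero {σ : ℝ} (hσ : 0 < σ) (y : ℝ) :
    lineAt σ y * (lineAt σ y + 1) ≠ 0 := by
  refine mul_ne_zero (fun h => ?_) (fun h => ?_)
  · have := congrArg Complex.re h
    simp at this; linarith
  · have := congrArg Complex.re h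
    simp at this; linarith

lemma integrable_perron_kernel {σ : ℝ} (hσ : 1 ≤ σ) {F : ℝ → ℂ} (hF : Continuous F) {B : ℝ}
    (hB : ∀ y, ‖F y‖ ≤ B) :
    MeasureTheory.Integrable fun y : ℝ => F y * (1 / (lineAt σ y * (lineAt σ y + 1))) := by
  refine (integrable_inv_one_add_sq.const_mul B).mono' ?_ (.of_forall fun y => ?_)
  · refine (hF.mul (Continuous.div continuous_const ?_ fun y =>
      lineAt_mul_add_one_ne_zero (by linarith) y)).aestronglyMeasurable
    exact (continuous_lineAt σ).mul ((continuous_lineAt σ).add continuous_const)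
  · rw [norm_mul]
    have h := norm_one_div_mul_add_one_le (s := lineAt σ y) (by simpa using hσ)
    rw [lineAt_im] at h
    exact mul_le_mul (hB y) h (norm_nonneg _) ((norm_nonneg _).trans (hB y))

lemma tent_eq_integral {σ : ℝ} (hσ : 1 ≤ σ) {u : ℝ} (hu : 0 < u) :
    ((max 0 (1 - u) : ℝ) : ℂ) = (1 / (2 * Real.pi) : ℝ) •
      ∫ y : ℝ, (u : ℂ) ^ (-lineAt σ y) * (1 / (lineAt σ y * (lineAt σ y + 1))) := by
  have hm : ∀ y : ℝ, mellin (fun u : ℝ => ((max 0 (1 - u) : ℝ) : ℂ)) (lineAt σ y) =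
      1 / (lineAt σ y * (lineAt σ y + 1)) := fun y =>
    (hasMellin_tent (by rw [lineAt_re]; linarith)).2
  have h := mellinInv_mellin_eq σ (fun u : ℝ => ((max 0 (1 - u) : ℝ) : ℂ)) hu
    (hasMellin_tent (by simp; linarith)).1 ?_ (by fun_prop)
  · rw [← h, mellinInv]
    simp only [smul_eq_mul]
    congr 1
    refine MeasureTheory.integral_congr_ae (.of_forall fun y => ?_)
    have := hm y
    unfold lineAt at this ⊢
    simp only [this]
  · have := integrable_perron_kernel hσ (F := fun _ => 1) continuous_const (B := 1) (by simp)
    simp only [one_mul, ← hm] at this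
    exact this

/-- Perron's formula for the Cesàro weighted sums of the Möbius function. -/
lemma sum_moebius_weighted_eq_integral {σ x : ℝ} (hσ : 1 < σ) (hx : 1 ≤ x) :
    ((∑ n ∈ Icc 1 ⌊x⌋₊, (ArithmeticFunction.moebius n : ℝ) * (1 - n / x) : ℝ) : ℂ) =
      (1 / (2 * Real.pi) : ℝ) • ∫ y : ℝ, (x : ℂ) ^ lineAt σ y * (riemannZeta (lineAt σ y))⁻¹ *
        (1 / (lineAt σ y * (lineAt σ y + 1))) := by
  have hx0 : 0 < x := by linarith
  have hxc : (x : ℂ) ≠ 0 := by exact_mod_cast hx0.ne'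
  set K : ℝ → ℂ := fun y => 1 / (lineAt σ y * (lineAt σ y + 1)) with hK
  set μ : ℕ → ℂ := fun n => (ArithmeticFunction.moebius n : ℂ) with hμ
  have hμ1 : ∀ n, ‖μ n‖ ≤ 1 := fun n => by
    rw [hμ]; simp only [Complex.norm_intCast]
    exact_mod_cast ArithmeticFunction.abs_moebius_le_one
  set F : ℕ → ℝ → ℂ := fun n y => (x : ℂ) ^ lineAt σ y * LSeries.term μ (lineAt σ y) n with hF
  have hFnorm : ∀ n y, ‖F n y‖ ≤ x ^ σ * (1 / (n : ℝ) ^ σ) := by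
    intro n y
    rw [hF]
    simp only [norm_mul]
    rw [Complex.norm_cpow_eq_rpow_re_of_pos hx0, lineAt_re]
    gcongr
    rw [LSeries.norm_term_eq]
    split_ifs with h0
    · positivity
    · rw [lineAt_re]
      gcongr
      exact hμ1 n
  have hFcont : ∀ n, Continuous (F n) := by
    intro n
    have hl := continuous_lineAt σ
    rcases eq_or_ne n 0 with rfl | hn
    · simp only [hF, LSeries.term_zero, mul_zero]; exact continuous_const
    · simp only [hF, LSeries.term_of_ne_zero hn]
      have hn' : (n : ℂ) ≠ 0 := by exact_mod_cast hn
      exact (hl.const_cpow (.inl hxc)).mul (continuous_const.div (hl.const_cpow (.inl hn'))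
        fun y => by simp [Complex.cpow_eq_zero_iff, hn'])
  have hintg : ∀ n, MeasureTheory.Integrable fun y => F n y * K y := fun n =>
    integrable_perron_kernel hσ.le (hFcont n) (hFnorm n)
  have hsum : Summable fun n => ∫ y : ℝ, ‖F n y * K y‖ := by
    have h1 : Summable fun n : ℕ => x ^ σ * (1 / (n : ℝ) ^ σ) * ∫ y : ℝ, (1 + y ^ 2)⁻¹ :=
      ((Real.summable_one_div_nat_rpow.mpr hσ).mul_left _).mul_right _
    refine Summable.of_nonneg_of_le (fun n => MeasureTheory.integral_nonneg fun y => norm_nonneg _)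
      (fun n => ?_) h1
    rw [← MeasureTheory.integral_const_mul]
    refine MeasureTheory.integral_mono (hintg n).norm (integrable_inv_one_add_sq.const_mul _) ?_
    intro y
    simp only [norm_mul]
    have h := norm_one_div_mul_add_one_le (s := lineAt σ y) (by simpa using hσ.le)
    rw [lineAt_im] at h
    exact mul_le_mul (hFnorm n y) h (norm_nonneg _) (by positivity)
  have hhas := MeasureTheory.hasSum_integral_of_summable_integral_norm hintg hsum
  have htsum : ∀ y, ∑' n, F n y * K y =
      (x : ℂ) ^ lineAt σ y * (riemannZeta (lineAt σ y))⁻¹ * K y := by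
    intro y
    have hre : 1 < (lineAt σ y).re := by simpa using hσ
    rw [tsum_mul_right]
    simp only [hF]
    rw [tsum_mul_left]
    have h1 := ArithmeticFunction.LSeries_zeta_mul_Lseries_moebius hre
    rw [ArithmeticFunction.LSeries_zeta_eq_riemannZeta hre] at h1
    rw [← eq_inv_of_mul_eq_one_right h1]
    rfl
  simp only [htsum] at hhas
  have hterm : ∀ n : ℕ, (1 / (2 * Real.pi) : ℝ) • ∫ y : ℝ, F n y * K y =
      if n ∈ Icc 1 ⌊x⌋₊ then (((ArithmeticFunction.moebius n : ℝ) * (1 - n / x) : ℝ) : ℂ) else 0 := by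
    intro n
    rcases eq_or_ne n 0 with rfl | hn
    · simp [hF]
    · have hn0 : (0 : ℝ) < n := by exact_mod_cast Nat.pos_of_ne_zero hn
      have hF' : ∀ y, F n y * K y = μ n * ((((n : ℝ) / x : ℝ) : ℂ) ^ (-lineAt σ y) * K y) := by
        intro y
        simp only [hF]
        rw [LSeries.term_of_ne_zero hn, Complex.ofReal_div, Complex.div_cpow_ofReal_nonneg hn0.le hx0.le,
          Complex.cpow_neg, Complex.cpow_neg]
        push_cast
        field_simp
      simp only [hF']
      rw [MeasureTheory.integral_const_mul, ← mul_smul_comm,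
        ← tent_eq_integral hσ.le (div_pos hn0 hx0)]
      have hmem : n ∈ Icc 1 ⌊x⌋₊ ↔ (n : ℝ) ≤ x := by
        rw [mem_Icc, Nat.le_floor_iff hx0.le]
        exact ⟨fun h => h.2, fun h => ⟨Nat.pos_of_ne_zero hn, h⟩⟩
      split_ifs with hc
      · have : (n : ℝ) / x ≤ 1 := (div_le_one hx0).mpr (hmem.mp hc)
        rw [max_eq_right (by linarith)]
        simp [hμ]
      · have : 1 ≤ (n : ℝ) / x := (one_le_div hx0).mpr (not_le.mp fun h => hc (hmem.mpr h)).le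
        rw [max_eq_left (by linarith)]
        simp
  have h2 := hhas.const_smul (1 / (2 * Real.pi) : ℝ)
  simp only [hterm] at h2
  rw [← h2.tsum_eq, tsum_eq_sum (s := Icc 1 ⌊x⌋₊) (fun n hn => if_neg hn)]
  push_cast
  refine Finset.sum_congr rfl fun n hn => ?_
  rw [if_pos hn]

lemma norm_one_div_mul_add_one_le_two_mul {s : ℂ} (hs : 1 / 2 ≤ s.re) :
    ‖1 / (s * (s + 1))‖ ≤ 2 * (1 + s.im ^ 2)⁻¹ := by
  have hnn := sq_nonneg s.im
  have h1 : (1 + s.im ^ 2) / 4 ≤ ‖s‖ ^ 2 := by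
    rw [← Complex.normSq_eq_norm_sq, Complex.normSq_apply]; nlinarith
  have h2 : 1 + s.im ^ 2 ≤ ‖s + 1‖ ^ 2 := by
    simp only [← Complex.normSq_eq_norm_sq, Complex.normSq_apply, Complex.add_re, Complex.one_re,
      Complex.add_im, Complex.one_im]; nlinarith
  have h3 : (1 + s.im ^ 2) / 2 ≤ ‖s‖ * ‖s + 1‖ := by
    refine (sq_le_sq₀ (by positivity) (by positivity)).mp ?_
    rw [mul_pow]
    calc ((1 + s.im ^ 2) / 2) ^ 2 = (1 + s.im ^ 2) / 4 * (1 + s.im ^ 2) := by ring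
      _ ≤ _ := mul_le_mul h1 h2 (by positivity) (by positivity)
  rw [norm_div, norm_one, norm_mul, one_div]
  calc (‖s‖ * ‖s + 1‖)⁻¹ ≤ ((1 + s.im ^ 2) / 2)⁻¹ := inv_anti₀ (by positivity) h3
    _ = _ := by field_simp

lemma arctan_le_self {t : ℝ} (ht : 0 ≤ t) : Real.arctan t ≤ t := by
  have h := Real.arctan_mem_Ioo t
  rcases eq_or_lt_of_le ht with rfl | ht0
  · simp
  · have h0 : 0 < Real.arctan t := Real.arctan_pos.mpr ht0
    simpa [Real.tan_arctan] using (Real.lt_tan h0 h.2).le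

lemma integral_Ioi_inv_one_add_sq_le {T : ℝ} (hT : 0 < T) :
    ∫ y in Set.Ioi T, (1 + y ^ 2)⁻¹ ≤ T⁻¹ := by
  rw [integral_Ioi_inv_one_add_sq, ← Real.arctan_inv_of_pos hT]
  exact arctan_le_self (by positivity)

lemma integral_Iic_inv_one_add_sq_le {T : ℝ} (hT : 0 < T) :
    ∫ y in Set.Iic (-T), (1 + y ^ 2)⁻¹ ≤ T⁻¹ := by
  rw [integral_Iic_inv_one_add_sq, Real.arctan_neg, neg_add_eq_sub, ← Real.arctan_inv_of_pos hT]
  exact arctan_le_self (by positivity)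

/-- Moving a vertical line integral to the left across a rectangle of holomorphy. -/
lemma norm_integral_lineAt_le {F : ℂ → ℂ} {a σ T B H V : ℝ} (haσ : a ≤ σ) (hT : 0 < T)
    (hF : DifferentiableOn ℂ F (Set.uIcc a σ ×ℂ Set.uIcc (-T) T))
    (hintg : MeasureTheory.Integrable fun y => F (lineAt σ y))
    (hB : ∀ y, ‖F (lineAt σ y)‖ ≤ B * (1 + y ^ 2)⁻¹)
    (hH : ∀ s : ℂ, a ≤ s.re → s.re ≤ σ → |s.im| = T → ‖F s‖ ≤ H)
    (hV : ∀ s : ℂ, s.re = a → |s.im| ≤ T → ‖F s‖ ≤ V) :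
    ‖∫ y, F (lineAt σ y)‖ ≤ 2 * B / T + 2 * (σ - a) * H + 2 * T * V := by
  have hB0 : 0 ≤ B := by simpa using (norm_nonneg _).trans (hB 0)
  have hrect := Complex.integral_boundary_rect_eq_zero_of_differentiableOn F
    (lineAt a (-T)) (lineAt σ T) (by simpa using hF)
  simp only [lineAt_re, lineAt_im] at hrect
  have hsplit : ∫ y, F (lineAt σ y) = (∫ y in Set.Iic (-T), F (lineAt σ y)) +
      (∫ y in (-T)..T, F (lineAt σ y)) + ∫ y in Set.Ioi T, F (lineAt σ y) := by
    rw [← intervalIntegral.integral_Iic_add_Ioi (b := T) hintg.integrableOn hintg.integrableOn,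
      ← intervalIntegral.integral_Iic_sub_Iic (a := -T) (b := T) hintg.integrableOn hintg.integrableOn]
    ring
  have htail1 : ‖∫ y in Set.Ioi T, F (lineAt σ y)‖ ≤ B * T⁻¹ := by
    refine (MeasureTheory.norm_integral_le_of_norm_le
      (integrable_inv_one_add_sq.integrableOn.const_mul B) (.of_forall hB)).trans ?_
    rw [MeasureTheory.integral_const_mul]
    exact mul_le_mul_of_nonneg_left (integral_Ioi_inv_one_add_sq_le hT) hB0
  have htail2 : ‖∫ y in Set.Iic (-T), F (lineAt σ y)‖ ≤ B * T⁻¹ := by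
    refine (MeasureTheory.norm_integral_le_of_norm_le
      (integrable_inv_one_add_sq.integrableOn.const_mul B) (.of_forall hB)).trans ?_
    rw [MeasureTheory.integral_const_mul]
    exact mul_le_mul_of_nonneg_left (integral_Iic_inv_one_add_sq_le hT) hB0
  have hhor : ∀ τ : ℝ, |τ| = T → ‖∫ x in a..σ, F (x + τ * Complex.I)‖ ≤ H * (σ - a) := by
    intro τ hτ
    have := intervalIntegral.norm_integral_le_of_norm_le_const (a := a) (b := σ) (C := H)
      (f := fun x : ℝ => F (x + τ * Complex.I)) (fun x hx => by
        rw [Set.uIoc_of_le haσ] at hx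
        exact hH _ (by simpa using hx.1.le) (by simpa using hx.2) (by simpa using hτ))
    rwa [abs_of_nonneg (sub_nonneg.mpr haσ)] at this
  have hver : ‖∫ y in (-T)..T, F (a + y * Complex.I)‖ ≤ V * (2 * T) := by
    have := intervalIntegral.norm_integral_le_of_norm_le_const (a := -T) (b := T) (C := V)
      (f := fun y : ℝ => F (a + y * Complex.I)) (fun y hy => by
        rw [Set.uIoc_of_le (by linarith)] at hy
        exact hV _ (by simp) (by simpa [abs_le] using ⟨hy.1.le, hy.2⟩))
    rwa [sub_neg_eq_add, ← two_mul, abs_of_pos (by linarith : (0 : ℝ) < 2 * T)] at this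
  have hmid : ‖∫ y in (-T)..T, F (lineAt σ y)‖ ≤ 2 * (H * (σ - a)) + V * (2 * T) := by
    have hI : (∫ y in (-T)..T, F (lineAt σ y)) = Complex.I *
        ((∫ x in a..σ, F (x + (-T : ℝ) * Complex.I)) - ∫ x in a..σ, F (x + T * Complex.I)) +
        ∫ y in (-T)..T, F (a + y * Complex.I) := by
      simp only [smul_eq_mul] at hrect
      have h2 := congrArg (fun z => Complex.I * z) hrect
      simp only [mul_zero] at h2
      have hII : ∀ z : ℂ, Complex.I * (Complex.I * z) = -z := fun z => by
        rw [← mul_assoc, Complex.I_mul_I, neg_one_mul]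
      simp only [mul_add, mul_sub, hII] at h2
      simp only [lineAt, mul_sub]
      linear_combination -h2
    rw [hI]
    refine (norm_add_le _ _).trans (add_le_add ?_ hver)
    rw [norm_mul, Complex.norm_I, one_mul]
    refine (norm_sub_le _ _).trans ?_
    have h1 := hhor (-T) (by rw [abs_neg, abs_of_pos hT])
    have h2 := hhor T (abs_of_pos hT)
    linarith
  rw [hsplit]
  refine (norm_add₃_le).trans ?_
  have : 2 * B / T = B * T⁻¹ + B * T⁻¹ := by ring
  linarith

/-- The integrand of Perron's formula for the Möbius function. -/
noncomputable def perronIntegrand (x : ℝ) (s : ℂ) : ℂ :=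
  (x : ℂ) ^ s * ((s - 1) / riemannZeta₁ s) * (1 / (s * (s + 1)))

lemma perronIntegrand_of_one_lt_re (x : ℝ) {s : ℂ} (hs : 1 < s.re) :
    perronIntegrand x s = (x : ℂ) ^ s * (riemannZeta s)⁻¹ * (1 / (s * (s + 1))) := by
  have h1 : s ≠ 1 := fun h => by simp [h] at hs
  have h2 : s - 1 ≠ 0 := sub_ne_zero.mpr h1
  rw [perronIntegrand, riemannZeta₁_eq_sub_one_mul h1, div_mul_cancel_left₀ h2]

lemma norm_perronIntegrand_le {x M : ℝ} (hx : 0 < x) {s : ℂ} (hs : 1 / 2 ≤ s.re)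
    (hM : ‖(s - 1) / riemannZeta₁ s‖ ≤ M) :
    ‖perronIntegrand x s‖ ≤ x ^ s.re * M * (2 * (1 + s.im ^ 2)⁻¹) := by
  rw [perronIntegrand, norm_mul, norm_mul, Complex.norm_cpow_eq_rpow_re_of_pos hx]
  have h := norm_one_div_mul_add_one_le_two_mul hs
  have hM0 : 0 ≤ M := (norm_nonneg _).trans hM
  gcongr

lemma one_le_log_of_three_le {x : ℝ} (hx : 3 ≤ x) : 1 ≤ Real.log x := by
  rw [Real.le_log_iff_exp_le (by linarith)]
  linarith [Real.exp_one_lt_d9]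

lemma rpow_one_add_inv_log {x : ℝ} (hx : 3 ≤ x) :
    x ^ (1 + 1 / Real.log x) = x * Real.exp 1 := by
  have hL := one_le_log_of_three_le hx
  rw [Real.rpow_add (by linarith), Real.rpow_one, Real.rpow_def_of_pos (by linarith) (1 / _),
    mul_one_div_cancel (by linarith)]

set_option maxHeartbeats 800000 in
/-- A bound for the weighted sums of the Möbius function, with a free parameter `l`. -/
lemma exists_abs_sum_moebius_weighted_le :
    ∃ c : ℝ, 0 < c ∧ ∃ A : ℕ, ∃ l₀ : ℝ, 10 ≤ l₀ ∧ ∃ C : ℝ, 0 < C ∧ ∀ l, l₀ ≤ l → ∀ x : ℝ, 3 ≤ x →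
      |∑ n ∈ Icc 1 ⌊x⌋₊, (ArithmeticFunction.moebius n : ℝ) * (1 - n / x)| ≤
        C * x * ((Real.log x + l ^ A) * (Real.exp (-l) + Real.exp l *
          Real.exp (-(c / (l ^ (2 / 3 : ℝ) * Real.log l ^ (1 / 3 : ℝ))) * Real.log x))) := by
  obtain ⟨c, hc, A, l₀, hl₀, hbound⟩ := exists_norm_sub_one_div_riemannZeta₁_le
  obtain ⟨C₀, hC₀, hzeta⟩ := exists_riemannZeta_real_bounds
  refine ⟨min c (1 / 2), by positivity, A, l₀, hl₀, 54 * C₀, by positivity, fun l hl x hx => ?_⟩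
  have hx0 : 0 < x := by linarith
  have hl10 : 10 ≤ l := hl₀.trans hl
  have hL := one_le_log_of_three_le hx
  have hlogl : 1 ≤ Real.log l := one_le_log_of_three_le (by linarith)
  set D := l ^ (2 / 3 : ℝ) * Real.log l ^ (1 / 3 : ℝ) with hD
  have hD1 : 1 ≤ D := one_le_mul_of_one_le_of_one_le
    (Real.one_le_rpow (by linarith) (by norm_num)) (Real.one_le_rpow hlogl (by norm_num))
  set δ := min c (1 / 2) / D with hδ
  have hδ0 : 0 ≤ δ := by positivity
  have hδ2 : δ ≤ 1 / 2 := (div_le_self (by positivity) hD1).trans (min_le_right _ _)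
  have hδc : δ ≤ c / D := div_le_div_of_nonneg_right (min_le_left _ _) (by linarith)
  set σ := 1 + 1 / Real.log x with hσdef
  have hinvL : 0 < 1 / Real.log x := by positivity
  have hσ1 : 1 < σ := by linarith
  have hσ2 : σ ≤ 2 := by
    have : 1 / Real.log x ≤ 1 := by rw [div_le_one (by linarith)]; exact hL
    linarith
  set T := Real.exp l / 3 with hTdef
  have hT1 : 1 ≤ T := by
    have := Real.add_one_le_exp l
    rw [hTdef]; linarith
  have hT0 : 0 < T := by linarith
  have hxσ : x ^ σ = x * Real.exp 1 := rpow_one_add_inv_log hx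
  have he : Real.exp 1 ≤ 3 := by linarith [Real.exp_one_lt_d9]
  have hxσ3 : x ^ σ ≤ 3 * x := by rw [hxσ, mul_comm]; gcongr
  have hregion : ∀ s : ℂ, 1 - δ ≤ s.re → s.re ≤ σ → |s.im| ≤ T →
      riemannZeta₁ s ≠ 0 ∧ ‖(s - 1) / riemannZeta₁ s‖ ≤ l ^ A := fun s h1 h2 h3 =>
    hbound l hl s h3 (by linarith) (by linarith)
  have hlA : 0 ≤ l ^ A := by positivity
  have hζσ : ‖riemannZeta σ‖ ≤ C₀ * Real.log x := by
    have h := (hzeta σ hσ1 hσ2).1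
    rw [hσdef, add_sub_cancel_left, div_div_eq_mul_div, div_one] at h
    rw [hσdef]; exact h
  have hline : ∀ y, ‖perronIntegrand x (lineAt σ y)‖ ≤
      (3 * x * (C₀ * Real.log x)) * (1 + y ^ 2)⁻¹ := by
    intro y
    have hre : 1 < (lineAt σ y).re := by simpa using hσ1
    rw [perronIntegrand_of_one_lt_re x hre, norm_mul, norm_mul,
      Complex.norm_cpow_eq_rpow_re_of_pos hx0, lineAt_re]
    have h1 := norm_one_div_mul_add_one_le hre.le
    have h2 := norm_inv_riemannZeta_le hre
    rw [lineAt_im] at h1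
    rw [lineAt_re] at h2
    have h3 := h2.trans hζσ
    gcongr
  have hne : ∀ s : ℂ, 1 / 2 ≤ s.re → s * (s + 1) ≠ 0 := fun s hs => by
    refine mul_ne_zero (fun h => ?_) (fun h => ?_)
    · simp [h] at hs; linarith
    · have := congrArg Complex.re h
      simp at this; linarith
  have hdiff : ∀ s : ℂ, 1 / 2 ≤ s.re → riemannZeta₁ s ≠ 0 →
      DifferentiableAt ℂ (perronIntegrand x) s := fun s hs hz => by
    have hxc : (x : ℂ) ≠ 0 := by exact_mod_cast hx0.ne'
    refine ((differentiableAt_id.const_cpow (.inl hxc)).mul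
      ((differentiableAt_id.sub_const 1).div differentiable_riemannZeta₁.differentiableAt hz)).mul
      ((differentiableAt_const _).div (differentiableAt_id.mul (differentiableAt_id.add_const 1))
        (hne s hs))
  have hcont : Continuous fun y => perronIntegrand x (lineAt σ y) := by
    refine continuous_iff_continuousAt.mpr fun y => ?_
    refine ContinuousAt.comp (f := lineAt σ) (g := perronIntegrand x) ?_
      (continuous_lineAt σ).continuousAt
    exact (hdiff _ (by rw [lineAt_re]; linarith)
      (riemannZeta₁_ne_zero_of_one_le_re (by rw [lineAt_re]; exact hσ1.le))).continuousAt
  have hkey := norm_integral_lineAt_le (F := perronIntegrand x) (a := 1 - δ) (σ := σ) (T := T)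
    (B := 3 * x * (C₀ * Real.log x)) (H := 3 * x * l ^ A * (2 * T⁻¹))
    (V := x ^ (1 - δ) * l ^ A * 2) (by linarith) hT0
    (fun s hs => by
      rw [Set.uIcc_of_le (by linarith), Set.uIcc_of_le (by linarith), Complex.mem_reProdIm] at hs
      exact (hdiff s (by linarith [hs.1.1])
        (hregion s hs.1.1 hs.1.2 (abs_le.mpr hs.2)).1).differentiableWithinAt)
    ((integrable_inv_one_add_sq.const_mul _).mono' hcont.aestronglyMeasurable (.of_forall hline))
    hline
    (fun s h1 h2 h3 => by
      refine (norm_perronIntegrand_le hx0 (by linarith) (hregion s h1 h2 h3.le).2).trans ?_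
      have h4 : x ^ s.re ≤ 3 * x :=
        (Real.rpow_le_rpow_of_exponent_le (by linarith) h2).trans hxσ3
      have h5 : (1 + s.im ^ 2)⁻¹ ≤ T⁻¹ := by
        rw [← sq_abs, h3]
        exact inv_anti₀ hT0 (by nlinarith)
      gcongr)
    (fun s h1 h2 => by
      refine (norm_perronIntegrand_le hx0 (by linarith)
        (hregion s h1.ge (by linarith) h2).2).trans ?_
      rw [h1]
      have h5 : (1 + s.im ^ 2)⁻¹ ≤ 1 := inv_le_one_of_one_le₀ (by nlinarith [sq_nonneg s.im])
      have h6 : 0 ≤ x ^ (1 - δ) * l ^ A := by positivity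
      nlinarith)
  have hperron := sum_moebius_weighted_eq_integral (σ := σ) (x := x) hσ1 (by linarith)
  have hcongr : (fun y : ℝ => (x : ℂ) ^ lineAt σ y * (riemannZeta (lineAt σ y))⁻¹ *
      (1 / (lineAt σ y * (lineAt σ y + 1)))) = fun y => perronIntegrand x (lineAt σ y) := by
    funext y
    rw [perronIntegrand_of_one_lt_re x (by simpa using hσ1)]
  rw [hcongr] at hperron
  have hnorm := congrArg norm hperron
  rw [Complex.norm_real, norm_smul, Real.norm_eq_abs, Real.norm_eq_abs] at hnorm
  rw [hnorm]
  have hpi : |1 / (2 * Real.pi)| ≤ 1 := by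
    rw [abs_of_pos (by positivity), div_le_one (by positivity)]
    linarith [Real.pi_gt_three]
  refine (mul_le_of_le_one_left (norm_nonneg _) hpi).trans (hkey.trans ?_)
  have hTinv : T⁻¹ = 3 * Real.exp (-l) := by
    rw [hTdef, Real.exp_neg, inv_div]; rfl
  have hxa : x ^ (1 - δ) = x * Real.exp (-δ * Real.log x) := by
    rw [sub_eq_add_neg, Real.rpow_add hx0, Real.rpow_one, Real.rpow_def_of_pos hx0, mul_comm (-δ)]
  rw [div_eq_mul_inv, hTinv, hxa, hTdef]
  set E₁ := Real.exp (-l)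
  set E₂ := Real.exp (-δ * Real.log x)
  have hE₁ : 0 < E₁ := Real.exp_pos _
  have hE₂ : 0 < E₂ := Real.exp_pos _
  have hEl : 0 < Real.exp l := Real.exp_pos _
  have h1 : 2 * (σ - (1 - δ)) * (3 * x * l ^ A * (2 * (3 * E₁))) ≤
      54 * C₀ * (x * l ^ A * E₁) := by
    have : σ - (1 - δ) ≤ 3 / 2 := by linarith
    calc _ = (σ - (1 - δ)) * 36 * (x * l ^ A * E₁) := by ring
      _ ≤ _ := mul_le_mul_of_nonneg_right (by linarith) (by positivity)
  have h2 : 2 * (3 * x * (C₀ * Real.log x)) * (3 * E₁) ≤ 54 * C₀ * (x * Real.log x * E₁) := by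
    have : 0 ≤ C₀ * (x * Real.log x * E₁) := by positivity
    nlinarith
  have h3 : 2 * (Real.exp l / 3) * (x * E₂ * l ^ A * 2) ≤
      54 * C₀ * (x * l ^ A * (Real.exp l * E₂)) := by
    calc _ = 4 / 3 * (x * l ^ A * (Real.exp l * E₂)) := by ring
      _ ≤ _ := by gcongr; linarith
  have h4 : 0 ≤ 54 * C₀ * (x * Real.log x * (Real.exp l * E₂)) := by positivity
  calc _ ≤ 54 * C₀ * (x * Real.log x * E₁) + 54 * C₀ * (x * l ^ A * E₁) +
        54 * C₀ * (x * l ^ A * (Real.exp l * E₂)) +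
        54 * C₀ * (x * Real.log x * (Real.exp l * E₂)) := by linarith
    _ = _ := by ring

/-- The Vinogradov–Korobov exponent `(log x)^{3/5} (log log x)^{-1/5}`. -/
noncomputable def vkExp (x : ℝ) : ℝ :=
  Real.log x ^ (3 / 5 : ℝ) / Real.log (Real.log x) ^ (1 / 5 : ℝ)

lemma exp_one_le_log {x : ℝ} (hx : 16 ≤ x) : Real.exp 1 ≤ Real.log x := by
  have h1 : Real.log 16 ≤ Real.log x := Real.log_le_log (by norm_num) hx
  have h2 : Real.log 16 = 4 * Real.log 2 := by
    rw [show (16 : ℝ) = 2 ^ 4 by norm_num, Real.log_pow]; norm_num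
  linarith [Real.log_two_gt_d9, Real.exp_one_lt_d9]

lemma one_le_log_log {x : ℝ} (hx : 16 ≤ x) : 1 ≤ Real.log (Real.log x) := by
  have h := exp_one_le_log hx
  rwa [Real.le_log_iff_exp_le ((Real.exp_pos 1).trans_le h)]

lemma one_le_log_of_le {x : ℝ} (hx : 16 ≤ x) : 1 ≤ Real.log x :=
  one_le_log_of_three_le (by linarith)

lemma vkExp_eq {x : ℝ} (hx : 16 ≤ x) :
    vkExp x = (Real.log x ^ 3 / Real.log (Real.log x)) ^ (1 / 5 : ℝ) := by
  have hL := one_le_log_of_le hx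
  have hΛ := one_le_log_log hx
  rw [vkExp, Real.div_rpow (by positivity) (by positivity), ← Real.rpow_natCast (Real.log x) 3,
    ← Real.rpow_mul (by positivity)]
  norm_num

lemma vkExp_mono {x y : ℝ} (hx : 16 ≤ x) (hxy : x ≤ y) : vkExp x ≤ vkExp y := by
  have hy : 16 ≤ y := hx.trans hxy
  rw [vkExp_eq hx, vkExp_eq hy]
  have hL := one_le_log_of_le hx
  have hΛ := one_le_log_log hx
  have hΛ2 := one_le_log_log hy
  have hLL : Real.log x ≤ Real.log y := Real.log_le_log (by linarith) hxy
  refine Real.rpow_le_rpow (by positivity) ?_ (by norm_num)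
  rw [div_le_div_iff₀ (by linarith) (by linarith)]
  set r := Real.log y / Real.log x with hr
  have hr1 : 1 ≤ r := (one_le_div (by linarith)).mpr hLL
  have hyr : Real.log y = r * Real.log x := by rw [hr, div_mul_cancel₀ _ (by linarith)]
  have hlog : Real.log (Real.log y) ≤ r * Real.log (Real.log x) := by
    rw [hyr, Real.log_mul (by linarith) (by linarith)]
    nlinarith [Real.log_le_sub_one_of_pos (by linarith : 0 < r)]
  have hr3 : r ≤ r ^ 3 := le_self_pow₀ hr1 (by norm_num)
  calc Real.log x ^ 3 * Real.log (Real.log y)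
      ≤ Real.log x ^ 3 * (r ^ 3 * Real.log (Real.log x)) := by
        gcongr
        exact hlog.trans (by gcongr)
    _ = Real.log y ^ 3 * Real.log (Real.log x) := by rw [hyr]; ring

lemma vkExp_le_log {x : ℝ} (hx : 16 ≤ x) : vkExp x ≤ Real.log x := by
  have hL := one_le_log_of_le hx
  have hΛ := one_le_log_log hx
  rw [vkExp]
  refine (div_le_self (by positivity) (Real.one_le_rpow hΛ (by norm_num))).trans ?_
  calc _ ≤ Real.log x ^ (1 : ℝ) := Real.rpow_le_rpow_of_exponent_le hL (by norm_num)
    _ = _ := Real.rpow_one _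

lemma log_rpow_le_vkExp {x : ℝ} (hx : 16 ≤ x) : Real.log x ^ (2 / 5 : ℝ) ≤ vkExp x := by
  have hL := one_le_log_of_le hx
  have hΛ := one_le_log_log hx
  have hΛL : Real.log (Real.log x) ≤ Real.log x := Real.log_le_self (by linarith)
  rw [vkExp, le_div_iff₀ (by positivity)]
  calc _ ≤ Real.log x ^ (2 / 5 : ℝ) * Real.log x ^ (1 / 5 : ℝ) := by gcongr
    _ = _ := by rw [← Real.rpow_add (by linarith)]; norm_num

lemma one_le_vkExp {x : ℝ} (hx : 16 ≤ x) : 1 ≤ vkExp x :=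
  (Real.one_le_rpow (one_le_log_of_le hx) (by norm_num)).trans (log_rpow_le_vkExp hx)

lemma log_le_vkExp_pow_three {x : ℝ} (hx : 16 ≤ x) : Real.log x ≤ vkExp x ^ 3 := by
  have hL := one_le_log_of_le hx
  calc Real.log x = Real.log x ^ (1 : ℝ) := (Real.rpow_one _).symm
    _ ≤ Real.log x ^ (2 / 5 * 3 : ℝ) := Real.rpow_le_rpow_of_exponent_le hL (by norm_num)
    _ = (Real.log x ^ (2 / 5 : ℝ)) ^ 3 := by
        rw [Real.rpow_mul (by linarith)]; norm_cast
    _ ≤ vkExp x ^ 3 := by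
        have := log_rpow_le_vkExp hx
        gcongr

lemma pow_le_mul_exp_half {l : ℝ} (hl : 0 ≤ l) (m : ℕ) :
    l ^ m ≤ 2 ^ m * m.factorial * Real.exp (l / 2) := by
  have h := Real.pow_div_factorial_le_exp (l / 2) (by linarith) m
  rw [div_pow, div_div, div_le_iff₀ (by positivity)] at h
  linarith

/-- With `l` a small multiple of the Vinogradov–Korobov exponent, the width of the zero-free region
beats the height. -/
lemma two_mul_le_width_mul_log {c c' x : ℝ} (hc' : 0 < c') (hc'1 : c' ≤ 1) (hcc : 2 * c' ≤ c)
    (hx : 16 ≤ x) (hl : 3 ≤ c' * vkExp x) :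
    2 * (c' * vkExp x) ≤ c / ((c' * vkExp x) ^ (2 / 3 : ℝ) *
      Real.log (c' * vkExp x) ^ (1 / 3 : ℝ)) * Real.log x := by
  have hL := one_le_log_of_le hx
  have hΛ := one_le_log_log hx
  have hY := one_le_vkExp hx
  have hlY : c' * vkExp x ≤ vkExp x := mul_le_of_le_one_left (by linarith) hc'1
  have hlogl : 1 ≤ Real.log (c' * vkExp x) := one_le_log_of_three_le hl
  have hlogle : Real.log (c' * vkExp x) ≤ Real.log (Real.log x) :=
    Real.log_le_log (by linarith) (hlY.trans (vkExp_le_log hx))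
  have hD : (c' * vkExp x) ^ (2 / 3 : ℝ) * Real.log (c' * vkExp x) ^ (1 / 3 : ℝ) ≤
      vkExp x ^ (2 / 3 : ℝ) * Real.log (Real.log x) ^ (1 / 3 : ℝ) := by gcongr
  have hD0 : 0 < (c' * vkExp x) ^ (2 / 3 : ℝ) * Real.log (c' * vkExp x) ^ (1 / 3 : ℝ) := by
    have : 0 < c' * vkExp x := by linarith
    positivity
  have hYD : vkExp x * (vkExp x ^ (2 / 3 : ℝ) * Real.log (Real.log x) ^ (1 / 3 : ℝ)) =
      Real.log x := by
    rw [← mul_assoc]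
    nth_rewrite 1 [← Real.rpow_one (vkExp x)]
    rw [← Real.rpow_add (by linarith), vkExp_eq hx, ← Real.rpow_mul (by positivity),
      Real.div_rpow (by positivity) (by positivity), ← Real.rpow_natCast (Real.log x) 3,
      ← Real.rpow_mul (by positivity)]
    norm_num
    exact div_mul_cancel₀ _ (by positivity)
  rw [div_mul_eq_mul_div, le_div_iff₀ hD0]
  calc 2 * (c' * vkExp x) * ((c' * vkExp x) ^ (2 / 3 : ℝ) *
        Real.log (c' * vkExp x) ^ (1 / 3 : ℝ))
      ≤ 2 * (c' * vkExp x) * (vkExp x ^ (2 / 3 : ℝ) * Real.log (Real.log x) ^ (1 / 3 : ℝ)) := by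
        gcongr
    _ = 2 * c' * (vkExp x *
        (vkExp x ^ (2 / 3 : ℝ) * Real.log (Real.log x) ^ (1 / 3 : ℝ))) := by ring
    _ = 2 * c' * Real.log x := by rw [hYD]
    _ ≤ c * Real.log x := by gcongr

lemma abs_moebius_real_le_one (n : ℕ) : |(ArithmeticFunction.moebius n : ℝ)| ≤ 1 := by
  exact_mod_cast ArithmeticFunction.abs_moebius_le_one

/-- The weighted sums of the Möbius function with the Vinogradov–Korobov error term. -/
lemma exists_abs_sum_moebius_weighted_le_exp : ∃ c : ℝ, 0 < c ∧ ∃ C : ℝ, 0 < C ∧ ∀ x : ℝ, 16 ≤ x →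
    |∑ n ∈ Icc 1 ⌊x⌋₊, (ArithmeticFunction.moebius n : ℝ) * (1 - n / x)| ≤
      C * x * Real.exp (-c * vkExp x) := by
  obtain ⟨c, hc, A, l₀, hl₀, C, hC, hmain⟩ := exists_abs_sum_moebius_weighted_le
  set c' := min 1 (c / 2) with hc'def
  have hc' : 0 < c' := by positivity
  have hc'1 : c' ≤ 1 := min_le_left _ _
  have hcc : 2 * c' ≤ c := by linarith [min_le_right 1 (c / 2)]
  set m := A + 3
  set K := (c'⁻¹ ^ 3 + 1) * (2 ^ m * m.factorial) with hK
  have hK0 : 0 < K := by positivity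
  refine ⟨c' / 2, by positivity, max (2 * C * K) (Real.exp l₀), by positivity, fun x hx => ?_⟩
  have hx0 : 0 < x := by linarith
  have hY := one_le_vkExp hx
  set l := c' * vkExp x with hl
  have hl0 : 0 < l := by positivity
  have hexp : -(c' / 2) * vkExp x = -(l / 2) := by rw [hl]; ring
  rw [hexp]
  rcases le_total l₀ l with hll | hll
  · refine (hmain l hll x (by linarith)).trans ?_
    have hwidth := two_mul_le_width_mul_log hc' hc'1 hcc hx (by linarith)
    rw [← hl] at hwidth
    have h1 : Real.exp l *
        Real.exp (-(c / (l ^ (2 / 3 : ℝ) * Real.log l ^ (1 / 3 : ℝ))) * Real.log x) ≤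
        Real.exp (-l) := by
      rw [← Real.exp_add]
      apply Real.exp_le_exp.mpr
      linarith
    have hl1 : 1 ≤ l := by linarith
    have h2 : Real.log x + l ^ A ≤ K * Real.exp (l / 2) := by
      have h3 : Real.log x ≤ c'⁻¹ ^ 3 * l ^ 3 := by
        rw [← mul_pow, hl, inv_mul_cancel_left₀ hc'.ne']
        exact log_le_vkExp_pow_three hx
      have h4 : l ^ 3 ≤ l ^ m := pow_le_pow_right₀ hl1 (by omega)
      have h5 : l ^ A ≤ l ^ m := pow_le_pow_right₀ hl1 (by omega)
      calc Real.log x + l ^ A ≤ c'⁻¹ ^ 3 * l ^ m + l ^ m := add_le_add (h3.trans (by gcongr)) h5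
        _ = (c'⁻¹ ^ 3 + 1) * l ^ m := by ring
        _ ≤ (c'⁻¹ ^ 3 + 1) * (2 ^ m * m.factorial * Real.exp (l / 2)) := by
          gcongr; exact pow_le_mul_exp_half hl0.le m
        _ = _ := by rw [hK]; ring
    have h6 : Real.exp (l / 2) * Real.exp (-l) = Real.exp (-(l / 2)) := by
      rw [← Real.exp_add]; ring_nf
    calc _ ≤ C * x * ((K * Real.exp (l / 2)) * (Real.exp (-l) + Real.exp (-l))) := by gcongr
      _ = 2 * C * K * x * (Real.exp (l / 2) * Real.exp (-l)) := by ring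
      _ ≤ _ := by
        rw [h6]; gcongr; exact le_max_left _ _
  · have hsum : |∑ n ∈ Icc 1 ⌊x⌋₊, (ArithmeticFunction.moebius n : ℝ) * (1 - n / x)| ≤ x := by
      refine (abs_sum_le_sum_abs _ _).trans ?_
      calc _ ≤ ∑ n ∈ Icc 1 ⌊x⌋₊, (1 : ℝ) := by
            refine sum_le_sum fun n hn => ?_
            have hnx : (n : ℝ) ≤ x := (Nat.le_floor_iff hx0.le).mp (mem_Icc.mp hn).2
            have h1 : (n : ℝ) / x ≤ 1 := (div_le_one hx0).mpr hnx
            have h2 : 0 ≤ (n : ℝ) / x := by positivity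
            rw [abs_mul, abs_of_nonneg (by linarith : 0 ≤ 1 - (n : ℝ) / x)]
            exact mul_le_one₀ (abs_moebius_real_le_one n) (by linarith) (by linarith)
        _ = (⌊x⌋₊ : ℝ) := by simp
        _ ≤ x := Nat.floor_le hx0.le
    refine hsum.trans ?_
    have h1 : 1 ≤ Real.exp l₀ * Real.exp (-(l / 2)) := by
      rw [← Real.exp_add]; exact Real.one_le_exp (by linarith)
    calc x ≤ x * (Real.exp l₀ * Real.exp (-(l / 2))) := le_mul_of_one_le_right hx0.le h1
      _ = Real.exp l₀ * x * Real.exp (-(l / 2)) := by ring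
      _ ≤ _ := by gcongr; exact le_max_right _ _

/-- The Mertens function at a real argument. -/
noncomputable def mertens (x : ℝ) : ℝ := ∑ n ∈ Icc 1 ⌊x⌋₊, (ArithmeticFunction.moebius n : ℝ)

lemma abs_mertens_le {x : ℝ} (hx : 0 ≤ x) : |mertens x| ≤ x := by
  refine (abs_sum_le_sum_abs _ _).trans ?_
  calc _ ≤ ∑ n ∈ Icc 1 ⌊x⌋₊, (1 : ℝ) := sum_le_sum fun n _ => abs_moebius_real_le_one n
    _ = (⌊x⌋₊ : ℝ) := by simp
    _ ≤ x := Nat.floor_le hx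

lemma sum_moebius_mul_sub_eq {x : ℝ} (hx : 0 < x) :
    ∑ n ∈ Icc 1 ⌊x⌋₊, (ArithmeticFunction.moebius n : ℝ) * (x - n) =
      x * ∑ n ∈ Icc 1 ⌊x⌋₊, (ArithmeticFunction.moebius n : ℝ) * (1 - n / x) := by
  rw [mul_sum]
  refine sum_congr rfl fun n _ => ?_
  field_simp

lemma abs_mul_mertens_le {x h : ℝ} (hx : 0 ≤ x) (hh : 0 < h) :
    h * |mertens x| ≤
      |∑ n ∈ Icc 1 ⌊x + h⌋₊, (ArithmeticFunction.moebius n : ℝ) * (x + h - n)| +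
      |∑ n ∈ Icc 1 ⌊x⌋₊, (ArithmeticFunction.moebius n : ℝ) * (x - n)| + h * (h + 1) := by
  have hfl : ⌊x⌋₊ ≤ ⌊x + h⌋₊ := Nat.floor_le_floor (by linarith)
  have hsplit : ∑ n ∈ Icc 1 ⌊x + h⌋₊, (ArithmeticFunction.moebius n : ℝ) * (x + h - n) =
      ∑ n ∈ Icc 1 ⌊x⌋₊, (ArithmeticFunction.moebius n : ℝ) * (x + h - n) +
      ∑ n ∈ Ioc ⌊x⌋₊ ⌊x + h⌋₊, (ArithmeticFunction.moebius n : ℝ) * (x + h - n) := by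
    have hI : ∀ N : ℕ, Icc 1 N = Ioc 0 N := fun N => Icc_add_one_left_eq_Ioc 0 N
    rw [hI, hI, sum_Ioc_consecutive _ (Nat.zero_le _) hfl]
  have hlin : ∑ n ∈ Icc 1 ⌊x⌋₊, (ArithmeticFunction.moebius n : ℝ) * (x + h - n) =
      ∑ n ∈ Icc 1 ⌊x⌋₊, (ArithmeticFunction.moebius n : ℝ) * (x - n) + h * mertens x := by
    rw [mertens, mul_sum, ← sum_add_distrib]
    exact sum_congr rfl fun n _ => by ring
  have hrest : |∑ n ∈ Ioc ⌊x⌋₊ ⌊x + h⌋₊, (ArithmeticFunction.moebius n : ℝ) * (x + h - n)| ≤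
      h * (h + 1) := by
    refine (abs_sum_le_sum_abs _ _).trans ?_
    calc _ ≤ ∑ n ∈ Ioc ⌊x⌋₊ ⌊x + h⌋₊, h := by
          refine sum_le_sum fun n hn => ?_
          rw [mem_Ioc] at hn
          have h1 : x ≤ n := ((Nat.floor_lt hx).mp hn.1).le
          have h2 : (n : ℝ) ≤ x + h := (Nat.le_floor_iff (by linarith)).mp hn.2
          rw [abs_mul, abs_of_nonneg (by linarith : 0 ≤ x + h - n)]
          calc _ ≤ 1 * (x + h - n) :=
                mul_le_mul_of_nonneg_right (abs_moebius_real_le_one n) (by linarith)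
            _ ≤ h := by linarith
      _ = ((⌊x + h⌋₊ : ℝ) - ⌊x⌋₊) * h := by
          rw [sum_const, Nat.card_Ioc, nsmul_eq_mul, Nat.cast_sub hfl]
      _ ≤ (h + 1) * h := by
          have h1 := Nat.floor_le (by linarith : 0 ≤ x + h)
          have h2 := Nat.lt_floor_add_one x
          gcongr; linarith
      _ = h * (h + 1) := mul_comm _ _
  have hid : h * mertens x =
      (∑ n ∈ Icc 1 ⌊x + h⌋₊, (ArithmeticFunction.moebius n : ℝ) * (x + h - n)) -
      (∑ n ∈ Icc 1 ⌊x⌋₊, (ArithmeticFunction.moebius n : ℝ) * (x - n)) -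
      ∑ n ∈ Ioc ⌊x⌋₊ ⌊x + h⌋₊, (ArithmeticFunction.moebius n : ℝ) * (x + h - n) := by
    rw [hsplit, hlin]; ring
  rw [← abs_of_pos hh, ← abs_mul, abs_of_pos hh, hid]
  refine (abs_sub _ _).trans (add_le_add (abs_sub _ _) hrest)

/-- The Vinogradov–Korobov bound for the Mertens function. -/
theorem exists_abs_mertens_le : ∃ c : ℝ, 0 < c ∧ c ≤ 1 ∧ ∃ C : ℝ, 0 < C ∧ ∀ x : ℝ, 16 ≤ x →
    |mertens x| ≤ C * x * Real.exp (-c * vkExp x) := by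
  obtain ⟨c₁, hc₁, C, hC, hmain⟩ := exists_abs_sum_moebius_weighted_le_exp
  set c := min c₁ 1 with hcdef
  have hc : 0 < c := by positivity
  refine ⟨c / 2, by positivity, by linarith [min_le_right c₁ 1], 5 * C + 2, by positivity,
    fun x hx => ?_⟩
  have hx0 : 0 < x := by linarith
  have hY := one_le_vkExp hx
  set e := Real.exp (-(c / 2) * vkExp x) with he
  have he0 : 0 < e := Real.exp_pos _
  have he1 : e ≤ 1 := Real.exp_le_one_iff.mpr (by nlinarith)
  have hbd : ∀ y, x ≤ y → |∑ n ∈ Icc 1 ⌊y⌋₊, (ArithmeticFunction.moebius n : ℝ) * (y - n)| ≤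
      C * y ^ 2 * e ^ 2 := by
    intro y hy
    have hy0 : 0 < y := by linarith
    rw [sum_moebius_mul_sub_eq hy0, abs_mul, abs_of_pos hy0]
    have h1 : Real.exp (-c₁ * vkExp y) ≤ e ^ 2 := by
      rw [he, ← Real.exp_nat_mul]
      apply Real.exp_le_exp.mpr
      have h2 := vkExp_mono hx hy
      have h3 : c ≤ c₁ := min_le_left _ _
      have h4 : c * vkExp x ≤ c₁ * vkExp y := by gcongr
      push_cast
      linarith
    calc _ ≤ y * (C * y * Real.exp (-c₁ * vkExp y)) := by
          gcongr; exact hmain y (hx.trans hy)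
      _ ≤ y * (C * y * e ^ 2) := by gcongr
      _ = _ := by ring
  have hxe : 1 ≤ x * e := by
    have h1 : Real.exp (Real.log x) = x := Real.exp_log hx0
    nth_rewrite 1 [← h1]
    rw [he, ← Real.exp_add]
    apply Real.one_le_exp
    have h2 := vkExp_le_log hx
    have h3 : c ≤ 1 := min_le_right _ _
    nlinarith
  have hh : 0 < x * e := by positivity
  have hkey := abs_mul_mertens_le hx0.le hh
  have h1 := hbd (x + x * e) (by linarith)
  have h2 := hbd x le_rfl
  have h3 : (x + x * e) ^ 2 ≤ 4 * x ^ 2 := by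
    calc _ ≤ (x + x * 1) ^ 2 := by gcongr
      _ = _ := by ring
  have h4 : C * (x + x * e) ^ 2 * e ^ 2 ≤ C * (4 * x ^ 2) * e ^ 2 := by gcongr
  have h5 : x * e * |mertens x| ≤ x * e * ((5 * C + 2) * x * e) := by
    calc _ ≤ C * (4 * x ^ 2) * e ^ 2 + C * x ^ 2 * e ^ 2 + x * e * (x * e + 1) := by linarith
      _ ≤ C * (4 * x ^ 2) * e ^ 2 + C * x ^ 2 * e ^ 2 + x * e * (x * e + x * e) := by gcongr
      _ = _ := by ring
  exact le_of_mul_le_mul_left h5 hh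

lemma div_le_vkExp_of_rpow_le {K x z : ℝ} (hK : 1 ≤ K) (hx : 16 ≤ x)
    (hxz : x ^ (1 / K) ≤ z) (hx' : 16 ≤ x ^ (1 / K)) : vkExp x / K ≤ vkExp z := by
  refine le_trans ?_ (vkExp_mono hx' hxz)
  have hL := one_le_log_of_le hx
  have hΛ' := one_le_log_log hx'
  have hlog : Real.log (x ^ (1 / K)) = Real.log x / K := by
    rw [Real.log_rpow (by linarith)]; ring
  have hL' := one_le_log_of_le hx'
  have hΛle : Real.log (Real.log (x ^ (1 / K))) ≤ Real.log (Real.log x) := by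
    refine Real.log_le_log (by linarith) ?_
    rw [hlog]
    exact div_le_self (by linarith) hK
  have h1 : Real.log x ^ (3 / 5 : ℝ) / K ≤ Real.log (x ^ (1 / K)) ^ (3 / 5 : ℝ) := by
    rw [hlog, Real.div_rpow (by linarith) (by linarith)]
    refine div_le_div_of_nonneg_left (by positivity) (by positivity) ?_
    calc K ^ (3 / 5 : ℝ) ≤ K ^ (1 : ℝ) := Real.rpow_le_rpow_of_exponent_le hK (by norm_num)
      _ = K := Real.rpow_one K
  rw [vkExp, vkExp, div_right_comm]
  gcongr

/-- The Vinogradov–Korobov bound for the Mertens function at arguments that are at least a fixed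
root of `x`. -/
lemma exists_abs_mertens_le_of_rpow_le {K : ℝ} (hK : 1 ≤ K) :
    ∃ c : ℝ, 0 < c ∧ c ≤ 1 ∧ ∃ C : ℝ, 0 < C ∧ ∀ x : ℝ, 16 ≤ x → ∀ z : ℝ, x ^ (1 / K) ≤ z →
      |mertens z| ≤ C * z * Real.exp (-c * vkExp x) := by
  obtain ⟨c, hc, hc1, C, hC, h⟩ := exists_abs_mertens_le
  have hK0 : 0 < K := by linarith
  refine ⟨c / K, by positivity, (div_le_self hc.le hK).trans hc1,
    max C ((16 : ℝ) ^ K), by positivity, fun x hx z hz => ?_⟩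
  have hx0 : 0 < x := by linarith
  have hz0 : 0 < z := (by positivity : 0 < x ^ (1 / K)).trans_le hz
  rcases le_total 16 (x ^ (1 / K)) with h16 | h16
  · refine (h z (h16.trans hz)).trans ?_
    have h1 := div_le_vkExp_of_rpow_le hK hx hz h16
    have h2 : Real.exp (-c * vkExp z) ≤ Real.exp (-(c / K) * vkExp x) := by
      apply Real.exp_le_exp.mpr
      have := mul_le_mul_of_nonneg_left h1 hc.le
      have h3 : c / K * vkExp x = c * (vkExp x / K) := by ring
      linarith
    gcongr
    exact le_max_left _ _
  · refine (abs_mertens_le hz0.le).trans ?_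
    have hxK : x ≤ (16 : ℝ) ^ K := by
      calc x = (x ^ (1 / K)) ^ K := by
            rw [← Real.rpow_mul hx0.le, one_div_mul_cancel hK0.ne', Real.rpow_one]
        _ ≤ _ := by gcongr
    have h1 : 1 ≤ x * Real.exp (-(c / K) * vkExp x) := by
      nth_rewrite 1 [← Real.exp_log hx0]
      rw [← Real.exp_add]
      apply Real.one_le_exp
      have h2 := vkExp_le_log hx
      have h3 := one_le_vkExp hx
      have h4 : c / K ≤ 1 := (div_le_self hc.le hK).trans hc1
      nlinarith
    have h2 : x ≤ max C ((16 : ℝ) ^ K) := hxK.trans (le_max_right _ _)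
    calc z ≤ z * (x * Real.exp (-(c / K) * vkExp x)) := le_mul_of_one_le_right hz0.le h1
      _ ≤ z * (max C ((16 : ℝ) ^ K) * Real.exp (-(c / K) * vkExp x)) := by gcongr
      _ = _ := by ring

/-- The arithmetic function supported on `k`-th powers whose value at `m ^ k` is `u m`. -/
def kthPow (k : ℕ) (u : ArithmeticFunction ℤ) : ArithmeticFunction ℤ :=
  ⟨fun n => ∑ m ∈ n.divisors, if m ^ k = n then u m else 0, by simp⟩

lemma kthPow_apply_pow {k m : ℕ} (hk : k ≠ 0) (u : ArithmeticFunction ℤ) :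
    kthPow k u (m ^ k) = u m := by
  rcases eq_or_ne m 0 with rfl | hm
  · simp [hk]
  change ∑ l ∈ (m ^ k).divisors, (if l ^ k = m ^ k then u l else 0) = u m
  rw [sum_eq_single m]
  · simp
  · intro l _ hl
    exact if_neg fun h => hl (Nat.pow_left_injective hk h)
  · intro h
    exact absurd (Nat.mem_divisors.mpr ⟨dvd_pow_self m hk, pow_ne_zero k hm⟩) h

lemma kthPow_apply_of_forall_ne {k n : ℕ} (u : ArithmeticFunction ℤ) (hn : ∀ m, m ^ k ≠ n) :
    kthPow k u n = 0 := by
  change ∑ m ∈ n.divisors, (if m ^ k = n then u m else 0) = 0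
  exact sum_eq_zero fun m _ => if_neg (hn m)

lemma kthPow_mul {k : ℕ} (hk : k ≠ 0) (u v : ArithmeticFunction ℤ) :
    kthPow k (u * v) = kthPow k u * kthPow k v := by
  ext n
  by_cases hn : ∃ q, q ^ k = n
  · obtain ⟨q, rfl⟩ := hn
    rw [kthPow_apply_pow hk, ArithmeticFunction.mul_apply, ArithmeticFunction.mul_apply]
    refine sum_of_injOn (fun a => (a.1 ^ k, a.2 ^ k)) ?_ ?_ ?_ ?_
    · rintro ⟨a, b⟩ - ⟨c, d⟩ - h
      simp only [Prod.mk.injEq] at h ⊢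
      exact ⟨Nat.pow_left_injective hk h.1, Nat.pow_left_injective hk h.2⟩
    · rintro ⟨a, b⟩ h
      simp only [mem_coe, Nat.mem_divisorsAntidiagonal] at h ⊢
      exact ⟨by rw [← mul_pow, h.1], pow_ne_zero k h.2⟩
    · rintro ⟨a, b⟩ h hnot
      rw [Nat.mem_divisorsAntidiagonal] at h
      by_contra hne
      obtain ⟨ha, hb⟩ := mul_ne_zero_iff.mp hne
      obtain ⟨c, rfl⟩ : ∃ c, c ^ k = a := by
        by_contra! h0; exact ha (kthPow_apply_of_forall_ne u h0)
      obtain ⟨d, rfl⟩ : ∃ d, d ^ k = b := by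
        by_contra! h0; exact hb (kthPow_apply_of_forall_ne v h0)
      refine hnot ⟨(c, d), ?_, rfl⟩
      simp only [mem_coe, Nat.mem_divisorsAntidiagonal]
      refine ⟨Nat.pow_left_injective hk (by simpa [mul_pow] using h.1), ?_⟩
      rintro rfl
      exact h.2 (by simp [hk])
    · rintro ⟨a, b⟩ -
      simp only [kthPow_apply_pow hk]
  · push Not at hn
    rw [kthPow_apply_of_forall_ne _ hn, ArithmeticFunction.mul_apply]
    symm
    refine sum_eq_zero fun a ha => ?_
    rw [Nat.mem_divisorsAntidiagonal] at ha
    by_contra hne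
    obtain ⟨h1, h2⟩ := mul_ne_zero_iff.mp hne
    obtain ⟨c, hc⟩ : ∃ c, c ^ k = a.1 := by
      by_contra! h0; exact h1 (kthPow_apply_of_forall_ne u h0)
    obtain ⟨d, hd⟩ : ∃ d, d ^ k = a.2 := by
      by_contra! h0; exact h2 (kthPow_apply_of_forall_ne v h0)
    exact hn (c * d) (by rw [mul_pow, hc, hd, ha.1])

lemma kthPow_one {k : ℕ} (hk : k ≠ 0) : kthPow k 1 = 1 := by
  ext n
  by_cases hn : ∃ q, q ^ k = n
  · obtain ⟨q, rfl⟩ := hn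
    rw [kthPow_apply_pow hk, ArithmeticFunction.one_apply, ArithmeticFunction.one_apply]
    simp [hk]
  · push Not at hn
    rw [kthPow_apply_of_forall_ne _ hn, ArithmeticFunction.one_apply_ne]
    rintro rfl
    exact hn 1 (one_pow k)

lemma isMultiplicative_kthPow {k : ℕ} (hk : k ≠ 0) {u : ArithmeticFunction ℤ}
    (hu : u.IsMultiplicative) : (kthPow k u).IsMultiplicative := by
  refine ⟨by simpa [hu.map_one] using kthPow_apply_pow (m := 1) hk u, fun {m n} hmn => ?_⟩
  by_cases hm : ∃ a, a ^ k = m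
  · by_cases hn : ∃ b, b ^ k = n
    · obtain ⟨a, rfl⟩ := hm
      obtain ⟨b, rfl⟩ := hn
      rw [← mul_pow, kthPow_apply_pow hk, kthPow_apply_pow hk, kthPow_apply_pow hk]
      refine hu.map_mul_of_coprime ?_
      exact (Nat.coprime_pow_left_iff (Nat.pos_of_ne_zero hk) _ _).mp
        ((Nat.coprime_pow_right_iff (Nat.pos_of_ne_zero hk) _ _).mp hmn)
    · push Not at hn
      rw [kthPow_apply_of_forall_ne u hn, mul_zero]
      refine kthPow_apply_of_forall_ne u fun q hq => ?_
      obtain ⟨b, hb⟩ := exists_eq_pow_of_mul_eq_pow (a := n) (b := m) (c := q) (k := k)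
        (by rw [gcd_comm]; exact Nat.isUnit_iff.mpr hmn) (by rw [mul_comm, hq])
      exact hn b hb.symm
  · push Not at hm
    rw [kthPow_apply_of_forall_ne u hm, zero_mul]
    refine kthPow_apply_of_forall_ne u fun q hq => ?_
    obtain ⟨a, ha⟩ := exists_eq_pow_of_mul_eq_pow (a := m) (b := n) (c := q) (k := k)
      (Nat.isUnit_iff.mpr hmn) hq.symm
    exact hm a ha.symm

lemma kthPow_zeta_mul_kthPow_moebius {k : ℕ} (hk : k ≠ 0) :
    kthPow k (ArithmeticFunction.zeta : ArithmeticFunction ℤ) *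
      kthPow k ArithmeticFunction.moebius = 1 := by
  rw [← kthPow_mul hk, ArithmeticFunction.coe_zeta_mul_moebius, kthPow_one hk]

/-- Summing `kthPow k μ` over an interval amounts to summing `μ` up to the `k`-th root. -/
lemma sum_kthPow_moebius {k : ℕ} (hk : k ≠ 0) (y : ℝ) (hy : 0 ≤ y) :
    ((∑ n ∈ Ioc 0 ⌊y⌋₊, kthPow k ArithmeticFunction.moebius n : ℤ) : ℝ) =
      mertens (y ^ (1 / (k : ℝ))) := by
  have hk0 : (k : ℝ) ≠ 0 := by exact_mod_cast hk
  have hmem : ∀ m : ℕ, m ≤ ⌊y ^ (1 / (k : ℝ))⌋₊ ↔ m ^ k ≤ ⌊y⌋₊ := by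
    intro m
    rw [Nat.le_floor_iff (by positivity), Nat.le_floor_iff hy, one_div,
      Real.le_rpow_inv_iff_of_pos (by positivity) hy (by positivity)]
    norm_cast
  rw [mertens]
  push_cast
  symm
  refine sum_of_injOn (fun m => m ^ k) (fun a _ b _ h => Nat.pow_left_injective hk h) ?_ ?_ ?_
  · intro m hm
    simp only [coe_Icc, Set.mem_Icc, coe_Ioc, Set.mem_Ioc] at hm ⊢
    exact ⟨pow_pos hm.1 k, (hmem m).mp hm.2⟩
  · intro n hn hnot
    rw [kthPow_apply_of_forall_ne, Int.cast_zero]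
    rintro m rfl
    refine hnot ⟨m, ?_, rfl⟩
    rw [mem_Ioc] at hn
    simp only [coe_Icc, Set.mem_Icc]
    exact ⟨Nat.pos_of_ne_zero fun h => by simp [h, hk] at hn, (hmem m).mpr hn.2⟩
  · intro m _
    rw [kthPow_apply_pow hk]

lemma summable_add_mul_geometric (a : ℝ) {q : ℝ} (hq0 : 0 ≤ q) (hq1 : q < 1) :
    Summable fun j : ℕ => ((j : ℝ) + a) * q ^ j := by
  have hq : ‖q‖ < 1 := by rwa [Real.norm_of_nonneg hq0]
  have h1 := summable_pow_mul_geometric_of_norm_lt_one 1 hq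
  have h2 := (summable_geometric_of_lt_one hq0 hq1).mul_left a
  refine (h1.add h2).congr fun j => ?_
  ring

lemma tsum_le_one_add_of_vanishing {v : ℕ → ℝ} {q q₀ : ℝ} {r : ℕ} (hr : 0 < r) (hv0 : v 0 = 1)
    (hvanish : ∀ j, 1 ≤ j → j < r → v j = 0) (hv : ∀ j, 0 ≤ v j)
    (hle : ∀ j, v j ≤ ((j : ℝ) + 1) * q ^ j) (hq : 0 ≤ q) (hqq : q ≤ q₀) (hq₀ : q₀ < 1) :
    ∑' j, v j ≤ 1 + q ^ r * ∑' i : ℕ, ((i : ℝ) + (r + 1)) * q₀ ^ i := by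
  have hsum : Summable v := Summable.of_nonneg_of_le hv hle
    (summable_add_mul_geometric 1 hq (hqq.trans_lt hq₀))
  rw [← hsum.sum_add_tsum_nat_add r, sum_eq_single 0, hv0, ← tsum_mul_left]
  · gcongr 1 + ?_
    refine Summable.tsum_le_tsum (fun i => ?_) ((summable_nat_add_iff r).mpr hsum)
      ((summable_add_mul_geometric _ (hq.trans hqq) hq₀).mul_left _)
    refine (hle _).trans ?_
    push_cast
    calc ((i : ℝ) + r + 1) * q ^ (i + r) = q ^ r * (((i : ℝ) + (r + 1)) * q ^ i) := by
          rw [pow_add]; ring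
      _ ≤ _ := by gcongr
  · intro j hj hj0
    exact hvanish j (Nat.one_le_iff_ne_zero.mpr hj0) (mem_range.mp hj)
  · intro h
    exact absurd (mem_range.mpr hr) h

/-- Absolute convergence of the Dirichlet series of a multiplicative function whose first nonzero
values at prime powers occur at the `r`-th powers. -/
lemma summable_abs_mul_rpow_of_vanishing {g : ArithmeticFunction ℤ} (hg : g.IsMultiplicative)
    {r : ℕ} (hr : 0 < r) {s : ℝ} (hs : 0 < s) (hsr : 1 < s * r)
    (hvanish : ∀ p : ℕ, p.Prime → ∀ j, 1 ≤ j → j < r → g (p ^ j) = 0)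
    (hle : ∀ p : ℕ, p.Prime → ∀ j : ℕ, |(g (p ^ j) : ℝ)| ≤ (j : ℝ) + 1) :
    Summable fun d : ℕ => |(g d : ℝ)| * (d : ℝ) ^ (-s) := by
  set h : ℕ → ℝ := fun d => |(g d : ℝ)| * (d : ℝ) ^ (-s) with hh
  have hnn : ∀ d, 0 ≤ h d := fun d => by simp only [hh]; positivity
  have h1 : h 1 = 1 := by simp [hh, hg.map_one]
  have hmul : ∀ {m n : ℕ}, m.Coprime n → h (m * n) = h m * h n := by
    intro m n hmn
    simp only [hh]
    rw [hg.map_mul_of_coprime hmn]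
    push_cast
    rw [abs_mul, Real.mul_rpow (by positivity) (by positivity)]
    ring
  set q₀ : ℝ := (2 : ℝ) ^ (-s) with hq₀
  have hq₀1 : q₀ < 1 := Real.rpow_lt_one_of_one_lt_of_neg (by norm_num) (by linarith)
  have hq : ∀ p : ℕ, p.Prime → (p : ℝ) ^ (-s) ≤ q₀ := fun p hp =>
    Real.rpow_le_rpow_of_nonpos (by norm_num) (by exact_mod_cast hp.two_le) (by linarith)
  have hpow : ∀ p j : ℕ, h (p ^ j) = |(g (p ^ j) : ℝ)| * ((p : ℝ) ^ (-s)) ^ j := by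
    intro p j
    simp only [hh]
    rw [Nat.cast_pow, ← Real.rpow_natCast, ← Real.rpow_mul (by positivity), mul_comm (j : ℝ),
      Real.rpow_mul (by positivity), Real.rpow_natCast]
  have hhle : ∀ p : ℕ, p.Prime → ∀ j : ℕ, h (p ^ j) ≤ ((j : ℝ) + 1) * ((p : ℝ) ^ (-s)) ^ j := by
    intro p hp j
    rw [hpow]
    have := hle p hp j
    gcongr
  have hprime : ∀ {p : ℕ}, p.Prime → Summable fun n : ℕ => ‖h (p ^ n)‖ := by
    intro p hp
    refine Summable.of_nonneg_of_le (fun n => norm_nonneg _) (fun n => ?_)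
      (summable_add_mul_geometric 1 (by positivity) ((hq p hp).trans_lt hq₀1))
    rw [Real.norm_of_nonneg (hnn _)]
    exact hhle p hp n
  set K : ℝ := ∑' i : ℕ, ((i : ℝ) + (r + 1)) * q₀ ^ i with hK
  have hK0 : 0 ≤ K := tsum_nonneg fun i => by positivity
  have hlocal : ∀ p : ℕ, p.Prime → ∑' n, h (p ^ n) ≤ Real.exp (K * (p : ℝ) ^ (-(s * r))) := by
    intro p hp
    have h2 := tsum_le_one_add_of_vanishing (v := fun n => h (p ^ n)) hr (by simpa using h1)
      (fun j hj hjr => by simp [hpow, hvanish p hp j hj hjr]) (fun j => hnn _)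
      (hhle p hp) (by positivity) (hq p hp) hq₀1
    have h3 : ((p : ℝ) ^ (-s)) ^ r = (p : ℝ) ^ (-(s * r)) := by
      rw [← Real.rpow_natCast, ← Real.rpow_mul (by positivity)]
      ring_nf
    rw [h3] at h2
    refine h2.trans ?_
    have := Real.add_one_le_exp (K * (p : ℝ) ^ (-(s * r)))
    linarith
  have hzeta : Summable fun n : ℕ => (n : ℝ) ^ (-(s * r)) :=
    Real.summable_nat_rpow.mpr (by linarith)
  have hprod : ∀ N : ℕ, ∏ p ∈ N.primesBelow, ∑' n : ℕ, h (p ^ n) ≤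
      Real.exp (K * ∑' n : ℕ, (n : ℝ) ^ (-(s * r))) := by
    intro N
    calc _ ≤ ∏ p ∈ N.primesBelow, Real.exp (K * (p : ℝ) ^ (-(s * r))) :=
          prod_le_prod (fun p _ => tsum_nonneg fun n => hnn _)
            fun p hp => hlocal p (Nat.prime_of_mem_primesBelow hp)
      _ = Real.exp (K * ∑ p ∈ N.primesBelow, (p : ℝ) ^ (-(s * r))) := by
          rw [← Real.exp_sum, mul_sum]
      _ ≤ _ := by
          apply Real.exp_le_exp.mpr
          gcongr
          exact hzeta.sum_le_tsum _ fun n _ => by positivity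
  refine summable_of_sum_le hnn (c := Real.exp (K * ∑' n : ℕ, (n : ℝ) ^ (-(s * r)))) fun u => ?_
  have hzero : h 0 = 0 := by simp [hh]
  obtain ⟨N, hN⟩ : ∃ N, ∀ d ∈ u, d < N := ⟨u.sup id + 1, fun d hd =>
    Nat.lt_succ_of_le (le_sup (f := id) hd)⟩
  obtain ⟨hsm, hhas⟩ := EulerProduct.summable_and_hasSum_smoothNumbers_prod_primesBelow_tsum
    h1 hmul hprime N
  refine le_trans ?_ (hprod N)
  rw [← hhas.tsum_eq]
  have hsm' : Summable ((N.smoothNumbers).indicator h) :=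
    summable_subtype_iff_indicator.mp hhas.summable
  rw [_root_.tsum_subtype]
  refine le_trans (sum_le_sum fun d hd => ?_)
    (hsm'.sum_le_tsum u fun d _ => Set.indicator_nonneg (fun d _ => hnn d) d)
  rcases eq_or_ne d 0 with rfl | hd0
  · rw [hzero]
    exact Set.indicator_nonneg (fun d _ => hnn d) 0
  · rw [Set.indicator_of_mem]
    exact Nat.mem_smoothNumbers_of_lt (Nat.pos_of_ne_zero hd0) (hN d hd)

lemma mul_apply_prime_pow (u v : ArithmeticFunction ℤ) {p : ℕ} (hp : p.Prime) (j : ℕ) :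
    (u * v) (p ^ j) = ∑ i ∈ range (j + 1), u (p ^ i) * v (p ^ (j - i)) := by
  rw [ArithmeticFunction.mul_apply, Nat.sum_divisorsAntidiagonal fun a b => u a * v b,
    Nat.sum_divisors_prime_pow hp]
  refine sum_congr rfl fun i hi => ?_
  rw [Nat.pow_div (mem_range_succ_iff.mp hi) hp.pos]

lemma abs_kthPow_zeta_le {k : ℕ} (hk : k ≠ 0) (n : ℕ) :
    |kthPow k (ArithmeticFunction.zeta : ArithmeticFunction ℤ) n| ≤ 1 := by
  by_cases h : ∃ m, m ^ k = n
  · obtain ⟨m, rfl⟩ := h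
    rw [kthPow_apply_pow hk, ArithmeticFunction.natCoe_apply, ArithmeticFunction.zeta_apply]
    split_ifs <;> simp
  · rw [kthPow_apply_of_forall_ne _ fun m hm => h ⟨m, hm⟩]
    simp

lemma kthPow_prime_pow_eq_zero (u : ArithmeticFunction ℤ) {k p j : ℕ} (hp : p.Prime) (hj : 1 ≤ j)
    (hjk : j < k) : kthPow k u (p ^ j) = 0 := by
  refine kthPow_apply_of_forall_ne _ fun m hm => ?_
  have h := congrArg (fun n => n.factorization p) hm
  simp only [Nat.factorization_pow, Finsupp.smul_apply, smul_eq_mul, hp.factorization_self,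
    mul_one] at h
  exact absurd (Nat.le_of_dvd hj (Dvd.intro _ h)) (by lia)

lemma mul_kthPow_zeta_prime_pow_eq_zero {F : ArithmeticFunction ℤ} (hF : F.IsMultiplicative)
    {k p : ℕ} (hk : k ≠ 0) (hp : p.Prime) (hzero : ∀ j, 1 ≤ j → j < k → F (p ^ j) = 0)
    (hFk : F (p ^ k) = -1) {j : ℕ} (hj : 1 ≤ j) (hjk : j ≤ k) :
    (F * kthPow k (ArithmeticFunction.zeta : ArithmeticFunction ℤ)) (p ^ j) = 0 := by
  have hP := isMultiplicative_kthPow hk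
    (ArithmeticFunction.isMultiplicative_zeta.natCast (R := ℤ))
  rw [mul_apply_prime_pow _ _ hp]
  obtain ⟨i, rfl⟩ := Nat.exists_eq_add_of_le' hj
  rw [sum_range_succ, sum_range_succ']
  have hmid : ∑ l ∈ range i, F (p ^ (l + 1)) *
      kthPow k (ArithmeticFunction.zeta : ArithmeticFunction ℤ) (p ^ (i + 1 - (l + 1))) = 0 :=
    sum_eq_zero fun l hl => by
      rw [hzero _ (by lia) (by have := mem_range.mp hl; lia), zero_mul]
  rw [hmid, pow_zero, hF.map_one, Nat.sub_self, pow_zero, hP.map_one, Nat.sub_zero]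
  rcases hjk.eq_or_lt with rfl | hlt
  · rw [hFk, kthPow_apply_pow hk, ArithmeticFunction.natCoe_apply,
      ArithmeticFunction.zeta_apply_ne hp.ne_zero]
    norm_num
  · rw [hzero _ hj hlt, kthPow_prime_pow_eq_zero _ hp hj hlt]
    norm_num

lemma abs_mul_kthPow_zeta_prime_pow_le {F : ArithmeticFunction ℤ} {k p : ℕ} (hk : k ≠ 0)
    (hp : p.Prime) (hF : ∀ j, |F (p ^ j)| ≤ 1) (j : ℕ) :
    |(F * kthPow k (ArithmeticFunction.zeta : ArithmeticFunction ℤ)) (p ^ j)| ≤ j + 1 := by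
  rw [mul_apply_prime_pow _ _ hp]
  refine (abs_sum_le_sum_abs _ _).trans ?_
  calc _ ≤ ∑ i ∈ range (j + 1), (1 : ℤ) := sum_le_sum fun i _ => by
        rw [abs_mul]
        exact mul_le_one₀ (hF i) (abs_nonneg _) (abs_kthPow_zeta_le hk _)
    _ = _ := by simp

lemma sum_eq_sum_mul_mertens (F : ArithmeticFunction ℤ) {k : ℕ} (hk : k ≠ 0) {x : ℝ} (hx : 0 ≤ x) :
    ∑ n ∈ Ioc 0 ⌊x⌋₊, (F n : ℝ) =
      ∑ d ∈ Ioc 0 ⌊x⌋₊, ((F * kthPow k (ArithmeticFunction.zeta : ArithmeticFunction ℤ)) d : ℝ) *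
        mertens ((x / d) ^ (1 / (k : ℝ))) := by
  have h1 : F = F * kthPow k (ArithmeticFunction.zeta : ArithmeticFunction ℤ) *
      kthPow k ArithmeticFunction.moebius := by
    rw [mul_assoc, kthPow_zeta_mul_kthPow_moebius hk, mul_one]
  have h2 := ArithmeticFunction.sum_Ioc_mul_eq_sum_sum
    (F * kthPow k (ArithmeticFunction.zeta : ArithmeticFunction ℤ))
    (kthPow k ArithmeticFunction.moebius) ⌊x⌋₊
  rw [← h1] at h2
  have h3 := congrArg (Int.cast : ℤ → ℝ) h2
  rw [Int.cast_sum] at h3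
  rw [h3, Int.cast_sum]
  refine sum_congr rfl fun d _ => ?_
  rw [Int.cast_mul, ← Nat.floor_div_natCast, sum_kthPow_moebius hk _ (by positivity)]

/-- Convolving the Mertens function at `k`-th roots with a function whose Dirichlet series converges
absolutely at some `s < 1 / k` preserves the Vinogradov–Korobov bound. -/
lemma exists_abs_sum_mul_mertens_le (g : ℕ → ℤ) {k : ℕ} (hk : 1 ≤ k) {s : ℝ}
    (hs : s < 1 / (k : ℝ)) (hg : Summable fun d : ℕ => |(g d : ℝ)| * (d : ℝ) ^ (-s)) :
    ∃ c : ℝ, 0 < c ∧ ∃ C : ℝ, 0 < C ∧ ∀ x : ℝ, 16 ≤ x →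
      |∑ d ∈ Ioc 0 ⌊x⌋₊, (g d : ℝ) * mertens ((x / d) ^ (1 / (k : ℝ)))| ≤
        C * x ^ (1 / (k : ℝ)) * Real.exp (-c * vkExp x) := by
  have hk1 : (1 : ℝ) ≤ k := by exact_mod_cast hk
  obtain ⟨c, hc, -, C, hC, h⟩ := exists_abs_mertens_le_of_rpow_le (K := 2 * k) (by linarith)
  set η : ℝ := 1 / (k : ℝ) - s with hη
  have hη0 : 0 < η := by linarith
  set G : ℝ := ∑' d : ℕ, |(g d : ℝ)| * (d : ℝ) ^ (-s) with hG
  have hG0 : 0 ≤ G := tsum_nonneg fun d => by positivity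
  refine ⟨min c (η / 2), by positivity, (max C 1) * (G + 1), by positivity, fun x hx => ?_⟩
  have hx0 : 0 < x := by linarith
  have hV := one_le_vkExp hx
  set E : ℝ := Real.exp (-(min c (η / 2)) * vkExp x) with hE
  have hterm : ∀ d ∈ Ioc 0 ⌊x⌋₊, |(g d : ℝ) * mertens ((x / d) ^ (1 / (k : ℝ)))| ≤
      max C 1 * x ^ (1 / (k : ℝ)) * E * (|(g d : ℝ)| * (d : ℝ) ^ (-s)) := by
    intro d hd
    have hd1 : (1 : ℝ) ≤ d := by exact_mod_cast (mem_Ioc.mp hd).1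
    have hd0 : (0 : ℝ) < d := by linarith
    rw [abs_mul]
    suffices hM : |mertens ((x / d) ^ (1 / (k : ℝ)))| ≤
        max C 1 * x ^ (1 / (k : ℝ)) * E * (d : ℝ) ^ (-s) by
      calc _ ≤ |(g d : ℝ)| * (max C 1 * x ^ (1 / (k : ℝ)) * E * (d : ℝ) ^ (-s)) := by gcongr
        _ = _ := by ring
    have hsplit : (x / d) ^ (1 / (k : ℝ)) = x ^ (1 / (k : ℝ)) * (d : ℝ) ^ (-s) *
        (d : ℝ) ^ (-η) := by
      rw [mul_assoc, ← Real.rpow_add hd0, Real.div_rpow hx0.le hd0.le, div_eq_mul_inv,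
        ← Real.rpow_neg hd0.le]
      congr 2
      ring
    rcases le_total (d : ℝ) (x ^ (1 / 2 : ℝ)) with hdx | hdx
    · have hz : x ^ (1 / (2 * (k : ℝ))) ≤ (x / d) ^ (1 / (k : ℝ)) := by
        have h1 : x ^ (1 / 2 : ℝ) ≤ x / d := by
          rw [le_div_iff₀ hd0]
          calc x ^ (1 / 2 : ℝ) * d ≤ x ^ (1 / 2 : ℝ) * x ^ (1 / 2 : ℝ) := by gcongr
            _ = x := by rw [← Real.rpow_add hx0]; norm_num
        calc x ^ (1 / (2 * (k : ℝ))) = (x ^ (1 / 2 : ℝ)) ^ (1 / (k : ℝ)) := by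
              rw [← Real.rpow_mul hx0.le]
              congr 1
              field_simp
          _ ≤ _ := by gcongr
      refine (h x hx _ hz).trans ?_
      rw [hsplit]
      have h2 : (d : ℝ) ^ (-η) ≤ 1 := Real.rpow_le_one_of_one_le_of_nonpos hd1 (by linarith)
      have h3 : Real.exp (-c * vkExp x) ≤ E := by
        apply Real.exp_le_exp.mpr
        have := min_le_left c (η / 2)
        nlinarith
      calc _ ≤ max C 1 * (x ^ (1 / (k : ℝ)) * (d : ℝ) ^ (-s) * 1) * E := by
            gcongr
            exact le_max_left _ _
        _ = _ := by ring
    · refine (abs_mertens_le (by positivity)).trans ?_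
      rw [hsplit]
      have h2 : (d : ℝ) ^ (-η) ≤ E := by
        calc (d : ℝ) ^ (-η) ≤ (x ^ (1 / 2 : ℝ)) ^ (-η) :=
              Real.rpow_le_rpow_of_nonpos (by positivity) hdx (by linarith)
          _ = Real.exp (Real.log x * (-(η / 2))) := by
              rw [← Real.rpow_mul hx0.le, Real.rpow_def_of_pos hx0]
              ring_nf
          _ ≤ E := by
              apply Real.exp_le_exp.mpr
              have := min_le_right c (η / 2)
              have := vkExp_le_log hx
              nlinarith
      calc _ ≤ 1 * (x ^ (1 / (k : ℝ)) * (d : ℝ) ^ (-s) * E) := by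
            rw [one_mul]; gcongr
        _ ≤ max C 1 * (x ^ (1 / (k : ℝ)) * (d : ℝ) ^ (-s) * E) := by
            gcongr
            exact le_max_right _ _
        _ = _ := by ring
  refine (abs_sum_le_sum_abs _ _).trans ((sum_le_sum hterm).trans ?_)
  rw [← mul_sum]
  have h4 : ∑ d ∈ Ioc 0 ⌊x⌋₊, |(g d : ℝ)| * (d : ℝ) ^ (-s) ≤ G + 1 :=
    (hg.sum_le_tsum _ fun d _ => by positivity).trans (by linarith)
  calc _ ≤ max C 1 * x ^ (1 / (k : ℝ)) * E * (G + 1) := by gcongr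
    _ = _ := by ring

/-- The Vinogradov–Korobov bound for the partial sums of a multiplicative function which vanishes at
the first `k - 1` powers of every prime and is `-1` at the `k`-th. -/
theorem exists_abs_sum_le {F : ArithmeticFunction ℤ} (hF : F.IsMultiplicative) {k : ℕ} (hk : 1 ≤ k)
    (hle : ∀ p : ℕ, p.Prime → ∀ j, |F (p ^ j)| ≤ 1)
    (hzero : ∀ p : ℕ, p.Prime → ∀ j, 1 ≤ j → j < k → F (p ^ j) = 0)
    (hFk : ∀ p : ℕ, p.Prime → F (p ^ k) = -1) :
    ∃ c : ℝ, 0 < c ∧ ∃ C : ℝ, 0 < C ∧ ∀ x : ℝ, 16 ≤ x →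
      |∑ n ∈ Ioc 0 ⌊x⌋₊, (F n : ℝ)| ≤ C * x ^ (1 / (k : ℝ)) * Real.exp (-c * vkExp x) := by
  have hk0 : k ≠ 0 := by lia
  have hk1 : (1 : ℝ) ≤ k := by exact_mod_cast hk
  have hP := isMultiplicative_kthPow hk0
    (ArithmeticFunction.isMultiplicative_zeta.natCast (R := ℤ))
  obtain ⟨s, hs1, hs2⟩ := exists_between
    (one_div_lt_one_div_of_lt (by linarith) (lt_add_one (k : ℝ)))
  have hs0 : 0 < s := lt_trans (by positivity) hs1
  have hsum := summable_abs_mul_rpow_of_vanishing (hF.mul hP) (r := k + 1) (by lia) hs0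
    (by push_cast; rwa [div_lt_iff₀ (by linarith)] at hs1)
    (fun p hp j hj hjk => mul_kthPow_zeta_prime_pow_eq_zero hF hk0 hp (hzero p hp) (hFk p hp) hj
      (by lia))
    (fun p hp j => by exact_mod_cast abs_mul_kthPow_zeta_prime_pow_le hk0 hp (hle p hp) j)
  obtain ⟨c, hc, C, hC, h⟩ := exists_abs_sum_mul_mertens_le _ hk hs2 hsum
  refine ⟨c, hc, C, hC, fun x hx => ?_⟩
  rw [sum_eq_sum_mul_mertens F hk0 (by linarith)]
  exact h x hx

end MeanValue

/-- unconditional upper bound, Möbius-type.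
If `f` is a fake μ defined via `(ε_j)` with `ε_j = 0` for `1 ≤ j ≤ k-1` and
`ε_k = -1`, then there are constants `c > 0` and `C > 0` such that for all
`x ≥ 16`, `|Σ_{n ≤ x} f(n)| ≤ C x^{1/k} exp(-c (log x)^{3/5} (log log x)^{-1/5})`. -/
theorem stmt_12 (f : ℕ → ℤ) (ε : ℕ → ℤ)
    (hf1 : f 1 = 1)
    (hmul : ∀ m n : ℕ, Nat.Coprime m n → f (m * n) = f m * f n)
    (hεval : ∀ j : ℕ, 1 ≤ j → ε j = -1 ∨ ε j = 0 ∨ ε j = 1)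
    (hfp : ∀ p : ℕ, Nat.Prime p → ∀ j : ℕ, 1 ≤ j → f (p ^ j) = ε j)
    (k : ℕ) (hk : 1 ≤ k)
    (hzero : ∀ j : ℕ, 1 ≤ j → j ≤ k - 1 → ε j = 0)
    (hεk : ε k = -1) :
    ∃ c : ℝ, 0 < c ∧ ∃ C : ℝ, 0 < C ∧ ∀ x : ℝ, 16 ≤ x →
      |∑ n ∈ Finset.Icc 1 ⌊x⌋₊, (f n : ℝ)| ≤
        C * x ^ (1 / (k : ℝ)) *
          Real.exp (-c * Real.log x ^ ((3 : ℝ) / 5) /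
            Real.log (Real.log x) ^ ((1 : ℝ) / 5)) := by
  set F : ArithmeticFunction ℤ := ⟨fun n => if n = 0 then 0 else f n, if_pos rfl⟩ with hF
  have hFf : ∀ n, n ≠ 0 → F n = f n := fun n hn => if_neg hn
  have hFmul : F.IsMultiplicative := by
    rw [ArithmeticFunction.IsMultiplicative.iff_ne_zero]
    refine ⟨by rw [hFf 1 one_ne_zero, hf1], fun {m n} hm hn hmn => ?_⟩
    rw [hFf _ (mul_ne_zero hm hn), hFf m hm, hFf n hn, hmul m n hmn]
  have hFp : ∀ p : ℕ, p.Prime → ∀ j, 1 ≤ j → F (p ^ j) = ε j := fun p hp j hj => by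
    rw [hFf _ (pow_ne_zero j hp.ne_zero), hfp p hp j hj]
  obtain ⟨c, hc, C, hC, h⟩ := MeanValue.exists_abs_sum_le hFmul hk
    (fun p hp j => by
      rcases Nat.eq_zero_or_pos j with rfl | hj
      · rw [pow_zero, hFmul.map_one, abs_one]
      · rw [hFp p hp j hj]
        rcases hεval j hj with h | h | h <;> simp [h])
    (fun p hp j hj hjk => by rw [hFp p hp j hj, hzero j hj (by lia)])
    (fun p hp => by rw [hFp p hp k hk, hεk])
  refine ⟨c, hc, C, hC, fun x hx => ?_⟩
  have hsum : ∑ n ∈ Finset.Icc 1 ⌊x⌋₊, (f n : ℝ) = ∑ n ∈ Finset.Ioc 0 ⌊x⌋₊, (F n : ℝ) :=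
    Finset.sum_congr rfl fun n hn => by
      rw [hFf n (Nat.one_le_iff_ne_zero.mp (Finset.mem_Icc.mp hn).1)]
  rw [hsum, mul_div_assoc]
  exact h x hx
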